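/- The multiplication map U⁻ ⊗ U'⁰ ⊗ U⁺ → U', a ⊗ b ⊗ c ↦ abc, is a bijection of ℂ-vector spaces, and U'⁰ is isomorphic to the Laurent polynomial algebra ℂ[h_{i,s} : 1 ≤ i ≤ M+N−1, s ∈ ℤ∖{0}][K_i^{±1} : 0 ≤ i ≤ M+N−1]. -/

import Mathlib

noncomputable section

namespace QAS

open Polynomial
open scoped TensorProduct

/-! ### Basic combinatorial data -/

/-- `l_i = 1` for `i ≤ M`, `-1` otherwise. -/
def lof (M : ℕ) (i : ℕ) : ℤ := if i ≤ M then 1 else -1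

/-- the bilinear form `(ε_i, ε_j) = l_i δ_{ij}`. -/
def innerE (M : ℕ) (i j : ℕ) : ℤ := if i = j then lof M i else 0

/-- `(ε_a − ε_b, ε_c − ε_d)`. -/
def form4 (M : ℕ) (a b c d : ℕ) : ℤ :=
  innerE M a c - innerE M a d - innerE M b c + innerE M b d

/-- the Cartan pairing `c_{ij} = (ε_i − ε_{i+1}, ε_j − ε_{j+1})`. -/
def cc (M : ℕ) (i j : ℕ) : ℤ := form4 M i (i + 1) j (j + 1)

/-- `q_i = q^{l_i}`. -/
def qpar (q : ℂ) (M : ℕ) (i : ℕ) : ℂ := q ^ lof M i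

/-- the quantum integer `[m]_v`. -/
def qint (v : ℂ) (m : ℤ) : ℂ := (v ^ m - v ^ (-m)) / (v - v⁻¹)

/-- the sign `(−1)^{|X_i||X_j|}` for the generators `X_i`, `X_j`. -/
def sgn (M : ℕ) (i j : ℕ) : ℂ := if i = M ∧ j = M then -1 else 1

/-- index set `1 ≤ i ≤ M+N−1`. -/
abbrev Idx (M N : ℕ) := {i : ℕ // 1 ≤ i ∧ i ≤ M + N - 1}

/-! ### Generators and the free superalgebra -/

/-- Drinfel'd generators; when `ext = true` we also have `K₀^{±1}`. -/
inductive Gen (M N : ℕ) (ext : Bool) : Type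
  | Xp : Idx M N → ℤ → Gen M N ext
  | Xm : Idx M N → ℤ → Gen M N ext
  | K : Idx M N → Gen M N ext
  | Ki : Idx M N → Gen M N ext
  | H : Idx M N → {s : ℤ // s ≠ 0} → Gen M N ext
  | K0 : ext = true → Gen M N ext
  | K0i : ext = true → Gen M N ext

abbrev FA (M N : ℕ) (ext : Bool) := FreeAlgebra ℂ (Gen M N ext)

def gi {M N : ℕ} {ext : Bool} (g : Gen M N ext) : FA M N ext := FreeAlgebra.ι ℂ g

def XpF (M N : ℕ) (ext : Bool) (i : ℕ) (n : ℤ) : FA M N ext :=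
  if h : 1 ≤ i ∧ i ≤ M + N - 1 then gi (Gen.Xp ⟨i, h⟩ n) else 0

def XmF (M N : ℕ) (ext : Bool) (i : ℕ) (n : ℤ) : FA M N ext :=
  if h : 1 ≤ i ∧ i ≤ M + N - 1 then gi (Gen.Xm ⟨i, h⟩ n) else 0

def KF (M N : ℕ) (ext : Bool) (i : ℕ) : FA M N ext :=
  if h : 1 ≤ i ∧ i ≤ M + N - 1 then gi (Gen.K ⟨i, h⟩) else 0

def KiF (M N : ℕ) (ext : Bool) (i : ℕ) : FA M N ext :=
  if h : 1 ≤ i ∧ i ≤ M + N - 1 then gi (Gen.Ki ⟨i, h⟩) else 0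

def HF (M N : ℕ) (ext : Bool) (i : ℕ) (s : ℤ) : FA M N ext :=
  if h : (1 ≤ i ∧ i ≤ M + N - 1) ∧ s ≠ 0 then gi (Gen.H ⟨i, h.1⟩ ⟨s, h.2⟩) else 0

def K0F (M N : ℕ) (ext : Bool) : FA M N ext :=
  if h : ext = true then gi (Gen.K0 h) else 0

def K0iF (M N : ℕ) (ext : Bool) : FA M N ext :=
  if h : ext = true then gi (Gen.K0i h) else 0

/-- coefficients of `exp (t · Σ_{s ≥ 1} a_s z^s)`. -/
def expC {A : Type} [Ring A] [Algebra ℂ A] (t : ℂ) (a : ℕ → A) : ℕ → A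
  | 0 => 1
  | n + 1 =>
      ((n : ℂ) + 1)⁻¹ •
        (t • ∑ s ∈ Finset.range (n + 1), ((s : ℂ) + 1) • (a (s + 1) * expC t a (n - s)))
termination_by n => n
decreasing_by omega

/-- `φ⁺_{i,n}`, the coefficient of `z^n` in
`K_i exp((q_i − q_i⁻¹) Σ_{s>0} h_{i,s} z^s)`. -/
def phiPF (q : ℂ) (M N : ℕ) (ext : Bool) (i : ℕ) (n : ℤ) : FA M N ext :=
  if 0 ≤ n then
    KF M N ext i *
      expC (qpar q M i - (qpar q M i)⁻¹) (fun s => HF M N ext i (s : ℤ)) n.toNat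
  else 0

/-- `φ⁻_{i,n}`, the coefficient of `z^n` (`n ≤ 0`) in
`K_i⁻¹ exp(−(q_i − q_i⁻¹) Σ_{s>0} h_{i,−s} z^{−s})`. -/
def phiMF (q : ℂ) (M N : ℕ) (ext : Bool) (i : ℕ) (n : ℤ) : FA M N ext :=
  if n ≤ 0 then
    KiF M N ext i *
      expC (-(qpar q M i - (qpar q M i)⁻¹)) (fun s => HF M N ext i (-(s : ℤ))) (-n).toNat
  else 0

/-- the `u`-bracket `[x,y]_u = xy − u·yx` (for `x` or `y` of even parity). -/
def brF {A : Type} [Ring A] [Module ℂ A] (u : ℂ) (x y : A) : A := x * y - u • (y * x)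

/-- the quartic oscillation expression
`[[[X_{M−1,m}, X_{M,n}]_{q⁻¹}, X_{M+1,k}]_q, X_{M,u}]` (a graded anticommutator in the
outermost bracket, both entries being odd). -/
def oscOf {A : Type} [Ring A] [Module ℂ A] (q : ℂ) (M : ℕ) (X : ℕ → ℤ → A) (m n k u : ℤ) : A :=
  brF q (brF q⁻¹ (X (M - 1) m) (X M n)) (X (M + 1) k) * X M u +
    X M u * brF q (brF q⁻¹ (X (M - 1) m) (X M n)) (X (M + 1) k)

/-! ### The defining relations.
`lvl = 1`: only (R1)–(R3);  `lvl = 2`: (R1)–(R5);  `lvl = 3`: all of (R1)–(R7).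
`ext = true` adds `K₀^{±1}` together with its relations. -/

inductive rel (q : ℂ) (M N : ℕ) (ext : Bool) (lvl : ℕ) : FA M N ext → FA M N ext → Prop
  | KKi (i : Idx M N) : rel q M N ext lvl (gi (Gen.K i) * gi (Gen.Ki i)) 1
  | KiK (i : Idx M N) : rel q M N ext lvl (gi (Gen.Ki i) * gi (Gen.K i)) 1
  | KK (i j : Idx M N) :
      rel q M N ext lvl (gi (Gen.K i) * gi (Gen.K j)) (gi (Gen.K j) * gi (Gen.K i))
  | KKi2 (i j : Idx M N) :
      rel q M N ext lvl (gi (Gen.K i) * gi (Gen.Ki j)) (gi (Gen.Ki j) * gi (Gen.K i))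
  | KiKi (i j : Idx M N) :
      rel q M N ext lvl (gi (Gen.Ki i) * gi (Gen.Ki j)) (gi (Gen.Ki j) * gi (Gen.Ki i))
  | KH (i j : Idx M N) (s : {s : ℤ // s ≠ 0}) :
      rel q M N ext lvl (gi (Gen.K i) * gi (Gen.H j s)) (gi (Gen.H j s) * gi (Gen.K i))
  | KiH (i j : Idx M N) (s : {s : ℤ // s ≠ 0}) :
      rel q M N ext lvl (gi (Gen.Ki i) * gi (Gen.H j s)) (gi (Gen.H j s) * gi (Gen.Ki i))
  | HH (i j : Idx M N) (s t : {s : ℤ // s ≠ 0}) :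
      rel q M N ext lvl (gi (Gen.H i s) * gi (Gen.H j t)) (gi (Gen.H j t) * gi (Gen.H i s))
  | KXp (i j : Idx M N) (n : ℤ) :
      rel q M N ext lvl (gi (Gen.K i) * gi (Gen.Xp j n))
        ((q ^ cc M i.1 j.1) • (gi (Gen.Xp j n) * gi (Gen.K i)))
  | KXm (i j : Idx M N) (n : ℤ) :
      rel q M N ext lvl (gi (Gen.K i) * gi (Gen.Xm j n))
        ((q ^ (-cc M i.1 j.1)) • (gi (Gen.Xm j n) * gi (Gen.K i)))
  | HXp (i j : Idx M N) (s : {s : ℤ // s ≠ 0}) (n : ℤ) :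
      rel q M N ext lvl
        (gi (Gen.H i s) * gi (Gen.Xp j n) - gi (Gen.Xp j n) * gi (Gen.H i s))
        ((qint (qpar q M i.1) (s.1 * lof M i.1 * cc M i.1 j.1) / (s.1 : ℂ)) •
          gi (Gen.Xp j (n + s.1)))
  | HXm (i j : Idx M N) (s : {s : ℤ // s ≠ 0}) (n : ℤ) :
      rel q M N ext lvl
        (gi (Gen.H i s) * gi (Gen.Xm j n) - gi (Gen.Xm j n) * gi (Gen.H i s))
        (-((qint (qpar q M i.1) (s.1 * lof M i.1 * cc M i.1 j.1) / (s.1 : ℂ)) •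
          gi (Gen.Xm j (n + s.1))))
  | XpXm (i j : Idx M N) (m n : ℤ) :
      rel q M N ext lvl
        (gi (Gen.Xp i m) * gi (Gen.Xm j n) -
          sgn M i.1 j.1 • (gi (Gen.Xm j n) * gi (Gen.Xp i m)))
        (if i = j then
            (qpar q M i.1 - (qpar q M i.1)⁻¹)⁻¹ •
              (phiPF q M N ext i.1 (m + n) - phiMF q M N ext i.1 (m + n))
          else 0)
  | XX0p (i j : Idx M N) (m n : ℤ) (h2 : 2 ≤ lvl) (h : cc M i.1 j.1 = 0) :
      rel q M N ext lvl
        (gi (Gen.Xp i m) * gi (Gen.Xp j n) -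
          sgn M i.1 j.1 • (gi (Gen.Xp j n) * gi (Gen.Xp i m))) 0
  | XX0m (i j : Idx M N) (m n : ℤ) (h2 : 2 ≤ lvl) (h : cc M i.1 j.1 = 0) :
      rel q M N ext lvl
        (gi (Gen.Xm i m) * gi (Gen.Xm j n) -
          sgn M i.1 j.1 • (gi (Gen.Xm j n) * gi (Gen.Xm i m))) 0
  | XXp (i j : Idx M N) (m n : ℤ) (h2 : 2 ≤ lvl) (h : cc M i.1 j.1 ≠ 0) :
      rel q M N ext lvl
        (gi (Gen.Xp i (m + 1)) * gi (Gen.Xp j n) -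
          (q ^ cc M i.1 j.1) • (gi (Gen.Xp j n) * gi (Gen.Xp i (m + 1))))
        ((q ^ cc M i.1 j.1) • (gi (Gen.Xp i m) * gi (Gen.Xp j (n + 1))) -
          gi (Gen.Xp j (n + 1)) * gi (Gen.Xp i m))
  | XXm (i j : Idx M N) (m n : ℤ) (h2 : 2 ≤ lvl) (h : cc M i.1 j.1 ≠ 0) :
      rel q M N ext lvl
        (gi (Gen.Xm i (m + 1)) * gi (Gen.Xm j n) -
          (q ^ (-cc M i.1 j.1)) • (gi (Gen.Xm j n) * gi (Gen.Xm i (m + 1))))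
        ((q ^ (-cc M i.1 j.1)) • (gi (Gen.Xm i m) * gi (Gen.Xm j (n + 1))) -
          gi (Gen.Xm j (n + 1)) * gi (Gen.Xm i m))
  | serreP (i j : Idx M N) (m n k : ℤ) (h3 : 3 ≤ lvl)
      (h : cc M i.1 j.1 = 1 ∨ cc M i.1 j.1 = -1) (hi : i.1 ≠ M) :
      rel q M N ext lvl
        (brF q (gi (Gen.Xp i m)) (brF q⁻¹ (gi (Gen.Xp i n)) (gi (Gen.Xp j k))) +
          brF q (gi (Gen.Xp i n)) (brF q⁻¹ (gi (Gen.Xp i m)) (gi (Gen.Xp j k)))) 0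
  | serreM (i j : Idx M N) (m n k : ℤ) (h3 : 3 ≤ lvl)
      (h : cc M i.1 j.1 = 1 ∨ cc M i.1 j.1 = -1) (hi : i.1 ≠ M) :
      rel q M N ext lvl
        (brF q (gi (Gen.Xm i m)) (brF q⁻¹ (gi (Gen.Xm i n)) (gi (Gen.Xm j k))) +
          brF q (gi (Gen.Xm i n)) (brF q⁻¹ (gi (Gen.Xm i m)) (gi (Gen.Xm j k)))) 0
  | oscP (m n k u : ℤ) (h3 : 3 ≤ lvl) (hM : 1 < M) (hN : 1 < N) :
      rel q M N ext lvl
        (oscOf q M (XpF M N ext) m n k u + oscOf q M (XpF M N ext) m u k n) 0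
  | oscM (m n k u : ℤ) (h3 : 3 ≤ lvl) (hM : 1 < M) (hN : 1 < N) :
      rel q M N ext lvl
        (oscOf q M (XmF M N ext) m n k u + oscOf q M (XmF M N ext) m u k n) 0
  | K0K0i (he : ext = true) : rel q M N ext lvl (gi (Gen.K0 he) * gi (Gen.K0i he)) 1
  | K0iK0 (he : ext = true) : rel q M N ext lvl (gi (Gen.K0i he) * gi (Gen.K0 he)) 1
  | K0K (he : ext = true) (i : Idx M N) :
      rel q M N ext lvl (gi (Gen.K0 he) * gi (Gen.K i)) (gi (Gen.K i) * gi (Gen.K0 he))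
  | K0Ki (he : ext = true) (i : Idx M N) :
      rel q M N ext lvl (gi (Gen.K0 he) * gi (Gen.Ki i)) (gi (Gen.Ki i) * gi (Gen.K0 he))
  | K0H (he : ext = true) (i : Idx M N) (s : {s : ℤ // s ≠ 0}) :
      rel q M N ext lvl (gi (Gen.K0 he) * gi (Gen.H i s)) (gi (Gen.H i s) * gi (Gen.K0 he))
  | K0Xp (he : ext = true) (i : Idx M N) (n : ℤ) :
      rel q M N ext lvl (gi (Gen.K0 he) * gi (Gen.Xp i n))
        ((q ^ (if i.1 = 1 then (1 : ℤ) else 0)) • (gi (Gen.Xp i n) * gi (Gen.K0 he)))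
  | K0Xm (he : ext = true) (i : Idx M N) (n : ℤ) :
      rel q M N ext lvl (gi (Gen.K0 he) * gi (Gen.Xm i n))
        ((q ^ (if i.1 = 1 then (-1 : ℤ) else 0)) • (gi (Gen.Xm i n) * gi (Gen.K0 he)))

/-! ### The quantum affine superalgebras -/

abbrev ALG (q : ℂ) (M N : ℕ) (ext : Bool) (lvl : ℕ) := RingQuot (rel q M N ext lvl)

def mkA (q : ℂ) (M N : ℕ) (ext : Bool) (lvl : ℕ) : FA M N ext →ₐ[ℂ] ALG q M N ext lvl :=
  RingQuot.mkAlgHom ℂ (rel q M N ext lvl)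

def XpA (q : ℂ) (M N : ℕ) (ext : Bool) (lvl : ℕ) (i : ℕ) (n : ℤ) : ALG q M N ext lvl :=
  mkA q M N ext lvl (XpF M N ext i n)

def XmA (q : ℂ) (M N : ℕ) (ext : Bool) (lvl : ℕ) (i : ℕ) (n : ℤ) : ALG q M N ext lvl :=
  mkA q M N ext lvl (XmF M N ext i n)

def KA (q : ℂ) (M N : ℕ) (ext : Bool) (lvl : ℕ) (i : ℕ) : ALG q M N ext lvl :=
  mkA q M N ext lvl (KF M N ext i)

def KiA (q : ℂ) (M N : ℕ) (ext : Bool) (lvl : ℕ) (i : ℕ) : ALG q M N ext lvl :=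
  mkA q M N ext lvl (KiF M N ext i)

def HA (q : ℂ) (M N : ℕ) (ext : Bool) (lvl : ℕ) (i : ℕ) (s : ℤ) : ALG q M N ext lvl :=
  mkA q M N ext lvl (HF M N ext i s)

def K0A (q : ℂ) (M N : ℕ) (ext : Bool) (lvl : ℕ) : ALG q M N ext lvl :=
  mkA q M N ext lvl (K0F M N ext)

def K0iA (q : ℂ) (M N : ℕ) (ext : Bool) (lvl : ℕ) : ALG q M N ext lvl :=
  mkA q M N ext lvl (K0iF M N ext)

def phiPA (q : ℂ) (M N : ℕ) (ext : Bool) (lvl : ℕ) (i : ℕ) (n : ℤ) : ALG q M N ext lvl :=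
  mkA q M N ext lvl (phiPF q M N ext i n)

def phiMA (q : ℂ) (M N : ℕ) (ext : Bool) (lvl : ℕ) (i : ℕ) (n : ℤ) : ALG q M N ext lvl :=
  mkA q M N ext lvl (phiMF q M N ext i n)

/-- `U⁺`: the subalgebra generated by the `X⁺_{i,n}`. -/
def Aplus (q : ℂ) (M N : ℕ) (ext : Bool) (lvl : ℕ) : Subalgebra ℂ (ALG q M N ext lvl) :=
  Algebra.adjoin ℂ {x | ∃ i : ℕ, ∃ n : ℤ, x = XpA q M N ext lvl i n}

/-- `U⁻`: the subalgebra generated by the `X⁻_{i,n}`. -/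
def Aminus (q : ℂ) (M N : ℕ) (ext : Bool) (lvl : ℕ) : Subalgebra ℂ (ALG q M N ext lvl) :=
  Algebra.adjoin ℂ {x | ∃ i : ℕ, ∃ n : ℤ, x = XmA q M N ext lvl i n}

/-- `U⁰`: the subalgebra generated by the `K_i^{±1}` and `h_{i,s}`. -/
def Azero (q : ℂ) (M N : ℕ) (ext : Bool) (lvl : ℕ) : Subalgebra ℂ (ALG q M N ext lvl) :=
  Algebra.adjoin ℂ {x | (∃ i : ℕ, x = KA q M N ext lvl i) ∨ (∃ i : ℕ, x = KiA q M N ext lvl i) ∨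
    ∃ i : ℕ, ∃ s : ℤ, x = HA q M N ext lvl i s}

/-- `U'⁰`: the subalgebra generated by `U⁰` and `K₀^{±1}`. -/
def AzeroE (q : ℂ) (M N : ℕ) (ext : Bool) (lvl : ℕ) : Subalgebra ℂ (ALG q M N ext lvl) :=
  Algebra.adjoin ℂ {x | (∃ i : ℕ, x = KA q M N ext lvl i) ∨ (∃ i : ℕ, x = KiA q M N ext lvl i) ∨
    (∃ i : ℕ, ∃ s : ℤ, x = HA q M N ext lvl i s) ∨ x = K0A q M N ext lvl ∨
      x = K0iA q M N ext lvl}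

/-! ### The multiplication map on the triple tensor product -/

def triMul (q : ℂ) (M N : ℕ) (ext : Bool) (lvl : ℕ)
    (S T R : Subalgebra ℂ (ALG q M N ext lvl)) :
    (↥S ⊗[ℂ] (↥T ⊗[ℂ] ↥R)) →ₗ[ℂ] ALG q M N ext lvl :=
  TensorProduct.lift
    (((LinearMap.mul ℂ (ALG q M N ext lvl)).comp S.val.toLinearMap).compl₂
      (TensorProduct.lift
        (((LinearMap.mul ℂ (ALG q M N ext lvl)).comp T.val.toLinearMap).compl₂
          R.val.toLinearMap)))

/-! ### Root vectors and PBW monomials -/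

def Xroot (q : ℂ) (M N : ℕ) (ext : Bool) (lvl : ℕ) (i : ℕ) : ℕ → ℤ → ALG q M N ext lvl
  | 0, n => XpA q M N ext lvl i n
  | k + 1, n =>
      brF (qpar q M (i + k + 1)) (Xroot q M N ext lvl i k n) (XpA q M N ext lvl (i + k + 1) 0)

/-- the root vector `X_{α_i + ⋯ + α_j}(n)`. -/
def XrootIJ (q : ℂ) (M N : ℕ) (ext : Bool) (lvl : ℕ) (i j : ℕ) (n : ℤ) : ALG q M N ext lvl :=
  Xroot q M N ext lvl i (j - i) n

def rootLE (a b : ℕ × ℕ) : Prop := a.1 < b.1 ∨ (a.1 = b.1 ∧ a.2 ≤ b.2)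

/-- the set of PBW ordered monomials in the root vectors. -/
def pbwSet (q : ℂ) (M N : ℕ) (ext : Bool) (lvl : ℕ) : Set (ALG q M N ext lvl) :=
  {x | ∃ L : List ((ℕ × ℕ) × ℤ),
      (∀ p ∈ L, 1 ≤ p.1.1 ∧ p.1.1 ≤ p.1.2 ∧ p.1.2 ≤ M + N - 1) ∧
      L.Chain' (fun a b => rootLE a.1 b.1) ∧
      x = (L.map fun p => XrootIJ q M N ext lvl p.1.1 p.1.2 p.2).prod}

/-- PBW ordered monomials of total degree `d` (`d i` counts the multiplicity of `α_i`). -/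
def pbwDegSet (q : ℂ) (M N : ℕ) (ext : Bool) (lvl : ℕ) (d : ℕ → ℕ) : Set (ALG q M N ext lvl) :=
  {x | ∃ L : List ((ℕ × ℕ) × ℤ),
      (∀ p ∈ L, 1 ≤ p.1.1 ∧ p.1.1 ≤ p.1.2 ∧ p.1.2 ≤ M + N - 1) ∧
      L.Chain' (fun a b => rootLE a.1 b.1) ∧
      (∀ i : ℕ, ((L.map fun p => if p.1.1 ≤ i ∧ i ≤ p.1.2 then 1 else 0).sum) = d i) ∧
      x = (L.map fun p => XrootIJ q M N ext lvl p.1.1 p.1.2 p.2).prod}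

/-- words in the generators `X⁺_{i,n}` of degree `d`. -/
def wordDegSet (q : ℂ) (M N : ℕ) (ext : Bool) (lvl : ℕ) (d : ℕ → ℕ) :
    Set (ALG q M N ext lvl) :=
  {x | ∃ w : List (ℕ × ℤ), (∀ p ∈ w, 1 ≤ p.1 ∧ p.1 ≤ M + N - 1) ∧
      (∀ i : ℕ, (w.map Prod.fst).count i = d i) ∧
      x = (w.map fun p => XpA q M N ext lvl p.1 p.2).prod}

/-! ### The subspaces `I^±_{i,j}` and `O^±` -/

def IElt (q : ℂ) (M N : ℕ) (ext : Bool) (lvl : ℕ) (pl : Bool) (i j : ℕ) (m n : ℤ) :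
    ALG q M N ext lvl :=
  let X : ℕ → ℤ → ALG q M N ext lvl := if pl then XpA q M N ext lvl else XmA q M N ext lvl
  let e : ℤ := if pl then cc M i j else -cc M i j
  if cc M i j = 0 then X i m * X j n - sgn M i j • (X j n * X i m)
  else
    X i (m + 1) * X j n - (q ^ e) • (X j n * X i (m + 1)) -
      (q ^ e) • (X i m * X j (n + 1)) + X j (n + 1) * X i m

def Isub (q : ℂ) (M N : ℕ) (ext : Bool) (lvl : ℕ) (pl : Bool) (i j : ℕ) :
    Submodule ℂ (ALG q M N ext lvl) :=
  Submodule.span ℂ (Set.range fun p : ℤ × ℤ => IElt q M N ext lvl pl i j p.1 p.2)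

def IsubAll (q : ℂ) (M N : ℕ) (ext : Bool) (lvl : ℕ) (pl : Bool) :
    Submodule ℂ (ALG q M N ext lvl) :=
  ⨆ p : ℕ × ℕ, ⨆ _ : 1 ≤ p.1 ∧ p.1 ≤ p.2 ∧ p.2 ≤ M + N - 1,
    Isub q M N ext lvl pl p.1 p.2

def OscElt (q : ℂ) (M N : ℕ) (ext : Bool) (lvl : ℕ) (pl : Bool) (m n k u : ℤ) :
    ALG q M N ext lvl :=
  let X : ℕ → ℤ → ALG q M N ext lvl := if pl then XpA q M N ext lvl else XmA q M N ext lvl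
  oscOf q M X m n k u + oscOf q M X m u k n

def Osub (q : ℂ) (M N : ℕ) (ext : Bool) (lvl : ℕ) (pl : Bool) :
    Submodule ℂ (ALG q M N ext lvl) :=
  Submodule.span ℂ
    (Set.range fun p : ℤ × ℤ × ℤ × ℤ => OscElt q M N ext lvl pl p.1 p.2.1 p.2.2.1 p.2.2.2)

/-- the sign `(−1)^{(p(α_k)+p(α_u))·p(α_i)}`. -/
def gsgn (M : ℕ) (k u i : ℕ) : ℂ :=
  if ((k = M ∧ ¬u = M) ∨ (¬k = M ∧ u = M)) ∧ i = M then -1 else 1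

/-! ### Highest weights and the associated eigenvalue sequences -/

/-- `Q·f = 0` for a bilateral formal series `f`. -/
def annih (Q : Polynomial ℂ) (f : ℤ → ℂ) : Prop :=
  ∀ n : ℤ, ∑ s ∈ Finset.range (Q.natDegree + 1), Q.coeff s * f (n - s) = 0

/-- an element of `R_{M,N}`: a highest weight `(P̲, f, c)`. -/
structure HW (q : ℂ) (M N : ℕ) : Type where
  P : ℕ → Polynomial ℂ
  f : ℤ → ℂ
  c : ℂ
  P_const : ∀ i, (P i).coeff 0 = 1
  c_ne : c ≠ 0
  torsion : ∃ Q : Polynomial ℂ, Q ≠ 0 ∧ annih Q f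
  f_zero : f 0 = (c - c⁻¹) / (q - q⁻¹)

def toPS (p : Polynomial ℂ) : PowerSeries ℂ := PowerSeries.mk fun n => p.coeff n

/-- `P(z·u)`. -/
def pscale (u : ℂ) (P : Polynomial ℂ) : Polynomial ℂ := P.comp (Polynomial.C u * Polynomial.X)

/-- the coefficient of `z^n` (`n ≥ 0`) in `q_i^{deg P} P(z q_i⁻¹)/P(z q_i)`,
expanded at `z = 0`. -/
def gammaP (q : ℂ) (M : ℕ) (i : ℕ) (P : Polynomial ℂ) (n : ℤ) : ℂ :=
  if 0 ≤ n then
    qpar q M i ^ P.natDegree *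
      PowerSeries.coeff n.toNat
        (toPS (pscale (qpar q M i)⁻¹ P) * (toPS (pscale (qpar q M i) P))⁻¹)
  else 0

/-- the coefficient of `z^n` (`n ≤ 0`) in `q_i^{deg P} P(z q_i⁻¹)/P(z q_i)`,
expanded at `z = ∞`. -/
def gammaM (q : ℂ) (M : ℕ) (i : ℕ) (P : Polynomial ℂ) (n : ℤ) : ℂ :=
  if n ≤ 0 then
    qpar q M i ^ P.natDegree *
      PowerSeries.coeff (-n).toNat
        (toPS ((pscale (qpar q M i)⁻¹ P).reflect P.natDegree) *
          (toPS ((pscale (qpar q M i) P).reflect P.natDegree))⁻¹)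
  else 0

/-! ### Verma, Weyl and simple modules -/

def vermaRels (q : ℂ) (M N : ℕ) (ext : Bool) (Λ : HW q M N) : Set (ALG q M N ext 3) :=
  {x | ∃ i : ℕ, ∃ n : ℤ, x = XpA q M N ext 3 i n} ∪
  {x | ∃ i : ℕ, ∃ n : ℤ, 1 ≤ i ∧ i ≤ M + N - 1 ∧ i ≠ M ∧
      (x = phiPA q M N ext 3 i n - algebraMap ℂ _ (gammaP q M i (Λ.P i) n) ∨
       x = phiMA q M N ext 3 i n - algebraMap ℂ _ (gammaM q M i (Λ.P i) n))} ∪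
  {x | x = KA q M N ext 3 M - algebraMap ℂ _ Λ.c} ∪
  {x | ∃ n : ℤ, x = phiPA q M N ext 3 M n - phiMA q M N ext 3 M n -
      algebraMap ℂ _ ((q - q⁻¹) * Λ.f n)} ∪
  {x | ext = true ∧ x = K0A q M N ext 3 - 1}

def evenRels (q : ℂ) (M N : ℕ) (ext : Bool) (Λ : HW q M N) : Set (ALG q M N ext 3) :=
  {x | ∃ i : ℕ, 1 ≤ i ∧ i ≤ M + N - 1 ∧ i ≠ M ∧
      x = XmA q M N ext 3 i 0 ^ (1 + (Λ.P i).natDegree)}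

def oddElt (q : ℂ) (M N : ℕ) (ext : Bool) (Q : Polynomial ℂ) (n : ℤ) : ALG q M N ext 3 :=
  ∑ s ∈ Finset.range (Q.natDegree + 1),
    Q.coeff (Q.natDegree - s) • XmA q M N ext 3 M ((s : ℤ) + n)

def oddRels (q : ℂ) (M N : ℕ) (ext : Bool) (Q : Polynomial ℂ) : Set (ALG q M N ext 3) :=
  if M = 1 ∧ N = 1 then {x | ∃ n : ℤ, x = oddElt q M N ext Q n}
  else {oddElt q M N ext Q 0}

def vermaIdeal (q : ℂ) (M N : ℕ) (ext : Bool) (Λ : HW q M N) : Ideal (ALG q M N ext 3) :=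
  Ideal.span (vermaRels q M N ext Λ)

def weylIdeal (q : ℂ) (M N : ℕ) (ext : Bool) (Λ : HW q M N) (Q : Polynomial ℂ) :
    Ideal (ALG q M N ext 3) :=
  Ideal.span (vermaRels q M N ext Λ ∪ evenRels q M N ext Λ ∪ oddRels q M N ext Q)

def uweylIdeal (q : ℂ) (M N : ℕ) (ext : Bool) (Λ : HW q M N) : Ideal (ALG q M N ext 3) :=
  Ideal.span (vermaRels q M N ext Λ ∪ evenRels q M N ext Λ)

/-- the Verma module `M(Λ)`. -/
def VermaMod (q : ℂ) (M N : ℕ) (ext : Bool) (Λ : HW q M N) : Type :=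
  ALG q M N ext 3 ⧸ vermaIdeal q M N ext Λ

/-- the Weyl module `W(Λ; Q)`. -/
def WeylMod (q : ℂ) (M N : ℕ) (ext : Bool) (Λ : HW q M N) (Q : Polynomial ℂ) : Type :=
  ALG q M N ext 3 ⧸ weylIdeal q M N ext Λ Q

/-- the universal Weyl module `W(Λ)`. -/
def UWeylMod (q : ℂ) (M N : ℕ) (ext : Bool) (Λ : HW q M N) : Type :=
  ALG q M N ext 3 ⧸ uweylIdeal q M N ext Λ

instance (q : ℂ) (M N : ℕ) (ext : Bool) (Λ : HW q M N) : AddCommGroup (VermaMod q M N ext Λ) :=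
  inferInstanceAs (AddCommGroup (ALG q M N ext 3 ⧸ vermaIdeal q M N ext Λ))
instance (q : ℂ) (M N : ℕ) (ext : Bool) (Λ : HW q M N) :
    Module (ALG q M N ext 3) (VermaMod q M N ext Λ) :=
  inferInstanceAs (Module (ALG q M N ext 3) (ALG q M N ext 3 ⧸ vermaIdeal q M N ext Λ))
instance (q : ℂ) (M N : ℕ) (ext : Bool) (Λ : HW q M N) : Module ℂ (VermaMod q M N ext Λ) :=
  inferInstanceAs (Module ℂ (ALG q M N ext 3 ⧸ vermaIdeal q M N ext Λ))
instance (q : ℂ) (M N : ℕ) (ext : Bool) (Λ : HW q M N) :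
    IsScalarTower ℂ (ALG q M N ext 3) (VermaMod q M N ext Λ) :=
  inferInstanceAs (IsScalarTower ℂ (ALG q M N ext 3) (ALG q M N ext 3 ⧸ vermaIdeal q M N ext Λ))

instance (q : ℂ) (M N : ℕ) (ext : Bool) (Λ : HW q M N) (Q : Polynomial ℂ) :
    AddCommGroup (WeylMod q M N ext Λ Q) :=
  inferInstanceAs (AddCommGroup (ALG q M N ext 3 ⧸ weylIdeal q M N ext Λ Q))
instance (q : ℂ) (M N : ℕ) (ext : Bool) (Λ : HW q M N) (Q : Polynomial ℂ) :
    Module (ALG q M N ext 3) (WeylMod q M N ext Λ Q) :=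
  inferInstanceAs (Module (ALG q M N ext 3) (ALG q M N ext 3 ⧸ weylIdeal q M N ext Λ Q))
instance (q : ℂ) (M N : ℕ) (ext : Bool) (Λ : HW q M N) (Q : Polynomial ℂ) :
    Module ℂ (WeylMod q M N ext Λ Q) :=
  inferInstanceAs (Module ℂ (ALG q M N ext 3 ⧸ weylIdeal q M N ext Λ Q))
instance (q : ℂ) (M N : ℕ) (ext : Bool) (Λ : HW q M N) (Q : Polynomial ℂ) :
    IsScalarTower ℂ (ALG q M N ext 3) (WeylMod q M N ext Λ Q) :=
  inferInstanceAs
    (IsScalarTower ℂ (ALG q M N ext 3) (ALG q M N ext 3 ⧸ weylIdeal q M N ext Λ Q))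

instance (q : ℂ) (M N : ℕ) (ext : Bool) (Λ : HW q M N) : AddCommGroup (UWeylMod q M N ext Λ) :=
  inferInstanceAs (AddCommGroup (ALG q M N ext 3 ⧸ uweylIdeal q M N ext Λ))
instance (q : ℂ) (M N : ℕ) (ext : Bool) (Λ : HW q M N) :
    Module (ALG q M N ext 3) (UWeylMod q M N ext Λ) :=
  inferInstanceAs (Module (ALG q M N ext 3) (ALG q M N ext 3 ⧸ uweylIdeal q M N ext Λ))
instance (q : ℂ) (M N : ℕ) (ext : Bool) (Λ : HW q M N) : Module ℂ (UWeylMod q M N ext Λ) :=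
  inferInstanceAs (Module ℂ (ALG q M N ext 3 ⧸ uweylIdeal q M N ext Λ))
instance (q : ℂ) (M N : ℕ) (ext : Bool) (Λ : HW q M N) :
    IsScalarTower ℂ (ALG q M N ext 3) (UWeylMod q M N ext Λ) :=
  inferInstanceAs (IsScalarTower ℂ (ALG q M N ext 3) (ALG q M N ext 3 ⧸ uweylIdeal q M N ext Λ))

/-- the highest weight vector (image of `1`). -/
def vgen (q : ℂ) (M N : ℕ) (Λ : HW q M N) : VermaMod q M N true Λ :=
  Submodule.Quotient.mk 1

/-- the sum of all submodules not containing the highest weight vector (the unique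
maximal submodule of the Verma module). -/
def radV (q : ℂ) (M N : ℕ) (Λ : HW q M N) :
    Submodule (ALG q M N true 3) (VermaMod q M N true Λ) :=
  sSup {p | vgen q M N Λ ∉ p}

/-- the simple quotient `S'(Λ)`. -/
def SimpMod (q : ℂ) (M N : ℕ) (Λ : HW q M N) : Type :=
  VermaMod q M N true Λ ⧸ radV q M N Λ

instance (q : ℂ) (M N : ℕ) (Λ : HW q M N) : AddCommGroup (SimpMod q M N Λ) :=
  inferInstanceAs (AddCommGroup (VermaMod q M N true Λ ⧸ radV q M N Λ))
instance (q : ℂ) (M N : ℕ) (Λ : HW q M N) :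
    Module (ALG q M N true 3) (SimpMod q M N Λ) :=
  inferInstanceAs (Module (ALG q M N true 3) (VermaMod q M N true Λ ⧸ radV q M N Λ))
instance (q : ℂ) (M N : ℕ) (Λ : HW q M N) : Module ℂ (SimpMod q M N Λ) :=
  inferInstanceAs (Module ℂ (VermaMod q M N true Λ ⧸ radV q M N Λ))
instance (q : ℂ) (M N : ℕ) (Λ : HW q M N) :
    IsScalarTower ℂ (ALG q M N true 3) (SimpMod q M N Λ) :=
  inferInstanceAs (IsScalarTower ℂ (ALG q M N true 3) (VermaMod q M N true Λ ⧸ radV q M N Λ))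

/-! ### Weight spaces -/

/-- `K_i` for `0 ≤ i`, with `K₀` at `i = 0`. -/
def Kgen (q : ℂ) (M N : ℕ) (ext : Bool) (lvl : ℕ) (i : ℕ) : ALG q M N ext lvl :=
  if i = 0 then K0A q M N ext lvl else KA q M N ext lvl i

/-- the `μ`-weight space of a module. -/
def wtSp (q : ℂ) (M N : ℕ) (ext : Bool) {W : Type} [AddCommGroup W] [Module ℂ W]
    [Module (ALG q M N ext 3) W] [IsScalarTower ℂ (ALG q M N ext 3) W] (μ : ℕ → ℂ) :
    Submodule ℂ W where
  carrier := {w | ∀ i < M + N, Kgen q M N ext 3 i • w = μ i • w}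
  add_mem' := by
    intro a b ha hb i hi
    rw [smul_add, ha i hi, hb i hi, smul_add]
  zero_mem' := by
    intro i hi
    rw [smul_zero, smul_zero]
  smul_mem' := by
    intro c w hw i hi
    have h1 : Kgen q M N ext 3 i • (c • w) = c • (Kgen q M N ext 3 i • w) := by
      rw [← algebraMap_smul (ALG q M N ext 3) c w, ← mul_smul, ← Algebra.commutes, mul_smul,
        algebraMap_smul]
    rw [h1, hw i hi, smul_comm]

/-- the character `λ_Λ`. -/
def lamF (q : ℂ) (M N : ℕ) (Λ : HW q M N) : ℕ → ℂ :=
  fun i => if i = 0 then 1 else if i = M then Λ.c else qpar q M i ^ (Λ.P i).natDegree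

/-- the character `α_j`. -/
def alF (q : ℂ) (M : ℕ) (j : ℕ) : ℕ → ℂ :=
  fun i => if i = 0 then (if j = 1 then q else 1) else q ^ cc M j i

/-! ### The generators of `U` inside `U'` -/

def UGenSet (q : ℂ) (M N : ℕ) : Set (ALG q M N true 3) :=
  {x | (∃ i : ℕ, ∃ n : ℤ, x = XpA q M N true 3 i n) ∨
    (∃ i : ℕ, ∃ n : ℤ, x = XmA q M N true 3 i n) ∨
    (∃ i : ℕ, x = KA q M N true 3 i) ∨ (∃ i : ℕ, x = KiA q M N true 3 i) ∨
    ∃ i : ℕ, ∃ s : ℤ, x = HA q M N true 3 i s}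

/-! ### One-sided presentations (for `U^±`) -/

def XgF (M N : ℕ) (i : ℕ) (n : ℤ) : FreeAlgebra ℂ (Idx M N × ℤ) :=
  if h : 1 ≤ i ∧ i ≤ M + N - 1 then FreeAlgebra.ι ℂ ((⟨i, h⟩, n) : Idx M N × ℤ) else 0

inductive rel1 (q : ℂ) (M N : ℕ) (pl : Bool) :
    FreeAlgebra ℂ (Idx M N × ℤ) → FreeAlgebra ℂ (Idx M N × ℤ) → Prop
  | comm0 (i j : Idx M N) (m n : ℤ) (h : cc M i.1 j.1 = 0) :
      rel1 q M N pl
        (FreeAlgebra.ι ℂ ((i, m) : Idx M N × ℤ) * FreeAlgebra.ι ℂ ((j, n) : Idx M N × ℤ) -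
          sgn M i.1 j.1 •
            (FreeAlgebra.ι ℂ ((j, n) : Idx M N × ℤ) * FreeAlgebra.ι ℂ ((i, m) : Idx M N × ℤ))) 0
  | deg2 (i j : Idx M N) (m n : ℤ) (h : cc M i.1 j.1 ≠ 0) :
      rel1 q M N pl
        (FreeAlgebra.ι ℂ ((i, m + 1) : Idx M N × ℤ) * FreeAlgebra.ι ℂ ((j, n) : Idx M N × ℤ) -
          (q ^ (if pl then cc M i.1 j.1 else -cc M i.1 j.1)) •
            (FreeAlgebra.ι ℂ ((j, n) : Idx M N × ℤ) *
              FreeAlgebra.ι ℂ ((i, m + 1) : Idx M N × ℤ)))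
        ((q ^ (if pl then cc M i.1 j.1 else -cc M i.1 j.1)) •
            (FreeAlgebra.ι ℂ ((i, m) : Idx M N × ℤ) *
              FreeAlgebra.ι ℂ ((j, n + 1) : Idx M N × ℤ)) -
          FreeAlgebra.ι ℂ ((j, n + 1) : Idx M N × ℤ) * FreeAlgebra.ι ℂ ((i, m) : Idx M N × ℤ))
  | serre (i j : Idx M N) (m n k : ℤ) (h : cc M i.1 j.1 = 1 ∨ cc M i.1 j.1 = -1)
      (hi : i.1 ≠ M) :
      rel1 q M N pl
        (brF q (FreeAlgebra.ι ℂ ((i, m) : Idx M N × ℤ))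
            (brF q⁻¹ (FreeAlgebra.ι ℂ ((i, n) : Idx M N × ℤ))
              (FreeAlgebra.ι ℂ ((j, k) : Idx M N × ℤ))) +
          brF q (FreeAlgebra.ι ℂ ((i, n) : Idx M N × ℤ))
            (brF q⁻¹ (FreeAlgebra.ι ℂ ((i, m) : Idx M N × ℤ))
              (FreeAlgebra.ι ℂ ((j, k) : Idx M N × ℤ)))) 0
  | osc (m n k u : ℤ) (hM : 1 < M) (hN : 1 < N) :
      rel1 q M N pl (oscOf q M (XgF M N) m n k u + oscOf q M (XgF M N) m u k n) 0

end QAS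

section
namespace QAS
open Polynomial
open scoped TensorProduct

/-! ### Part A: exponentials -/

theorem expC_succ_smul {A : Type} [Ring A] [Algebra ℂ A] (t : ℂ) (a : ℕ → A) (n : ℕ) :
    ((n : ℂ) + 1) • expC t a (n + 1) =
      t • ∑ s ∈ Finset.range (n + 1), ((s : ℂ) + 1) • (a (s + 1) * expC t a (n - s)) := by
  rw [expC, smul_smul, mul_inv_cancel₀ (Nat.cast_add_one_ne_zero n), one_smul]

theorem map_expC {A B : Type} [Ring A] [Algebra ℂ A] [Ring B] [Algebra ℂ B] (f : A →ₐ[ℂ] B)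
    (t : ℂ) (a : ℕ → A) (n : ℕ) : f (expC t a n) = expC t (fun s => f (a s)) n := by
  induction n using Nat.strong_induction_on with
  | _ n ih =>
    cases n with
    | zero => simp [expC]
    | succ n =>
      rw [expC, expC]
      simp only [map_smul, map_sum, map_mul]
      congr 2
      refine Finset.sum_congr rfl fun s hs => ?_
      rw [ih (n - s) (by omega)]

theorem expC_ode {C : Type} [CommRing C] [Algebra ℂ C] (t : ℂ) (l : ℕ → C) :
    PowerSeries.X * PowerSeries.derivative C (PowerSeries.mk (expC t l)) =
      PowerSeries.mk (fun s => (t * s) • l s) * PowerSeries.mk (expC t l) := by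
  ext n
  cases n with
  | zero => simp [PowerSeries.coeff_mul]
  | succ n =>
    rw [PowerSeries.coeff_succ_X_mul, PowerSeries.coeff_mul,
      Finset.Nat.sum_antidiagonal_succ]
    simp only [PowerSeries.coeff_mk]
    rw [show PowerSeries.coeff n (PowerSeries.derivative C (PowerSeries.mk (expC t l)))
        = expC t l (n + 1) * ((n : C) + 1) by
          simp [PowerSeries.coeff_derivative]]
    have := expC_succ_smul t l n
    rw [Finset.Nat.sum_antidiagonal_eq_sum_range_succ
      (f := fun i j => (t * ((i + 1 : ℕ) : ℂ)) • l (i + 1) * expC t l j)]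
    rw [Finset.smul_sum] at this
    have h2 : expC t l (n + 1) * ((n : C) + 1) = ((n : ℂ) + 1) • expC t l (n + 1) := by
      rw [Algebra.smul_def, mul_comm]; simp
    rw [h2, this]
    simp [mul_smul]

theorem ode_unique {C : Type} [CommRing C] [Algebra ℂ C] (c d y : PowerSeries C)
    (hc : PowerSeries.constantCoeff c = 1) (hd : PowerSeries.constantCoeff d = 0)
    (hy : PowerSeries.constantCoeff y = 0)
    (h : c * (PowerSeries.X * PowerSeries.derivative C y) = d * y) : y = 0 := by
  have hu : IsUnit c := by
    rw [PowerSeries.isUnit_iff_constantCoeff, hc]; exact isUnit_one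
  obtain ⟨u, rfl⟩ := hu
  set e : PowerSeries C := ↑u⁻¹ * d with he
  have h' : PowerSeries.X * PowerSeries.derivative C y = e * y := by
    rw [he, mul_assoc, ← h, Units.inv_mul_cancel_left]
  have he0 : PowerSeries.constantCoeff e = 0 := by rw [he, map_mul, hd, mul_zero]
  ext n
  induction n using Nat.strong_induction_on with
  | _ n ih =>
    cases n with
    | zero => simpa using hy
    | succ n =>
      have := congrArg (PowerSeries.coeff (n + 1)) h'
      rw [PowerSeries.coeff_succ_X_mul, PowerSeries.coeff_mul] at this
      rw [show PowerSeries.coeff n (PowerSeries.derivative C y)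
        = PowerSeries.coeff (n + 1) y * ((n : C) + 1) by
          simp [PowerSeries.coeff_derivative]] at this
      rw [Finset.sum_eq_zero] at this
      · have h2 : ((n : ℂ) + 1) • PowerSeries.coeff (n + 1) y = 0 := by
          rw [← this, Algebra.smul_def, mul_comm]; simp
        have h3 := congrArg (fun z => ((n : ℂ) + 1)⁻¹ • z) h2
        simpa [smul_smul, inv_mul_cancel₀ (Nat.cast_add_one_ne_zero (R := ℂ) n)] using h3
      · rintro ⟨i, j⟩ hij
        rw [Finset.HasAntidiagonal.mem_antidiagonal] at hij
        simp only at hij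
        rcases Nat.eq_zero_or_pos i with rfl | hi
        · simp [he0]
        · simp only
          rw [ih j (by omega)]; simp

theorem expC_shift {C : Type} [CommRing C] [Algebra ℂ C] (t : ℂ) (l : ℕ → C) (T : C)
    (a : ℂ) (co : ℕ → ℂ) (hco : ∀ s : ℕ, t * s * co s = a ^ s - a⁻¹ ^ s) (m : ℕ) :
    expC t (fun s => l s - co s • T ^ s) (m + 1) - a⁻¹ • (T * expC t (fun s => l s - co s • T ^ s) m)
      = expC t l (m + 1) - a • (T * expC t l m) := by
  set A := PowerSeries.C (algebraMap ℂ C a * T) * (PowerSeries.X : PowerSeries C) with hA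
  set B := PowerSeries.C (algebraMap ℂ C a⁻¹ * T) * (PowerSeries.X : PowerSeries C) with hB
  set E := PowerSeries.mk (expC t l) with hE
  set F := PowerSeries.mk (expC t (fun s => l s - co s • T ^ s)) with hF
  set P := PowerSeries.mk (fun s => (t * s) • l s) with hP
  set S := PowerSeries.mk (fun s => algebraMap ℂ C (a ^ s - a⁻¹ ^ s) * T ^ s) with hS
  have hE' := expC_ode t l
  have hF' := expC_ode t (fun s => l s - co s • T ^ s)
  have hPS : PowerSeries.mk (fun s : ℕ => (t * s) • (l s - co s • T ^ s)) = P - S := by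
    ext s
    simp only [PowerSeries.coeff_mk, map_sub, hP, hS]
    rw [← map_sub, ← hco, Algebra.smul_def, Algebra.smul_def, Algebra.smul_def, map_mul _ _ (co s)]
    ring
  rw [hPS] at hF'
  rw [← hE, ← hP] at hE'
  rw [← hF] at hF'
  have geo : ∀ x : C, (1 - PowerSeries.C x * PowerSeries.X) * PowerSeries.mk (fun s => x ^ s) = 1 := by
    intro x
    ext n
    cases n with
    | zero => simp [sub_mul, mul_assoc]
    | succ n => simp [sub_mul, mul_assoc, PowerSeries.coeff_succ_X_mul, pow_succ',
        PowerSeries.coeff_one]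
  have hSd : S = PowerSeries.mk (fun s => (algebraMap ℂ C a * T) ^ s) -
      PowerSeries.mk (fun s => (algebraMap ℂ C a⁻¹ * T) ^ s) := by
    ext s; simp only [hS, PowerSeries.coeff_mk, map_sub, mul_pow, map_pow]; ring
  have g1 := geo (algebraMap ℂ C a * T)
  have g2 := geo (algebraMap ℂ C a⁻¹ * T)
  rw [← hA] at g1
  rw [← hB] at g2
  set G1 := PowerSeries.mk (fun s => (algebraMap ℂ C a * T) ^ s)
  set G2 := PowerSeries.mk (fun s => (algebraMap ℂ C a⁻¹ * T) ^ s)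
  have dA : PowerSeries.X * PowerSeries.derivative C A = A := by
    rw [hA, Derivation.leibniz]; simp; ring
  have dB : PowerSeries.X * PowerSeries.derivative C B = B := by
    rw [hB, Derivation.leibniz]; simp; ring
  have key : (1 - B) * F - (1 - A) * E = 0 := by
    apply ode_unique ((1 - A) * (1 - B)) (A * B - A + (1 - A) * (1 - B) * P)
    · simp [hA, hB]
    · simp [hA, hB, hP]
    · have : PowerSeries.constantCoeff F = 1 := by
        rw [hF, ← PowerSeries.coeff_zero_eq_constantCoeff_apply, PowerSeries.coeff_mk, expC]
      have : PowerSeries.constantCoeff E = 1 := by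
        rw [hE, ← PowerSeries.coeff_zero_eq_constantCoeff_apply, PowerSeries.coeff_mk, expC]
      rw [map_sub, map_mul, map_mul, ‹PowerSeries.constantCoeff E = 1›,
        ‹PowerSeries.constantCoeff F = 1›]
      simp [hA, hB]
    · have h1 : ∀ (U V : PowerSeries C), PowerSeries.derivative C (U * V) =
          U * PowerSeries.derivative C V + V * PowerSeries.derivative C U := by
        intro U V; rw [Derivation.leibniz]; simp
      have h3 : PowerSeries.derivative C (1 : PowerSeries C) = 0 := by simp
      rw [map_sub, h1, h1, map_sub, map_sub, h3]
      linear_combination (1 - A) * (1 - B) * ((1 - B) * hF' - (1 - A) * hE' - F * dB + E * dA)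
        - (1 - A) * (1 - B)^2 * F * hSd - (1 - B)^2 * F * g1 + (1 - A) * (1 - B) * F * g2
  have := congrArg (PowerSeries.coeff (m + 1)) key
  rw [hA, hB] at this
  simp only [sub_mul, one_mul, mul_assoc, map_sub, PowerSeries.coeff_C_mul,
    PowerSeries.coeff_succ_X_mul, hE, hF, PowerSeries.coeff_mk, map_zero] at this
  rw [Algebra.smul_def, Algebra.smul_def]
  linear_combination this
theorem expC_shift_nc {D : Type} [Ring D] [Algebra ℂ D] (t : ℂ) (l : ℕ → D) (T : D)
    (hl : ∀ s s', l s * l s' = l s' * l s) (hT : ∀ s, l s * T = T * l s)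
    (a : ℂ) (co : ℕ → ℂ) (hco : ∀ s : ℕ, t * s * co s = a ^ s - a⁻¹ ^ s) (m : ℕ) :
    expC t (fun s => l s - co s • T ^ s) (m + 1) - a⁻¹ • (T * expC t (fun s => l s - co s • T ^ s) m)
      = expC t l (m + 1) - a • (T * expC t l m) := by
  let S : Set D := insert T (Set.range l)
  have hS : ∀ x ∈ S, ∀ y ∈ S, x * y = y * x := by
    rintro x (rfl | ⟨s, rfl⟩) y (rfl | ⟨s', rfl⟩)
    · rfl
    · exact (hT s').symm
    · exact hT s
    · exact hl s s'
  letI : CommRing (Algebra.adjoin ℂ S) := Algebra.adjoinCommRingOfComm ℂ hS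
  let v : Algebra.adjoin ℂ S →ₐ[ℂ] D := (Algebra.adjoin ℂ S).val
  let l' : ℕ → Algebra.adjoin ℂ S := fun s => ⟨l s, Algebra.subset_adjoin (Or.inr ⟨s, rfl⟩)⟩
  let T' : Algebra.adjoin ℂ S := ⟨T, Algebra.subset_adjoin (Or.inl rfl)⟩
  have := congrArg v (expC_shift t l' T' a co hco m)
  simp only [map_sub, map_smul, map_mul, map_expC, map_pow] at this
  exact this

theorem expC_commute {A : Type} [Ring A] [Algebra ℂ A] (t : ℂ) (a : ℕ → A) (b : A)
    (h : ∀ s, Commute b (a s)) (n : ℕ) : Commute b (expC t a n) := by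
  induction n using Nat.strong_induction_on with
  | _ n ih =>
    cases n with
    | zero => simp [expC]
    | succ n =>
      rw [expC]
      refine Commute.smul_right (Commute.smul_right ?_ _) _
      refine Commute.sum_right _ _ _ fun s _ => Commute.smul_right ?_ _
      exact (h _).mul_right (ih _ (by omega))

theorem expC_X {A : Type} [Ring A] [Algebra ℂ A] (t : ℂ) (h : ℕ → A)
    (hh : ∀ s s', h s * h s' = h s' * h s) (X : ℤ → A) (e : ℤ)
    (a : ℂ) (co : ℕ → ℂ) (hco : ∀ s : ℕ, t * s * co s = a ^ s - a⁻¹ ^ s)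
    (hX : ∀ (s : ℕ) (n : ℤ), h s * X n - X n * h s = co s • X (n + s * e)) (m : ℕ) (n : ℤ) :
    expC t h (m + 1) * X n - a • (expC t h m * X (n + e)) =
      X n * expC t h (m + 1) - a⁻¹ • (X (n + e) * expC t h m) := by
  let T : Module.End ℂ (ℤ → A) :=
    { toFun := fun f n => f (n + e), map_add' := fun _ _ => rfl, map_smul' := fun _ _ => rfl }
  let lm : A →ₐ[ℂ] Module.End ℂ (ℤ → A) := AlgHom.ofLinearMap
    { toFun := fun b => { toFun := fun f n => b * f n
                          map_add' := fun _ _ => by ext; simp [mul_add]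
                          map_smul' := fun _ _ => by ext; simp }
      map_add' := fun _ _ => by ext; simp [add_mul]
      map_smul' := fun _ _ => by ext; simp } (by ext; simp) (fun _ _ => by ext; simp [mul_assoc])
  have lm_app : ∀ b f n, lm b f n = b * f n := fun _ _ _ => rfl
  have T_app : ∀ f n, T f n = f (n + e) := fun _ _ => rfl
  have Tpow : ∀ (s : ℕ) f n, (T ^ s) f n = f (n + s * e) := by
    intro s
    induction s with
    | zero => simp
    | succ s ih =>
      intro f n
      rw [pow_succ, Module.End.mul_apply, ih, T_app]; congr 1; push_cast; ring
  let l : ℕ → Module.End ℂ (ℤ → A) := fun s => lm (h s)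
  have hT : ∀ s, l s * T = T * l s := fun s => rfl
  have hl : ∀ s s', l s * l s' = l s' * l s := by
    intro s s'; simp only [l, ← map_mul, hh]
  have key := expC_shift_nc t l T hl hT a co hco m
  set r : ℕ → Module.End ℂ (ℤ → A) := fun s => l s - co s • T ^ s with hr
  -- right multiplication by `h s` on `X` is `r s`
  have rX : ∀ s n, r s X n = X n * h s := by
    intro s n
    have := hX s n
    simp only [hr, LinearMap.sub_apply, LinearMap.smul_apply, Pi.sub_apply, Pi.smul_apply, l,
      lm_app, Tpow, ← this]
    abel
  let rm : A → Module.End ℂ (ℤ → A) := fun b =>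
    { toFun := fun f n => f n * b
      map_add' := fun _ _ => by ext; simp [add_mul]
      map_smul' := fun _ _ => by ext; simp }
  have rcomm : ∀ b m', Commute (rm b) (expC t r m') := by
    intro b m'
    apply expC_commute
    intro s
    have c1 : Commute (rm b) (l s) := by
      ext f n; simp [rm, l, lm_app, mul_assoc]
    have c2 : Commute (rm b) T := rfl
    exact c1.sub_right ((c2.pow_right s).smul_right _)
  have eX : ∀ m' n, expC t r m' X n = X n * expC t h m' := by
    intro m'
    induction m' using Nat.strong_induction_on with
    | _ m' ih =>
      cases m' with
      | zero => intro n; simp [expC]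
      | succ m' =>
        intro n
        rw [expC, expC]
        simp only [LinearMap.smul_apply, Pi.smul_apply, mul_smul_comm, LinearMap.sum_apply,
          Finset.sum_apply, Finset.mul_sum]
        congr 2
        refine Finset.sum_congr rfl fun s hs => ?_
        congr 1
        have hrs : Commute (r (s + 1)) (expC t r (m' - s)) := by
          apply expC_commute
          intro s'
          have c1 : Commute T (l s') := (hT s').symm
          have c2 : Commute T (l (s + 1)) := (hT (s + 1)).symm
          have c3 : Commute (l (s + 1)) (l s') := hl _ _
          have c4 : Commute (T ^ (s + 1)) (T ^ s') := Commute.pow_pow_self T _ _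
          exact ((c3.sub_right ((c2.symm.pow_right s').smul_right _)).sub_left
            ((Commute.sub_right ((c1.pow_left (s + 1)))
              (c4.smul_right _)).smul_left _))
        have e1 : r (s + 1) X = rm (h (s + 1)) X := by ext n; exact rX _ _
        rw [hrs.eq, Module.End.mul_apply, e1, ← Module.End.mul_apply, ← (rcomm _ _).eq,
          Module.End.mul_apply]
        change expC t r (m' - s) X n * h (s + 1) = _
        rw [ih _ (by omega), mul_assoc,
          (expC_commute t h (h (s + 1)) (fun s' => hh _ _) (m' - s)).eq]
  have := congrFun (congrArg (fun z => z X) key) n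
  have lmexp : ∀ m', expC t l m' = lm (expC t h m') := fun m' => (map_expC lm t h m').symm
  simp only [LinearMap.sub_apply, LinearMap.smul_apply, Pi.sub_apply, Pi.smul_apply, eX, T_app,
    Module.End.mul_apply, lmexp, lm_app] at this
  exact this.symm

end QAS
end

section
namespace QAS
open Polynomial
open scoped TensorProduct

/-- index lattice of shifts -/
abbrev G4 := ℤ × ℤ × ℤ × ℤ
/-- families of elements indexed by `ℤ⁴` -/
def Fam (A : Type) := G4 → A
abbrev SR := AddMonoidAlgebra ℂ G4

instance (A : Type) [Ring A] : AddCommGroup (Fam A) := inferInstanceAs (AddCommGroup (G4 → A))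
instance (A : Type) [Ring A] [Algebra ℂ A] : Module ℂ (Fam A) :=
  inferInstanceAs (Module ℂ (G4 → A))

def shiftHom (A : Type) [Ring A] [Algebra ℂ A] : Multiplicative G4 →* Module.End ℂ (Fam A) where
  toFun g := { toFun := fun f x => f (x + g.toAdd)
               map_add' := fun _ _ => rfl
               map_smul' := fun _ _ => rfl }
  map_one' := by
    refine LinearMap.ext fun f => funext fun x => ?_
    exact congrArg f (add_zero x)
  map_mul' := fun a b => by
    refine LinearMap.ext fun f => funext fun x => ?_
    exact congrArg f (by rw [toAdd_mul, add_assoc])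

def shiftAlg (A : Type) [Ring A] [Algebra ℂ A] : SR →ₐ[ℂ] Module.End ℂ (Fam A) :=
  AddMonoidAlgebra.lift ℂ (Module.End ℂ (Fam A)) G4 (shiftHom A)

instance (A : Type) [Ring A] [Algebra ℂ A] : Module SR (Fam A) :=
  Module.compHom (Fam A) (shiftAlg A).toRingHom

def TT (g : G4) : SR := AddMonoidAlgebra.single g 1
def cs (a : ℂ) : SR := algebraMap ℂ SR a

theorem TT_smul {A : Type} [Ring A] [Algebra ℂ A] (g : G4) (f : Fam A) (x : G4) :
    (TT g • f) x = f (x + g) := by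
  change (shiftAlg A (TT g) f) x = _
  simp [shiftAlg, TT, shiftHom]
  rfl

theorem cs_smul {A : Type} [Ring A] [Algebra ℂ A] (a : ℂ) (f : Fam A) (x : G4) :
    (cs a • f) x = a • f x := by
  change (shiftAlg A (cs a) f) x = _
  rw [cs, AlgHom.commutes]; rfl

theorem fam_add {A : Type} [Ring A] (f g : Fam A) (x : G4) : (f + g) x = f x + g x := rfl
theorem fam_sub {A : Type} [Ring A] (f g : Fam A) (x : G4) : (f - g) x = f x - g x := rfl
theorem fam_neg {A : Type} [Ring A] (f : Fam A) (x : G4) : (-f) x = - f x := rfl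
theorem fam_zero {A : Type} [Ring A] (x : G4) : (0 : Fam A) x = 0 := rfl

abbrev tU : SR := TT (1,0,0,0)
abbrev tZ : SR := TT (0,1,0,0)
abbrev tW : SR := TT (0,0,1,0)
abbrev tV : SR := TT (0,0,0,1)

/-- vanishing below (`b = true`) or above (`b = false`) in the first index -/
def Vanish {A : Type} [Ring A] (b : Bool) (f : Fam A) : Prop :=
  ∃ n : ℤ, ∀ x : G4, (bif b then x.1 < n else n < x.1) → f x = 0

theorem cancel_one {A : Type} [Ring A] [Algebra ℂ A] (b : Bool) (f : Fam A) (hf : Vanish b f)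
    (g : G4) (hg : g.1 = 0) (s : ℂ) (hs : s ≠ 0)
    (h : (tU - cs s * TT g) • f = 0) : f = 0 := by
  have h1 : ∀ x : G4, f (x + (1,0,0,0)) = s • f (x + g) := by
    intro x
    have := congrFun h x
    rw [sub_smul, mul_smul, fam_sub, TT_smul, cs_smul, TT_smul, fam_zero, sub_eq_zero] at this
    exact this
  obtain ⟨n, hn⟩ := hf
  cases b with
  | true =>
    simp only [cond_true] at hn
    have key : ∀ k : ℕ, ∀ x : G4, x.1 < n + k → f x = 0 := by
      intro k
      induction k with
      | zero => intro x hx; exact hn x (by simpa using hx)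
      | succ k ih =>
        intro x hx
        have := h1 (x - (1,0,0,0))
        rw [sub_add_cancel] at this
        rw [this, ih, smul_zero]
        simp [hg]; push_cast at hx; omega
    funext x
    exact key (x.1 - n + 1).toNat x (by omega)
  | false =>
    simp only [cond_false] at hn
    have key : ∀ k : ℕ, ∀ x : G4, n - k < x.1 → f x = 0 := by
      intro k
      induction k with
      | zero => intro x hx; exact hn x (by simpa using hx)
      | succ k ih =>
        intro x hx
        have := h1 (x - g)
        rw [sub_add_cancel, ih (x - g + (1,0,0,0))] at this
        · exact (smul_eq_zero.mp this.symm).resolve_left hs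
        · simp [hg]; push_cast at hx; omega
    funext x
    exact key (n - x.1 + 1).toNat x (by omega)

theorem Vanish.lin {A : Type} [Ring A] [Algebra ℂ A] {b : Bool} {f : Fam A} (hf : Vanish b f)
    (g : G4) (hg : g.1 = 0) (s : ℂ) : Vanish b ((tU - cs s * TT g) • f) := by
  obtain ⟨n, hn⟩ := hf
  refine ⟨bif b then n - 1 else n + 1, fun x hx => ?_⟩
  rw [sub_smul, mul_smul, fam_sub, TT_smul, cs_smul, TT_smul, hn, hn]
  · simp
  · cases b <;> simp [hg] at hx ⊢ <;> omega
  · cases b <;> simp at hx ⊢ <;> omega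

theorem cancel_two {A : Type} [Ring A] [Algebra ℂ A] (b : Bool) (f : Fam A) (hf : Vanish b f)
    (g g' : G4) (hg : g.1 = 0) (hg' : g'.1 = 0) (s s' : ℂ) (hs : s ≠ 0) (hs' : s' ≠ 0)
    (h : ((tU - cs s * TT g) * (tU - cs s' * TT g')) • f = 0) : f = 0 := by
  rw [mul_smul] at h
  exact cancel_one b f hf g' hg' s' hs'
    (cancel_one b _ (hf.lin g' hg' s') g hg s hs h)

section abs
variable {R V : Type} [CommRing R] [AddCommGroup V] [Module R V]

theorem abs_serreJ (a a' U Z W : R) (haa : a * a' = 1) (p1 q1 r1 p2 q2 r2 : V)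
    (h1 : (U - a * Z) • r1 = (a * U - Z) • q1) (h2 : (U - a * W) • q1 = (a * U - W) • p1)
    (h3 : (U - a * W) • r2 = (a * U - W) • q2) (h4 : (U - a * Z) • q2 = (a * U - Z) • p2)
    (h5 : (Z - (a' * a') * W) • p1 = ((a' * a') * Z - W) • p2) :
    ((U - a * Z) * (U - a * W)) •
      (p1 - (a + a') • q1 + r1 + p2 - (a + a') • q2 + r2) = 0 := by
  have e1 : ((U - a * Z) * (U - a * W)) •
      (p1 - (a + a') • q1 + r1 + p2 - (a + a') • q2 + r2) =
      ((U - a * Z) * (U - a * W) - (a + a') * ((U - a * Z) * (a * U - W)) +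
        (a * U - Z) * (a * U - W)) • p1 +
      ((U - a * Z) * (U - a * W) - (a + a') * ((U - a * W) * (a * U - Z)) +
        (a * U - Z) * (a * U - W)) • p2 := by
    linear_combination (norm := module) (U - a * W) • h1 + (a * U - Z) • h2 -
      ((a + a') * (U - a * Z)) • h2 + (U - a * Z) • h3 + (a * U - W) • h4 -
      ((a + a') * (U - a * W)) • h4
  have e2 : (U - a * Z) * (U - a * W) - (a + a') * ((U - a * Z) * (a * U - W)) +
        (a * U - Z) * (a * U - W) = (a - a') * U * a ^ 2 * (Z - (a' * a') * W) := by grind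
  have e3 : (U - a * Z) * (U - a * W) - (a + a') * ((U - a * W) * (a * U - Z)) +
        (a * U - Z) * (a * U - W) = - ((a - a') * U * a ^ 2 * ((a' * a') * Z - W)) := by grind
  rw [e1, e2, e3]
  linear_combination (norm := module) ((a - a') * U * a ^ 2) • h5

/-- `h1..h4` move `Φ` to the right; `h5` is the quadratic relation. -/
theorem abs_serreI (a a' U Z W : R) (haa : a * a' = 1) (fxv xfv xvf fvx vfx vxf : V)
    (h1 : (U - (a' * a') * Z) • fxv = ((a' * a') * U - Z) • xfv)
    (h2 : (U - a * W) • xfv = (a * U - W) • xvf)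
    (h3 : (U - a * W) • fvx = (a * U - W) • vfx)
    (h4 : (U - (a' * a') * Z) • vfx = ((a' * a') * U - Z) • vxf)
    (h5 : (Z - a * W) • xvf = (a * Z - W) • vxf) :
    ((U - (a' * a') * Z) * (U - a * W)) •
      (fxv + xfv - (a + a') • (fvx + xvf) + vfx + vxf) = 0 := by
  have e1 : ((U - (a' * a') * Z) * (U - a * W)) •
      (fxv + xfv - (a + a') • (fvx + xvf) + vfx + vxf) =
      ((a * U - W) * (((a' * a') * U - Z) + (U - (a' * a') * Z)) -
        (a + a') * ((U - (a' * a') * Z) * (U - a * W))) • xvf +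
      (((a' * a') * U - Z) * ((U - a * W) - (a + a') * (a * U - W)) +
        ((U - (a' * a') * Z) * (U - a * W))) • vxf := by
    linear_combination (norm := module) (U - a * W) • h1 + ((a' * a') * U - Z + (U - (a' * a') * Z)) • h2 -
      ((a + a') * (U - (a' * a') * Z)) • h3 - ((a + a') * (a * U - W)) • h4 + (U - a * W) • h4
  have e2 : ((a * U - W) * (((a' * a') * U - Z) + (U - (a' * a') * Z)) -
        (a + a') * ((U - (a' * a') * Z) * (U - a * W))) =
        (1 + a' * a') * (a ^ 2 - 1) * U * (W - a' * Z) := by grind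
  have e3 : (((a' * a') * U - Z) * ((U - a * W) - (a + a') * (a * U - W)) +
        ((U - (a' * a') * Z) * (U - a * W))) =
        (1 + a' * a') * (a ^ 2 - 1) * U * (Z - a' * W) := by grind
  have e4 : (W - a' * Z) • xvf + (Z - a' * W) • vxf = 0 := by
    have e5 : W - a' * Z = - a' * (Z - a * W) := by grind
    have e6 : Z - a' * W = a' * (a * Z - W) := by grind
    rw [e5, e6]
    linear_combination (norm := module) (-a') • h5
  rw [e1, e2, e3]
  linear_combination (norm := module) ((1 + a' * a') * (a ^ 2 - 1) * U) • e4

/-- oscillation relation against an outer generator; `c` is the other outer generator -/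
theorem abs_oscA (s t U Z W X : R) (hst : s * t = 1)
    (fbcd bcfd bcdf cbfd cbdf bfdc bdcf fdcb dcfb dcbf cdfb dfbc : V)
    (h1 : (U - s * Z) • fbcd = (s * U - Z) • bcfd)
    (h2 : (U - s * W) • bcfd = (s * U - W) • bcdf)
    (h3 : (U - s * W) • cbfd = (s * U - W) • cbdf)
    (h4 : (U - s * W) • bfdc = (s * U - W) • bdcf)
    (g1 : (U - s * W) • fdcb = (s * U - W) • dcfb)
    (g2 : (U - s * Z) • dcfb = (s * U - Z) • dcbf)
    (g3 : (U - s * Z) • cdfb = (s * U - Z) • (-cbdf))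
    (g4 : (U - s * Z) • dfbc = (s * U - Z) • (-bdcf))
    (r1 : (Z - t * X) • bcdf = (t * Z - X) • cbdf)
    (r2 : (W - t * X) • bdcf = (t * W - X) • bcdf)
    (r3 : (W - t * X) • dcbf = (t * W - X) • (-cbdf))
    (r4 : (Z - t * X) • (-bdcf) = (t * Z - X) • dcbf) :
    ((U - s * Z) * (U - s * W)) •
      (fbcd + cbfd + bfdc + bcdf - (s + t) • bcfd +
        (fdcb + cdfb + dfbc + dcbf - (s + t) • dcfb)) = 0 := by
  have e1 : ((U - s * Z) * (U - s * W)) •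
      (fbcd + cbfd + bfdc + bcdf - (s + t) • bcfd +
        (fdcb + cdfb + dfbc + dcbf - (s + t) • dcfb)) =
      ((s * U - Z) * (s * U - W) + (U - s * Z) * (U - s * W)
        - (s + t) * ((U - s * Z) * (s * U - W))) • bcdf +
      ((s * U - Z) * (s * U - W) + (U - s * Z) * (U - s * W)
        - (s + t) * ((U - s * W) * (s * U - Z))) • dcbf +
      ((U - s * Z) * (s * U - W) - (U - s * W) * (s * U - Z)) • (cbdf + bdcf) := by
    linear_combination (norm := module) (U - s * W) • h1 + (s * U - Z) • h2
      - ((s + t) * (U - s * Z)) • h2 + (U - s * Z) • h3 + (U - s * Z) • h4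
      + (U - s * Z) • g1 + (s * U - W) • g2 - ((s + t) * (U - s * W)) • g2
      + (U - s * W) • g3 + (U - s * W) • g4
  have e2 : (s * U - Z) * (s * U - W) + (U - s * Z) * (U - s * W)
        - (s + t) * ((U - s * Z) * (s * U - W)) = s * s * U * (s - t) * (Z - t * t * W) := by grind
  have e3 : (s * U - Z) * (s * U - W) + (U - s * Z) * (U - s * W)
        - (s + t) * ((U - s * W) * (s * U - Z)) = s * s * U * (s - t) * (W - t * t * Z) := by grind
  have e4 : (U - s * Z) * (s * U - W) - (U - s * W) * (s * U - Z) =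
      s * s * U * (s - t) * (t * W - t * Z) := by grind
  have e5 : (Z - t * t * W) • bcdf + (W - t * t * Z) • dcbf + (t * W - t * Z) • (cbdf + bdcf)
      = 0 := by
    linear_combination (norm := module) r1 + t • r2 + r3 + t • r4
  rw [e1, e2, e3, e4]
  linear_combination (norm := module) (s * s * U * (s - t)) • e5

/-- oscillation relation against the odd generator -/
theorem abs_oscB (s t U X Z W : R) (hst : s * t = 1)
    (abcf cbaf acbf bacf afcb cfab bafc fabc afbc bcfa fcba cfba facb : V)
    (h1 : (U - t * W) • afcb = (t * U - W) • acbf)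
    (h2 : (U - s * X) • cfab = (s * U - X) • acbf)
    (h3 : (U - t * W) • bafc = (t * U - W) • bacf)
    (h4 : (U - s * X) • fabc = (s * U - X) • afbc)
    (h5 : (U - t * W) • afbc = (t * U - W) • abcf)
    (h6 : (U - s * X) • bcfa = (s * U - X) • bacf)
    (h7 : (U - t * W) • fcba = (t * U - W) • cfba)
    (h8 : (U - s * X) • cfba = (s * U - X) • cbaf)
    (h9 : (U - s * X) • facb = (s * U - X) • afcb)
    (r1 : (X - s * Z) • abcf = (s * X - Z) • bacf)
    (r2 : (X - s * Z) • acbf = (s * X - Z) • cbaf)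
    (r3 : (Z - t * W) • abcf = (t * Z - W) • acbf)
    (r4 : (Z - t * W) • bacf = (t * Z - W) • cbaf) :
    ((U - s * X) * (U - t * W)) •
      (abcf - afcb + cbaf - cfab + bafc - fabc + bcfa - fcba - (s + t) • (bacf - facb)) = 0 := by
  have e1 : ((U - s * X) * (U - t * W)) •
      (abcf - afcb + cbaf - cfab + bafc - fabc + bcfa - fcba - (s + t) • (bacf - facb)) =
      ((U - s * X) * (U - t * W) - (s * U - X) * (t * U - W)) • (abcf + cbaf) +
      (-(U - s * X) * (t * U - W) - (U - t * W) * (s * U - X)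
        + (s + t) * ((s * U - X) * (t * U - W))) • acbf +
      ((U - s * X) * (t * U - W) + (U - t * W) * (s * U - X)
        - (s + t) * ((U - s * X) * (U - t * W))) • bacf := by
    linear_combination (norm := module) (-(U - s * X)) • h1 - (U - t * W) • h2
      + (U - s * X) • h3 - (U - t * W) • h4 - (s * U - X) • h5 + (U - t * W) • h6
      - (U - s * X) • h7 - (t * U - W) • h8 + ((s + t) * (U - t * W)) • h9
      + ((s + t) * (s * U - X)) • h1
  have e2 : (U - s * X) * (U - t * W) - (s * U - X) * (t * U - W) =
      U * (t - s) * (X - W) := by grind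
  have e3 : (-(U - s * X) * (t * U - W) - (U - t * W) * (s * U - X)
        + (s + t) * ((s * U - X) * (t * U - W))) = U * (t - s) * (s * W - t * X) := by grind
  have e4 : ((U - s * X) * (t * U - W) + (U - t * W) * (s * U - X)
        - (s + t) * ((U - s * X) * (U - t * W))) = U * (t - s) * (t * W - s * X) := by grind
  have e5 : (X - W) • (abcf + cbaf) + (s * W - t * X) • acbf + (t * W - s * X) • bacf = 0 := by
    have f1 : X - W = (X - s * Z) + s * (Z - t * W) := by grind
    have f2 : X - W = t * (s * X - Z) + (t * Z - W) := by grind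
    have f3 : s * W - t * X = - t * (X - s * Z) - s * (t * Z - W) := by grind
    have f4 : t * W - s * X = - (s * X - Z) - (Z - t * W) := by grind
    rw [smul_add, f3, f4]
    nth_rewrite 1 [f1]
    rw [f2]
    linear_combination (norm := module) r1 - t • r2 + s • r3 - r4
  rw [e1, e2, e3, e4]
  linear_combination (norm := module) (U * (t - s)) • e5

end abs
end QAS
end

section
namespace QAS
open Polynomial
open scoped TensorProduct

theorem innerE_symm (M i j : ℕ) : innerE M i j = innerE M j i := by
  unfold innerE
  by_cases h : i = j
  · subst h; rfl
  · simp [h, Ne.symm h]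

theorem cc_symm (M i j : ℕ) : cc M i j = cc M j i := by
  unfold cc form4
  rw [innerE_symm M i j, innerE_symm M i (j+1), innerE_symm M (i+1) j, innerE_symm M (i+1) (j+1)]
  ring

theorem cc_self (M i : ℕ) : cc M i i = lof M i + lof M (i + 1) := by
  simp [cc, form4, innerE]

theorem cc_succ (M i : ℕ) : cc M i (i + 1) = - lof M (i + 1) := by
  simp [cc, form4, innerE]
  omega

theorem cc_far (M i j : ℕ) (h1 : i ≠ j) (h2 : j ≠ i + 1) (h3 : i ≠ j + 1) : cc M i j = 0 := by
  simp [cc, form4, innerE, h1, h3, Ne.symm h2]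

theorem cc_MM (M : ℕ) : cc M M M = 0 := by
  simp [cc_self, lof]

theorem cc_diag (M i j : ℕ) (hi : i ≠ M) (h : cc M i j = 1 ∨ cc M i j = -1) :
    cc M i i = -cc M i j - cc M i j := by
  by_cases h2 : j = i + 1
  · subst h2
    rw [cc_self, cc_succ]
    unfold lof
    split_ifs <;> omega
  by_cases h3 : i = j + 1
  · subst h3
    rw [cc_self, cc_symm M _ j, cc_succ]
    unfold lof
    split_ifs <;> omega
  by_cases h1 : i = j
  · subst h1
    rw [cc_self] at *
    unfold lof at *
    split_ifs at * <;> omega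
  rw [cc_far M i j h1 h2 h3] at h
  omega

theorem cc_ne (M i j : ℕ) (h : cc M i j = 1 ∨ cc M i j = -1) : i ≠ j := by
  rintro rfl
  rw [cc_self] at h
  unfold lof at h
  split_ifs at h <;> omega

theorem sgn_symm (M i j : ℕ) : sgn M i j = sgn M j i := by
  unfold sgn; simp [and_comm]

theorem sgn_sq (M i j : ℕ) : sgn M i j * sgn M i j = 1 := by
  unfold sgn; split_ifs <;> simp

theorem sgn_of_ne (M i j : ℕ) (h : i ≠ M) : sgn M i j = 1 := by
  unfold sgn; simp [h]

theorem sgn_of_cc (M i j : ℕ) (h : cc M i j ≠ 0) : sgn M i j = 1 := by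
  unfold sgn
  split_ifs with h1
  · obtain ⟨rfl, rfl⟩ := h1
    exact absurd (cc_MM _) h
  · rfl

def mkFam {A : Type} (f : ℤ → ℤ → ℤ → ℤ → A) : Fam A := fun x => f x.1 x.2.1 x.2.2.1 x.2.2.2

theorem mkFam_apply {A : Type} (f : ℤ → ℤ → ℤ → ℤ → A) (u z w v : ℤ) :
    mkFam f (u, z, w, v) = f u z w v := rfl

theorem fam_ext {A : Type} {F G : Fam A} (h : ∀ u z w v : ℤ, F (u, z, w, v) = G (u, z, w, v)) :
    F = G := by
  funext x
  obtain ⟨u, z, w, v⟩ := x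
  exact h u z w v

section sh
variable {A : Type} [Ring A] [Algebra ℂ A]
theorem tU_smul (f : Fam A) (u z w v : ℤ) : (tU • f) (u, z, w, v) = f (u + 1, z, w, v) := by
  rw [TT_smul]; simp
theorem tZ_smul (f : Fam A) (u z w v : ℤ) : (tZ • f) (u, z, w, v) = f (u, z + 1, w, v) := by
  rw [TT_smul]; simp
theorem tW_smul (f : Fam A) (u z w v : ℤ) : (tW • f) (u, z, w, v) = f (u, z, w + 1, v) := by
  rw [TT_smul]; simp
theorem tV_smul (f : Fam A) (u z w v : ℤ) : (tV • f) (u, z, w, v) = f (u, z, w, v + 1) := by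
  rw [TT_smul]; simp
end sh

/-- one half of the Drinfeld data -/
structure Half (A : Type) [Ring A] [Algebra ℂ A] (Q : ℂ) (M N : ℕ) where
  Q0 : Q ≠ 0
  x : Idx M N → ℤ → A
  y : Idx M N → ℤ → A
  f : Bool → Idx M N → ℤ → A
  κ : Idx M N → ℂ
  hxy : ∀ i j m n, x i m * y j n - sgn M i.1 j.1 • (y j n * x i m) =
    if i = j then κ i • (f true i (m + n) - f false i (m + n)) else 0
  hfx : ∀ b i j m n, f b i (m + 1) * x j n - (Q ^ cc M i.1 j.1) • (f b i m * x j (n + 1)) =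
    (Q ^ cc M i.1 j.1) • (x j n * f b i (m + 1)) - x j (n + 1) * f b i m
  supp : ∀ b i m, (bif b then m < 0 else 0 < m) → f b i m = 0

namespace Half
variable {A : Type} [Ring A] [Algebra ℂ A] {Q : ℂ} {M N : ℕ} (S : Half A Q M N)

/-- the Cartan part of the commutator -/
def d (k : Idx M N) (l : ℤ) (i : Idx M N) (m : ℤ) : A :=
  if i = k then S.κ i • (S.f true i (m + l) - S.f false i (m + l)) else 0

theorem xy (k : Idx M N) (l : ℤ) (i : Idx M N) (m : ℤ) :
    S.x i m * S.y k l = sgn M i.1 k.1 • (S.y k l * S.x i m) + S.d k l i m := by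
  rw [d, ← S.hxy]; abel

def R4 : Prop := ∀ i j m n, cc M i.1 j.1 = 0 →
  S.x i m * S.x j n - sgn M i.1 j.1 • (S.x j n * S.x i m) = 0

def R5 : Prop := ∀ i j m n, cc M i.1 j.1 ≠ 0 →
  S.x i (m + 1) * S.x j n - (Q ^ cc M i.1 j.1) • (S.x j n * S.x i (m + 1)) =
    (Q ^ cc M i.1 j.1) • (S.x i m * S.x j (n + 1)) - S.x j (n + 1) * S.x i m

theorem f_comm (b : Bool) (i j : Idx M N) (h : cc M i.1 j.1 = 0) (m n : ℤ) :
    S.f b i m * S.x j n = S.x j n * S.f b i m := by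
  have := cancel_one (A := A) b
    (mkFam fun u z _ _ => S.f b i u * S.x j z - S.x j z * S.f b i u)
    ⟨0, fun x hx => by simp only [mkFam]; rw [S.supp b i _ (by simpa using hx)]; simp⟩
    (0,1,0,0) rfl 1 one_ne_zero ?_
  · have := congrFun this (m, n, 0, 0)
    exact sub_eq_zero.mp this
  · apply fam_ext
    intro u z w v
    simp only [sub_smul, mul_smul, fam_sub, tU_smul, cs_smul, tZ_smul, fam_zero, mkFam_apply]
    have := S.hfx b i j u z
    simp only [h, zpow_zero, one_smul] at this ⊢
    linear_combination (norm := abel) this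

theorem d_comm (k : Idx M N) (l : ℤ) (i j : Idx M N) (h : cc M i.1 j.1 = 0) (m n : ℤ) :
    S.d k l i m * S.x j n = S.x j n * S.d k l i m := by
  unfold d
  split_ifs
  · rw [smul_mul_assoc, mul_smul_comm, sub_mul, mul_sub, S.f_comm _ _ _ h, S.f_comm _ _ _ h]
  · simp

theorem d_x (k : Idx M N) (l : ℤ) (i j : Idx M N) (m n : ℤ) :
    S.d k l i (m + 1) * S.x j n - (Q ^ cc M i.1 j.1) • (S.d k l i m * S.x j (n + 1)) =
    (Q ^ cc M i.1 j.1) • (S.x j n * S.d k l i (m + 1)) - S.x j (n + 1) * S.d k l i m := by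
  unfold d
  split_ifs
  · have h1 := S.hfx true i j (m + l) n
    have h2 := S.hfx false i j (m + l) n
    rw [show m + 1 + l = m + l + 1 by ring]
    simp only [smul_mul_assoc, mul_smul_comm, sub_mul, mul_sub]
    linear_combination (norm := module) S.κ i • h1 - S.κ i • h2
  · simp

end Half

theorem word2 {A : Type} [Ring A] [Algebra ℂ A] {y a b a' b' : A} {α β : ℂ}
    (ha : a * y = α • (y * a) + a') (hb : b * y = β • (y * b) + b') :
    a * b * y = (α * β) • (y * (a * b)) + β • (a' * b) + a * b' := by
  rw [mul_assoc, hb, mul_add, mul_smul_comm, ← mul_assoc, ha, add_mul, smul_mul_assoc, mul_assoc]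
  module

theorem word3 {A : Type} [Ring A] [Algebra ℂ A] {y a b c a' b' c' : A} {α β γ : ℂ}
    (ha : a * y = α • (y * a) + a') (hb : b * y = β • (y * b) + b')
    (hc : c * y = γ • (y * c) + c') :
    a * b * c * y = (α * β * γ) • (y * (a * b * c)) + (β * γ) • (a' * b * c) +
      γ • (a * b' * c) + a * b * c' := by
  rw [word2 (a := a * b) (a' := β • (a' * b) + a * b') (by rw [word2 ha hb]; abel) hc, add_mul,
    smul_mul_assoc]
  module

theorem word4 {A : Type} [Ring A] [Algebra ℂ A] {y a b c e a' b' c' e' : A} {α β γ δ : ℂ}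
    (ha : a * y = α • (y * a) + a') (hb : b * y = β • (y * b) + b')
    (hc : c * y = γ • (y * c) + c') (he : e * y = δ • (y * e) + e') :
    a * b * c * e * y = (α * β * γ * δ) • (y * (a * b * c * e)) + (β * γ * δ) • (a' * b * c * e) +
      (γ * δ) • (a * b' * c * e) + δ • (a * b * c' * e) + a * b * c * e' := by
  rw [word2 (a := a * b * c) (a' := (β * γ) • (a' * b * c) + γ • (a * b' * c) + a * b * c')
    (by rw [word3 ha hb hc]; abel) he]
  simp only [add_mul, smul_mul_assoc]
  module

namespace Half
variable {A : Type} [Ring A] [Algebra ℂ A] {Q : ℂ} {M N : ℕ} (S : Half A Q M N)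

def el4 (i j : Idx M N) (m n : ℤ) : A :=
  S.x i m * S.x j n - sgn M i.1 j.1 • (S.x j n * S.x i m)

def el5 (i j : Idx M N) (m n : ℤ) : A :=
  S.x i (m + 1) * S.x j n - (Q ^ cc M i.1 j.1) • (S.x j n * S.x i (m + 1)) -
    ((Q ^ cc M i.1 j.1) • (S.x i m * S.x j (n + 1)) - S.x j (n + 1) * S.x i m)

theorem el4_y (i j : Idx M N) (h : cc M i.1 j.1 = 0) (m n : ℤ) (k : Idx M N) (l : ℤ) :
    ∃ c : ℂ, S.el4 i j m n * S.y k l = c • (S.y k l * S.el4 i j m n) := by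
  refine ⟨sgn M i.1 k.1 * sgn M j.1 k.1, ?_⟩
  unfold el4
  rw [sub_mul, smul_mul_assoc, word2 (S.xy k l i m) (S.xy k l j n),
    word2 (S.xy k l j n) (S.xy k l i m), S.d_comm k l i j h,
    S.d_comm k l j i (by rw [cc_symm, h])]
  have h1 : sgn M j.1 k.1 • (S.x j n * S.d k l i m) = sgn M i.1 j.1 • (S.x j n * S.d k l i m) := by
    by_cases hk : i = k
    · subst hk; rw [sgn_symm]
    · simp [d, hk]
  have h2 : (sgn M i.1 j.1 * sgn M i.1 k.1) • (S.x i m * S.d k l j n) =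
      S.x i m * S.d k l j n := by
    by_cases hk : j = k
    · subst hk; rw [sgn_sq, one_smul]
    · simp [d, hk]
  simp only [mul_sub, mul_smul_comm]
  linear_combination (norm := module) h1 - h2

theorem el5_y (i j : Idx M N) (h : cc M i.1 j.1 ≠ 0) (m n : ℤ) (k : Idx M N) (l : ℤ) :
    ∃ c : ℂ, S.el5 i j m n * S.y k l = c • (S.y k l * S.el5 i j m n) := by
  refine ⟨sgn M i.1 k.1 * sgn M j.1 k.1, ?_⟩
  unfold el5
  simp only [sub_mul, smul_mul_assoc]
  rw [word2 (S.xy k l i _) (S.xy k l j n), word2 (S.xy k l i _) (S.xy k l j (n + 1)),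
    word2 (S.xy k l j n) (S.xy k l i _), word2 (S.xy k l j _) (S.xy k l i m)]
  have h1 : ∀ m n, sgn M j.1 k.1 • (S.d k l i m * S.x j n) = S.d k l i m * S.x j n := by
    intro m n
    by_cases hk : i = k
    · subst hk; rw [sgn_symm, sgn_of_cc _ _ _ h, one_smul]
    · simp [d, hk]
  have h2 : ∀ m n, sgn M i.1 k.1 • (S.d k l j n * S.x i m) = S.d k l j n * S.x i m := by
    intro m n
    by_cases hk : j = k
    · subst hk; rw [sgn_of_cc _ _ _ h, one_smul]
    · simp [d, hk]
  rw [h1, h1, h2, h2]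
  have h3 := S.d_x k l i j m n
  have h4 := S.d_x k l j i n m
  rw [cc_symm M j.1 i.1] at h4
  simp only [mul_sub, mul_smul_comm]
  linear_combination (norm := module) h3 + h4

end Half
end QAS
end

section
namespace QAS
open Polynomial
open scoped TensorProduct

theorem relG {A : Type} [Ring A] [Algebra ℂ A] (g g' : G4) (a : ℂ) (F G : Fam A)
    (h : ∀ u z w v : ℤ, F ((u, z, w, v) + g) - a • F ((u, z, w, v) + g') =
      a • G ((u, z, w, v) + g) - G ((u, z, w, v) + g')) :
    (TT g - cs a * TT g') • F = (cs a * TT g - TT g') • G := by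
  apply fam_ext
  intro u z w v
  simp only [sub_smul, mul_smul, fam_sub, TT_smul, cs_smul]
  exact h u z w v

theorem serre_expand {A : Type} [Ring A] [Algebra ℂ A] (q : ℂ) (hq : q ≠ 0) (x y z : A) :
    brF q x (brF q⁻¹ y z) + brF q y (brF q⁻¹ x z) =
    x * y * z + y * x * z - (q + q⁻¹) • (x * z * y + y * z * x) + z * y * x + z * x * y := by
  simp only [brF, mul_sub, sub_mul, mul_smul_comm, smul_mul_assoc, smul_sub, smul_smul,
    mul_inv_cancel₀ hq, ← mul_assoc]
  module

/-- polarised Serre expression (outer letter replaced) -/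
def polyJ {A : Type} [Ring A] [Algebra ℂ A] (t : ℂ) (F X W : A) : A :=
  X * W * F + W * X * F - t • (X * F * W + W * F * X) + F * W * X + F * X * W

/-- polarised Serre expression (inner letter replaced) -/
def polyI {A : Type} [Ring A] [Algebra ℂ A] (t : ℂ) (F X V : A) : A :=
  F * X * V + X * F * V - t • (F * V * X + X * V * F) + V * F * X + V * X * F

namespace Half
variable {A : Type} [Ring A] [Algebra ℂ A] {Q : ℂ} {M N : ℕ} (S : Half A Q M N)

def elS (i j : Idx M N) (m n k : ℤ) : A := polyJ (Q + Q⁻¹) (S.x j k) (S.x i m) (S.x i n)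

theorem Qpow (c : ℤ) (h : c = 1 ∨ c = -1) : Q + Q⁻¹ = Q ^ c + (Q ^ c)⁻¹ := by
  rcases h with rfl | rfl <;> simp [add_comm]

theorem diagpow (i j : Idx M N) (hi : i.1 ≠ M)
    (h : cc M i.1 j.1 = 1 ∨ cc M i.1 j.1 = -1) (hQ : Q ≠ 0) :
    Q ^ cc M i.1 i.1 = (Q ^ cc M i.1 j.1)⁻¹ * (Q ^ cc M i.1 j.1)⁻¹ := by
  rw [cc_diag M i.1 j.1 hi h, sub_eq_add_neg, zpow_add₀ hQ, zpow_neg]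

theorem ne_of_pm {c : ℤ} (h : c = 1 ∨ c = -1) : c ≠ 0 := by omega

theorem ne_diag (i j : Idx M N) (hi : i.1 ≠ M)
    (h : cc M i.1 j.1 = 1 ∨ cc M i.1 j.1 = -1) : cc M i.1 i.1 ≠ 0 := by
  rw [cc_diag M i.1 j.1 hi h]; omega

theorem serreJ_zero (h5 : S.R5) (i j : Idx M N) (hi : i.1 ≠ M)
    (h : cc M i.1 j.1 = 1 ∨ cc M i.1 j.1 = -1) (b : Bool) (u z w : ℤ) :
    polyJ (Q + Q⁻¹) (S.f b j u) (S.x i z) (S.x i w) = 0 := by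
  set a := Q ^ cc M i.1 j.1 with ha
  have hji : Q ^ cc M j.1 i.1 = a := by rw [cc_symm]
  have ha0 : a ≠ 0 := zpow_ne_zero _ S.Q0
  have hb := diagpow i j hi h S.Q0
  rw [← ha] at hb
  have hf := S.hfx b j i
  rw [hji] at hf
  have hx := h5 i i
  rw [hb] at hx
  have key := abs_serreJ (cs a) (cs a⁻¹) tU tZ tW
    (by rw [cs, cs, ← map_mul, mul_inv_cancel₀ ha0, map_one])
    (mkFam fun u z w _ => S.x i z * S.x i w * S.f b j u)
    (mkFam fun u z w _ => S.x i z * S.f b j u * S.x i w)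
    (mkFam fun u z w _ => S.f b j u * S.x i z * S.x i w)
    (mkFam fun u z w _ => S.x i w * S.x i z * S.f b j u)
    (mkFam fun u z w _ => S.x i w * S.f b j u * S.x i z)
    (mkFam fun u z w _ => S.f b j u * S.x i w * S.x i z)
    (by
      apply relG; intro u z w v
      simp only [Prod.mk_add_mk, add_zero, mkFam_apply]
      have := congrArg (· * S.x i w) (hf u z)
      simpa only [sub_mul, mul_sub, smul_mul_assoc, mul_smul_comm, mul_assoc] using this)
    (by
      apply relG; intro u z w v
      simp only [Prod.mk_add_mk, add_zero, mkFam_apply]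
      have := congrArg (S.x i z * ·) (hf u w)
      simpa only [sub_mul, mul_sub, smul_mul_assoc, mul_smul_comm, mul_assoc] using this)
    (by
      apply relG; intro u z w v
      simp only [Prod.mk_add_mk, add_zero, mkFam_apply]
      have := congrArg (· * S.x i z) (hf u w)
      simpa only [sub_mul, mul_sub, smul_mul_assoc, mul_smul_comm, mul_assoc] using this)
    (by
      apply relG; intro u z w v
      simp only [Prod.mk_add_mk, add_zero, mkFam_apply]
      have := congrArg (S.x i w * ·) (hf u z)
      simpa only [sub_mul, mul_sub, smul_mul_assoc, mul_smul_comm, mul_assoc] using this)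
    (by
      rw [show cs a⁻¹ * cs a⁻¹ = cs (a⁻¹ * a⁻¹) from (map_mul _ _ _).symm]
      apply relG; intro u z w v
      simp only [Prod.mk_add_mk, add_zero, mkFam_apply]
      have := congrArg (· * S.f b j u) (hx z w (ne_diag i j hi h))
      simp only [sub_mul, mul_sub, smul_mul_assoc, mul_smul_comm, mul_assoc] at this ⊢
      linear_combination (norm := module) this)
  have := congrFun (cancel_two b _ ?_ _ _ rfl rfl a a ha0 ha0 key) (u, z, w, 0)
  · simp only [fam_add, fam_sub, fam_zero, mkFam_apply, add_smul, cs_smul] at this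
    rw [Qpow _ h, ← ha]
    unfold polyJ
    linear_combination (norm := module) this
  · refine ⟨0, fun x hx => ?_⟩
    obtain ⟨u, z, w, v⟩ := x
    simp only [fam_add, fam_sub, mkFam_apply, add_smul, cs_smul, S.supp b j u hx]
    simp

theorem serreI_zero (h5 : S.R5) (i j : Idx M N) (hi : i.1 ≠ M)
    (h : cc M i.1 j.1 = 1 ∨ cc M i.1 j.1 = -1) (b : Bool) (u z w : ℤ) :
    polyI (Q + Q⁻¹) (S.f b i u) (S.x i z) (S.x j w) = 0 := by
  set a := Q ^ cc M i.1 j.1 with ha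
  have ha0 : a ≠ 0 := zpow_ne_zero _ S.Q0
  have hb := diagpow i j hi h S.Q0
  rw [← ha] at hb
  have hf := S.hfx b i j
  rw [← ha] at hf
  have hg := S.hfx b i i
  rw [hb] at hg
  have hx := h5 i j
  rw [← ha] at hx
  have hcc : cs a⁻¹ * cs a⁻¹ = cs (a⁻¹ * a⁻¹) := (map_mul _ _ _).symm
  have key := abs_serreI (cs a) (cs a⁻¹) tU tZ tW
    (by rw [cs, cs, ← map_mul, mul_inv_cancel₀ ha0, map_one])
    (mkFam fun u z w _ => S.f b i u * S.x i z * S.x j w)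
    (mkFam fun u z w _ => S.x i z * S.f b i u * S.x j w)
    (mkFam fun u z w _ => S.x i z * S.x j w * S.f b i u)
    (mkFam fun u z w _ => S.f b i u * S.x j w * S.x i z)
    (mkFam fun u z w _ => S.x j w * S.f b i u * S.x i z)
    (mkFam fun u z w _ => S.x j w * S.x i z * S.f b i u)
    (by
      rw [hcc]
      apply relG; intro u z w v
      simp only [Prod.mk_add_mk, add_zero, mkFam_apply]
      have := congrArg (· * S.x j w) (hg u z)
      simpa only [sub_mul, mul_sub, smul_mul_assoc, mul_smul_comm, mul_assoc] using this)
    (by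
      apply relG; intro u z w v
      simp only [Prod.mk_add_mk, add_zero, mkFam_apply]
      have := congrArg (S.x i z * ·) (hf u w)
      simpa only [sub_mul, mul_sub, smul_mul_assoc, mul_smul_comm, mul_assoc] using this)
    (by
      apply relG; intro u z w v
      simp only [Prod.mk_add_mk, add_zero, mkFam_apply]
      have := congrArg (· * S.x i z) (hf u w)
      simpa only [sub_mul, mul_sub, smul_mul_assoc, mul_smul_comm, mul_assoc] using this)
    (by
      rw [hcc]
      apply relG; intro u z w v
      simp only [Prod.mk_add_mk, add_zero, mkFam_apply]
      have := congrArg (S.x j w * ·) (hg u z)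
      simpa only [sub_mul, mul_sub, smul_mul_assoc, mul_smul_comm, mul_assoc] using this)
    (by
      apply relG; intro u z w v
      simp only [Prod.mk_add_mk, add_zero, mkFam_apply]
      have := congrArg (· * S.f b i u) (hx z w (ne_of_pm h))
      simp only [sub_mul, mul_sub, smul_mul_assoc, mul_smul_comm, mul_assoc] at this ⊢
      linear_combination (norm := module) this)
  rw [hcc] at key
  have := congrFun (cancel_two b _ ?_ _ _ rfl rfl (a⁻¹ * a⁻¹) a
    (mul_ne_zero (inv_ne_zero ha0) (inv_ne_zero ha0)) ha0 key) (u, z, w, 0)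
  · simp only [fam_add, fam_sub, fam_zero, mkFam_apply, add_smul, smul_add, cs_smul] at this
    rw [Qpow _ h, ← ha]
    unfold polyI
    linear_combination (norm := module) this
  · refine ⟨0, fun x hx => ?_⟩
    obtain ⟨u, z, w, v⟩ := x
    simp only [fam_add, fam_sub, mkFam_apply, add_smul, smul_add, cs_smul, S.supp b i u hx]
    simp

theorem polyJ_d (h5 : S.R5) (i j : Idx M N) (hi : i.1 ≠ M)
    (h : cc M i.1 j.1 = 1 ∨ cc M i.1 j.1 = -1) (k : Idx M N) (l z w u : ℤ) :
    polyJ (Q + Q⁻¹) (S.d k l j u) (S.x i z) (S.x i w) = 0 := by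
  unfold d
  split_ifs
  · have h1 := S.serreJ_zero h5 i j hi h true (u + l) z w
    have h2 := S.serreJ_zero h5 i j hi h false (u + l) z w
    unfold polyJ at *
    simp only [sub_mul, mul_sub, smul_mul_assoc, mul_smul_comm]
    linear_combination (norm := module) S.κ j • h1 - S.κ j • h2
  · simp [polyJ]

theorem polyI_d (h5 : S.R5) (i j : Idx M N) (hi : i.1 ≠ M)
    (h : cc M i.1 j.1 = 1 ∨ cc M i.1 j.1 = -1) (k : Idx M N) (l z w u : ℤ) :
    polyI (Q + Q⁻¹) (S.d k l i u) (S.x i z) (S.x j w) = 0 := by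
  unfold d
  split_ifs
  · have h1 := S.serreI_zero h5 i j hi h true (u + l) z w
    have h2 := S.serreI_zero h5 i j hi h false (u + l) z w
    unfold polyI at *
    simp only [sub_mul, mul_sub, smul_mul_assoc, mul_smul_comm]
    linear_combination (norm := module) S.κ i • h1 - S.κ i • h2
  · simp [polyI]

theorem elS_y (h5 : S.R5) (i j : Idx M N) (hi : i.1 ≠ M)
    (h : cc M i.1 j.1 = 1 ∨ cc M i.1 j.1 = -1) (m n p : ℤ) (k : Idx M N) (l : ℤ) :
    ∃ c : ℂ, S.elS i j m n p * S.y k l = c • (S.y k l * S.elS i j m n p) := by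
  refine ⟨sgn M j.1 k.1, ?_⟩
  have hs : sgn M i.1 k.1 = 1 := sgn_of_ne _ _ _ hi
  have X := S.xy k l i
  rw [hs] at X
  have V := S.xy k l j p
  have h0 := S.polyJ_d h5 i j hi h k l m n p
  have h1 := S.polyI_d h5 i j hi h k l m p n
  have h2 := S.polyI_d h5 i j hi h k l n p m
  have hd : ∀ m, (sgn M j.1 k.1) • S.d k l i m = S.d k l i m := by
    intro m
    by_cases hk : i = k
    · subst hk; rw [sgn_symm, sgn_of_ne _ _ _ hi, one_smul]
    · simp [d, hk]
  have e1 : ∀ m n, sgn M j.1 k.1 • (S.d k l i m * S.x i n * S.x j p) =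
      S.d k l i m * S.x i n * S.x j p := fun m n => by
    rw [← smul_mul_assoc, ← smul_mul_assoc, hd]
  have e2 : ∀ m n, sgn M j.1 k.1 • (S.d k l i m * S.x j p * S.x i n) =
      S.d k l i m * S.x j p * S.x i n := fun m n => by
    rw [← smul_mul_assoc, ← smul_mul_assoc, hd]
  have e3 : ∀ m n, sgn M j.1 k.1 • (S.x i n * S.d k l i m * S.x j p) =
      S.x i n * S.d k l i m * S.x j p := fun m n => by
    rw [← smul_mul_assoc, ← mul_smul_comm, hd]
  unfold elS
  unfold polyJ polyI at *
  simp only [sub_mul, add_mul, smul_mul_assoc]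
  rw [word3 (X m) (X n) V, word3 (X n) (X m) V, word3 (X m) V (X n), word3 (X n) V (X m),
    word3 V (X m) (X n), word3 V (X n) (X m)]
  simp only [mul_one, one_mul, one_smul, e1, e2, e3, mul_add, mul_sub, mul_smul_comm]
  linear_combination (norm := module) h0 + h1 + h2

end Half
end QAS
end

section
namespace QAS
open Polynomial
open scoped TensorProduct

def osc1 {A : Type} [Ring A] [Algebra ℂ A] (t : ℂ) (a b c d : A) : A :=
  a * b * c * d + c * b * a * d + b * a * d * c + b * c * d * a - t • (b * a * c * d)

def polyB {A : Type} [Ring A] [Algebra ℂ A] (t : ℂ) (F a b c : A) : A :=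
  a * b * c * F - a * F * c * b + c * b * a * F - c * F * a * b + b * a * F * c - F * a * b * c
    + b * c * F * a - F * c * b * a - t • (b * a * c * F - F * a * c * b)

/-- expansion of the oscillation relation modulo the quadratic relations -/
theorem osc_expand {A : Type} [Ring A] [Algebra ℂ A] (q : ℂ) (hq : q ≠ 0) (a b c d : A)
    (hac : a * c = c * a) (hbd : b * d = - (d * b)) :
    (brF q (brF q⁻¹ a b) c * d + d * brF q (brF q⁻¹ a b) c) +
      (brF q (brF q⁻¹ a d) c * b + b * brF q (brF q⁻¹ a d) c) =
    osc1 (q + q⁻¹) a b c d + osc1 (q + q⁻¹) a d c b := by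
  have e1 : c * a * b * d = - (c * a * d * b) := by
    rw [mul_assoc, hbd, mul_neg, ← mul_assoc]
  have e2 : d * b * a * c = - (b * d * a * c) := by rw [hbd]; simp
  have e3 : d * c * a * b = d * a * c * b := by rw [mul_assoc d a c, hac, mul_assoc d c a]
  have e4 : b * c * a * d = b * a * c * d := by rw [mul_assoc b a c, hac, mul_assoc b c a]
  simp only [brF, osc1, mul_sub, sub_mul, mul_smul_comm, smul_mul_assoc, smul_sub, smul_smul,
    mul_inv_cancel₀ hq, ← mul_assoc, e1, e2, e3, e4]
  module

/-- the three nodes around the odd one -/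
structure Nodes (M N : ℕ) (a b c : Idx M N) : Prop where
  hb : b.1 = M
  hac : cc M a.1 c.1 = 0
  hab : cc M a.1 b.1 = 1 ∨ cc M a.1 b.1 = -1
  hbc : cc M b.1 c.1 = - cc M a.1 b.1

theorem Nodes.symm {M N : ℕ} {a b c : Idx M N} (h : Nodes M N a b c) : Nodes M N c b a where
  hb := h.hb
  hac := by rw [cc_symm, h.hac]
  hab := by rw [cc_symm, h.hbc]; have := h.hab; omega
  hbc := by rw [cc_symm M c.1 b.1, h.hbc, cc_symm M b.1 a.1, neg_neg]

namespace Half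
variable {A : Type} [Ring A] [Algebra ℂ A] {Q : ℂ} {M N : ℕ} (S : Half A Q M N)

theorem nodes_comm (h4 : S.R4) {a b c : Idx M N} (h : Nodes M N a b c) (m n : ℤ) :
    S.x a m * S.x c n = S.x c n * S.x a m := by
  have := h4 a c m n h.hac
  rw [sgn_of_ne, one_smul, sub_eq_zero] at this
  · exact this
  · intro h1
    have h2 := h.hab
    rw [h1, h.hb, cc_MM] at h2
    omega

theorem nodes_anti (h4 : S.R4) {a b c : Idx M N} (h : Nodes M N a b c) (m n : ℤ) :
    S.x b m * S.x b n = - (S.x b n * S.x b m) := by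
  have := h4 b b m n (by rw [h.hb, cc_MM])
  rw [sgn, if_pos ⟨h.hb, h.hb⟩] at this
  linear_combination (norm := module) this

theorem oscA_zero (h4 : S.R4) (h5 : S.R5) {o b o' : Idx M N} (h : Nodes M N o b o')
    (bb : Bool) (u z w v : ℤ) :
    osc1 (Q + Q⁻¹) (S.f bb o u) (S.x b z) (S.x o' v) (S.x b w) +
      osc1 (Q + Q⁻¹) (S.f bb o u) (S.x b w) (S.x o' v) (S.x b z) = 0 := by
  set s := Q ^ cc M o.1 b.1 with hs
  have hs0 : s ≠ 0 := zpow_ne_zero _ S.Q0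
  have ht : Q ^ cc M b.1 o'.1 = s⁻¹ := by rw [h.hbc, zpow_neg]
  have hf := S.hfx bb o b
  rw [← hs] at hf
  have hx := fun z v => h5 b o' z v (by rw [h.hbc]; have := h.hab; omega)
  rw [ht] at hx
  have fc : ∀ u v, S.f bb o u * S.x o' v = S.x o' v * S.f bb o u :=
    fun u v => S.f_comm bb o o' h.hac u v
  have fc' : ∀ u v (T : A), S.f bb o u * (S.x o' v * T) = S.x o' v * (S.f bb o u * T) := by
    intro u v T; rw [← mul_assoc, fc, mul_assoc]
  have an : ∀ z w (T : A), S.x b w * (S.x b z * T) = - (S.x b z * (S.x b w * T)) := by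
    intro z w T; rw [← mul_assoc, S.nodes_anti h4 h, neg_mul, mul_assoc]
  have n1 : - (mkFam fun u z w v => S.x o' v * S.x b z * S.x b w * S.f bb o u) =
      mkFam fun u z w v => S.x o' v * S.x b w * S.x b z * S.f bb o u := by
    apply fam_ext; intro u z w v
    simp only [fam_neg, mkFam_apply, mul_assoc]
    rw [an z w, mul_neg]
  have n2 : - (mkFam fun u z w v => S.x b z * S.x b w * S.x o' v * S.f bb o u) =
      mkFam fun u z w v => S.x b w * S.x b z * S.x o' v * S.f bb o u := by
    apply fam_ext; intro u z w v
    simp only [fam_neg, mkFam_apply, mul_assoc]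
    rw [an z w]
  have key := abs_oscA (cs s) (cs s⁻¹) tU tZ tW tV
    (by rw [cs, cs, ← map_mul, mul_inv_cancel₀ hs0, map_one])
    (mkFam fun u z w v => S.f bb o u * S.x b z * S.x o' v * S.x b w)
    (mkFam fun u z w v => S.x b z * S.x o' v * S.f bb o u * S.x b w)
    (mkFam fun u z w v => S.x b z * S.x o' v * S.x b w * S.f bb o u)
    (mkFam fun u z w v => S.x o' v * S.x b z * S.f bb o u * S.x b w)
    (mkFam fun u z w v => S.x o' v * S.x b z * S.x b w * S.f bb o u)
    (mkFam fun u z w v => S.x b z * S.f bb o u * S.x b w * S.x o' v)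
    (mkFam fun u z w v => S.x b z * S.x b w * S.x o' v * S.f bb o u)
    (mkFam fun u z w v => S.f bb o u * S.x b w * S.x o' v * S.x b z)
    (mkFam fun u z w v => S.x b w * S.x o' v * S.f bb o u * S.x b z)
    (mkFam fun u z w v => S.x b w * S.x o' v * S.x b z * S.f bb o u)
    (mkFam fun u z w v => S.x o' v * S.x b w * S.f bb o u * S.x b z)
    (mkFam fun u z w v => S.x b w * S.f bb o u * S.x b z * S.x o' v)
    (by
      apply relG; intro u z w v
      simp only [Prod.mk_add_mk, add_zero, mkFam_apply]
      have := congrArg (· * (S.x o' v * S.x b w)) (hf u z)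
      simpa only [sub_mul, mul_sub, smul_mul_assoc, mul_smul_comm, mul_assoc, fc, fc'] using this)
    (by
      apply relG; intro u z w v
      simp only [Prod.mk_add_mk, add_zero, mkFam_apply]
      have := congrArg (S.x b z * S.x o' v * ·) (hf u w)
      simpa only [sub_mul, mul_sub, smul_mul_assoc, mul_smul_comm, mul_assoc, fc, fc'] using this)
    (by
      apply relG; intro u z w v
      simp only [Prod.mk_add_mk, add_zero, mkFam_apply]
      have := congrArg (S.x o' v * S.x b z * ·) (hf u w)
      simpa only [sub_mul, mul_sub, smul_mul_assoc, mul_smul_comm, mul_assoc, fc, fc'] using this)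
    (by
      apply relG; intro u z w v
      simp only [Prod.mk_add_mk, add_zero, mkFam_apply]
      have := congrArg (S.x b z * · * S.x o' v) (hf u w)
      simpa only [sub_mul, mul_sub, smul_mul_assoc, mul_smul_comm, mul_assoc, fc, fc'] using this)
    (by
      apply relG; intro u z w v
      simp only [Prod.mk_add_mk, add_zero, mkFam_apply]
      have := congrArg (· * (S.x o' v * S.x b z)) (hf u w)
      simpa only [sub_mul, mul_sub, smul_mul_assoc, mul_smul_comm, mul_assoc, fc, fc'] using this)
    (by
      apply relG; intro u z w v
      simp only [Prod.mk_add_mk, add_zero, mkFam_apply]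
      have := congrArg (S.x b w * S.x o' v * ·) (hf u z)
      simpa only [sub_mul, mul_sub, smul_mul_assoc, mul_smul_comm, mul_assoc, fc, fc'] using this)
    (by
      rw [n1]
      apply relG; intro u z w v
      simp only [Prod.mk_add_mk, add_zero, mkFam_apply]
      have := congrArg (S.x o' v * S.x b w * ·) (hf u z)
      simpa only [sub_mul, mul_sub, smul_mul_assoc, mul_smul_comm, mul_assoc, fc, fc'] using this)
    (by
      rw [n2]
      apply relG; intro u z w v
      simp only [Prod.mk_add_mk, add_zero, mkFam_apply]
      have := congrArg (S.x b w * · * S.x o' v) (hf u z)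
      simpa only [sub_mul, mul_sub, smul_mul_assoc, mul_smul_comm, mul_assoc, fc, fc'] using this)
    (by
      apply relG; intro u z w v
      simp only [Prod.mk_add_mk, add_zero, mkFam_apply]
      have := congrArg (· * (S.x b w * S.f bb o u)) (hx z v)
      simp only [sub_mul, mul_sub, smul_mul_assoc, mul_smul_comm, mul_assoc] at this ⊢
      linear_combination (norm := module) this)
    (by
      apply relG; intro u z w v
      simp only [Prod.mk_add_mk, add_zero, mkFam_apply]
      have := congrArg (S.x b z * · * S.f bb o u) (hx w v)
      simp only [sub_mul, mul_sub, smul_mul_assoc, mul_smul_comm, mul_assoc] at this ⊢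
      linear_combination (norm := module) this)
    (by
      rw [n1]
      apply relG; intro u z w v
      simp only [Prod.mk_add_mk, add_zero, mkFam_apply]
      have := congrArg (· * (S.x b z * S.f bb o u)) (hx w v)
      simp only [sub_mul, mul_sub, smul_mul_assoc, mul_smul_comm, mul_assoc] at this ⊢
      linear_combination (norm := module) this)
    (by
      rw [n2]
      apply relG; intro u z w v
      simp only [Prod.mk_add_mk, add_zero, mkFam_apply]
      have := congrArg (S.x b w * · * S.f bb o u) (hx z v)
      simp only [sub_mul, mul_sub, smul_mul_assoc, mul_smul_comm, mul_assoc] at this ⊢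
      linear_combination (norm := module) this)
  have := congrFun (cancel_two bb _ ?_ _ _ rfl rfl s s hs0 hs0 key) (u, z, w, v)
  · simp only [fam_add, fam_sub, fam_zero, mkFam_apply, add_smul, cs_smul] at this
    rw [Qpow _ h.hab, ← hs]
    unfold osc1
    simp only [mul_assoc, fc, fc'] at this ⊢
    linear_combination (norm := module) this
  · refine ⟨0, fun x hx => ?_⟩
    obtain ⟨u, z, w, v⟩ := x
    simp only [fam_add, fam_sub, mkFam_apply, add_smul, cs_smul, S.supp bb o u hx]
    simp

theorem oscB_zero (h4 : S.R4) (h5 : S.R5) {a b c : Idx M N} (h : Nodes M N a b c)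
    (bb : Bool) (u z w v : ℤ) :
    polyB (Q + Q⁻¹) (S.f bb b u) (S.x a z) (S.x b w) (S.x c v) = 0 := by
  set s := Q ^ cc M a.1 b.1 with hs
  have hs0 : s ≠ 0 := zpow_ne_zero _ S.Q0
  have hs' : Q ^ cc M b.1 a.1 = s := by rw [cc_symm]
  have ht : Q ^ cc M b.1 c.1 = s⁻¹ := by rw [h.hbc, zpow_neg]
  have hfa := S.hfx bb b a
  rw [hs'] at hfa
  have hfc := S.hfx bb b c
  rw [ht] at hfc
  have hx := fun z v => h5 b c z v (by rw [h.hbc]; have := h.hab; omega)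
  rw [ht] at hx
  have hy := fun z v => h5 a b z v (by have := h.hab; omega)
  rw [← hs] at hy
  have fb : ∀ u v, S.f bb b u * S.x b v = S.x b v * S.f bb b u :=
    fun u v => S.f_comm bb b b (by rw [h.hb, cc_MM]) u v
  have fb' : ∀ u v (T : A), S.f bb b u * (S.x b v * T) = S.x b v * (S.f bb b u * T) := by
    intro u v T; rw [← mul_assoc, fb, mul_assoc]
  have ca : ∀ u v, S.x c v * S.x a u = S.x a u * S.x c v :=
    fun u v => (S.nodes_comm h4 h u v).symm
  have ca' : ∀ u v (T : A), S.x c v * (S.x a u * T) = S.x a u * (S.x c v * T) := by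
    intro u v T; rw [← mul_assoc, ca, mul_assoc]
  have key := abs_oscB (cs s) (cs s⁻¹) tU tZ tW tV
    (by rw [cs, cs, ← map_mul, mul_inv_cancel₀ hs0, map_one])
    (mkFam fun u z w v => S.x a z * S.x b w * S.x c v * S.f bb b u)
    (mkFam fun u z w v => S.x c v * S.x b w * S.x a z * S.f bb b u)
    (mkFam fun u z w v => S.x a z * S.x c v * S.x b w * S.f bb b u)
    (mkFam fun u z w v => S.x b w * S.x a z * S.x c v * S.f bb b u)
    (mkFam fun u z w v => S.x a z * S.f bb b u * S.x c v * S.x b w)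
    (mkFam fun u z w v => S.x c v * S.f bb b u * S.x a z * S.x b w)
    (mkFam fun u z w v => S.x b w * S.x a z * S.f bb b u * S.x c v)
    (mkFam fun u z w v => S.f bb b u * S.x a z * S.x b w * S.x c v)
    (mkFam fun u z w v => S.x a z * S.f bb b u * S.x b w * S.x c v)
    (mkFam fun u z w v => S.x b w * S.x c v * S.f bb b u * S.x a z)
    (mkFam fun u z w v => S.f bb b u * S.x c v * S.x b w * S.x a z)
    (mkFam fun u z w v => S.x c v * S.f bb b u * S.x b w * S.x a z)
    (mkFam fun u z w v => S.f bb b u * S.x a z * S.x c v * S.x b w)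
    (by
      apply relG; intro u z w v
      simp only [Prod.mk_add_mk, add_zero, mkFam_apply]
      have := congrArg (S.x a z * · * S.x b w) (hfc u v)
      simpa only [sub_mul, mul_sub, smul_mul_assoc, mul_smul_comm, mul_assoc, fb, fb', ca, ca']
        using this)
    (by
      apply relG; intro u z w v
      simp only [Prod.mk_add_mk, add_zero, mkFam_apply]
      have := congrArg (S.x c v * · * S.x b w) (hfa u z)
      simpa only [sub_mul, mul_sub, smul_mul_assoc, mul_smul_comm, mul_assoc, fb, fb', ca, ca']
        using this)
    (by
      apply relG; intro u z w v
      simp only [Prod.mk_add_mk, add_zero, mkFam_apply]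
      have := congrArg (S.x b w * S.x a z * ·) (hfc u v)
      simpa only [sub_mul, mul_sub, smul_mul_assoc, mul_smul_comm, mul_assoc, fb, fb', ca, ca']
        using this)
    (by
      apply relG; intro u z w v
      simp only [Prod.mk_add_mk, add_zero, mkFam_apply]
      have := congrArg (· * (S.x b w * S.x c v)) (hfa u z)
      simpa only [sub_mul, mul_sub, smul_mul_assoc, mul_smul_comm, mul_assoc, fb, fb', ca, ca']
        using this)
    (by
      apply relG; intro u z w v
      simp only [Prod.mk_add_mk, add_zero, mkFam_apply]
      have := congrArg (S.x a z * S.x b w * ·) (hfc u v)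
      simpa only [sub_mul, mul_sub, smul_mul_assoc, mul_smul_comm, mul_assoc, fb, fb', ca, ca']
        using this)
    (by
      apply relG; intro u z w v
      simp only [Prod.mk_add_mk, add_zero, mkFam_apply]
      have := congrArg (S.x b w * S.x c v * ·) (hfa u z)
      simpa only [sub_mul, mul_sub, smul_mul_assoc, mul_smul_comm, mul_assoc, fb, fb', ca, ca']
        using this)
    (by
      apply relG; intro u z w v
      simp only [Prod.mk_add_mk, add_zero, mkFam_apply]
      have := congrArg (· * (S.x b w * S.x a z)) (hfc u v)
      simpa only [sub_mul, mul_sub, smul_mul_assoc, mul_smul_comm, mul_assoc, fb, fb', ca, ca']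
        using this)
    (by
      apply relG; intro u z w v
      simp only [Prod.mk_add_mk, add_zero, mkFam_apply]
      have := congrArg (S.x c v * S.x b w * ·) (hfa u z)
      simpa only [sub_mul, mul_sub, smul_mul_assoc, mul_smul_comm, mul_assoc, fb, fb', ca, ca']
        using this)
    (by
      apply relG; intro u z w v
      simp only [Prod.mk_add_mk, add_zero, mkFam_apply]
      have := congrArg (· * (S.x c v * S.x b w)) (hfa u z)
      simpa only [sub_mul, mul_sub, smul_mul_assoc, mul_smul_comm, mul_assoc, fb, fb', ca, ca']
        using this)
    (by
      apply relG; intro u z w v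
      simp only [Prod.mk_add_mk, add_zero, mkFam_apply]
      have := congrArg (· * (S.x c v * S.f bb b u)) (hy z w)
      simp only [sub_mul, mul_sub, smul_mul_assoc, mul_smul_comm, mul_assoc, ca, ca'] at this ⊢
      linear_combination (norm := module) this)
    (by
      apply relG; intro u z w v
      simp only [Prod.mk_add_mk, add_zero, mkFam_apply]
      have := congrArg (S.x c v * · * S.f bb b u) (hy z w)
      simp only [sub_mul, mul_sub, smul_mul_assoc, mul_smul_comm, mul_assoc, ca, ca'] at this ⊢
      linear_combination (norm := module) this)
    (by
      apply relG; intro u z w v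
      simp only [Prod.mk_add_mk, add_zero, mkFam_apply]
      have := congrArg (S.x a z * · * S.f bb b u) (hx w v)
      simp only [sub_mul, mul_sub, smul_mul_assoc, mul_smul_comm, mul_assoc, ca, ca'] at this ⊢
      linear_combination (norm := module) this)
    (by
      apply relG; intro u z w v
      simp only [Prod.mk_add_mk, add_zero, mkFam_apply]
      have := congrArg (· * (S.x a z * S.f bb b u)) (hx w v)
      simp only [sub_mul, mul_sub, smul_mul_assoc, mul_smul_comm, mul_assoc, ca, ca'] at this ⊢
      linear_combination (norm := module) this)
  have := congrFun (cancel_two bb _ ?_ _ _ rfl rfl s s⁻¹ hs0 (inv_ne_zero hs0) key) (u, z, w, v)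
  · simp only [fam_add, fam_sub, fam_zero, mkFam_apply, add_smul, smul_sub, cs_smul] at this
    rw [Qpow _ h.hab, ← hs]
    unfold polyB
    linear_combination (norm := module) this
  · refine ⟨0, fun x hx => ?_⟩
    obtain ⟨u, z, w, v⟩ := x
    simp only [fam_add, fam_sub, mkFam_apply, add_smul, smul_sub, cs_smul, S.supp bb b u hx]
    simp

/-- normal form of the oscillation element -/
def elO (a b c : Idx M N) (m n k u : ℤ) : A :=
  osc1 (Q + Q⁻¹) (S.x a m) (S.x b n) (S.x c k) (S.x b u) +
    osc1 (Q + Q⁻¹) (S.x a m) (S.x b u) (S.x c k) (S.x b n)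

theorem osc1_swap (t : ℂ) (a b c d : A) (h : a * c = c * a) :
    osc1 t a b c d = osc1 t c b a d := by
  have e4 : b * c * a * d = b * a * c * d := by rw [mul_assoc b a c, h, mul_assoc b c a]
  unfold osc1
  rw [e4]; abel

theorem elO_y (h4 : S.R4) (h5 : S.R5) {a b c : Idx M N} (h : Nodes M N a b c) (m n p r : ℤ)
    (k : Idx M N) (l : ℤ) :
    ∃ α : ℂ, S.elO a b c m n p r * S.y k l = α • (S.y k l * S.elO a b c m n p r) := by
  have hne : ∀ {a b c : Idx M N}, Nodes M N a b c → a.1 ≠ M := by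
    intro a b c h h1
    have h2 := h.hab
    rw [h1, h.hb, cc_MM] at h2
    omega
  have ha1 := hne h
  have hc1 := hne h.symm
  have hab : a ≠ b := fun e => ha1 (by rw [e, h.hb])
  have hcb : c ≠ b := fun e => hc1 (by rw [e, h.hb])
  have hac : a ≠ c := by
    rintro rfl
    have h1 := h.hbc
    rw [cc_symm] at h1
    have := h.hab
    omega
  refine ⟨1, ?_⟩
  have Xa := S.xy k l a m
  have Xb := S.xy k l b
  have Xc := S.xy k l c p
  rw [sgn_of_ne _ _ _ ha1] at Xa
  rw [sgn_of_ne _ _ _ hc1] at Xc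
  unfold elO osc1
  simp only [sub_mul, add_mul, smul_mul_assoc]
  rw [word4 Xa (Xb n) Xc (Xb r), word4 Xc (Xb n) Xa (Xb r), word4 (Xb n) Xa (Xb r) Xc,
    word4 (Xb n) Xc (Xb r) Xa, word4 (Xb n) Xa Xc (Xb r),
    word4 Xa (Xb r) Xc (Xb n), word4 Xc (Xb r) Xa (Xb n), word4 (Xb r) Xa (Xb n) Xc,
    word4 (Xb r) Xc (Xb n) Xa, word4 (Xb r) Xa Xc (Xb n)]
  simp only [mul_add, mul_sub, mul_smul_comm, one_mul, mul_one, one_smul, sgn_sq]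
  by_cases hka : a = k
  · subst hka
    have db : ∀ n, S.d a l b n = 0 := fun n => by simp [d, Ne.symm hab]
    have dc : S.d a l c p = 0 := by simp [d, Ne.symm hac]
    have hs : sgn M b.1 a.1 = 1 := by rw [sgn_symm, sgn_of_ne _ _ _ ha1]
    have h1 := S.oscA_zero h4 h5 h true (m + l) n r p
    have h2 := S.oscA_zero h4 h5 h false (m + l) n r p
    have da : S.d a l a m = S.κ a • (S.f true a (m + l) - S.f false a (m + l)) := by simp [d]
    simp only [db, dc, hs, da, mul_zero, zero_mul, add_zero, zero_add, smul_zero, one_smul]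
    unfold osc1 at h1 h2
    simp only [sub_mul, mul_sub, smul_mul_assoc, mul_smul_comm]
    linear_combination (norm := module) S.κ a • h1 - S.κ a • h2
  by_cases hkc : c = k
  · subst hkc
    have db : ∀ n, S.d c l b n = 0 := fun n => by simp [d, Ne.symm hcb]
    have da : S.d c l a m = 0 := by simp [d, hac]
    have hs : sgn M b.1 c.1 = 1 := by rw [sgn_symm, sgn_of_ne _ _ _ hc1]
    have h1 := S.oscA_zero h4 h5 h.symm true (p + l) n r m
    have h2 := S.oscA_zero h4 h5 h.symm false (p + l) n r m
    have cm : ∀ bb, S.f bb c (p + l) * S.x a m = S.x a m * S.f bb c (p + l) :=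
      fun bb => S.f_comm bb c a h.symm.hac _ _
    rw [osc1_swap _ _ _ _ _ (cm _), osc1_swap _ _ (S.x b r) _ _ (cm _)] at h1 h2
    have dc : S.d c l c p = S.κ c • (S.f true c (p + l) - S.f false c (p + l)) := by simp [d]
    simp only [db, dc, hs, da, mul_zero, zero_mul, add_zero, zero_add, smul_zero, one_smul]
    unfold osc1 at h1 h2
    simp only [sub_mul, mul_sub, smul_mul_assoc, mul_smul_comm]
    linear_combination (norm := module) S.κ c • h1 - S.κ c • h2
  have da : S.d k l a m = 0 := by simp [d, hka]
  have dc : S.d k l c p = 0 := by simp [d, hkc]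
  by_cases hkb : b = k
  · subst hkb
    have hs : sgn M b.1 b.1 = -1 := by simp [sgn, h.hb]
    have h1 := S.oscB_zero h4 h5 h true (n + l) m r p
    have h2 := S.oscB_zero h4 h5 h false (n + l) m r p
    have h3 := S.oscB_zero h4 h5 h true (r + l) m n p
    have h4 := S.oscB_zero h4 h5 h false (r + l) m n p
    have db : ∀ n, S.d b l b n = S.κ b • (S.f true b (n + l) - S.f false b (n + l)) :=
      fun n => by simp [d]
    simp only [db, dc, hs, da, mul_zero, zero_mul, add_zero, zero_add, smul_zero, one_smul]
    unfold polyB at h1 h2 h3 h4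
    simp only [sub_mul, mul_sub, smul_mul_assoc, mul_smul_comm]
    linear_combination (norm := module) S.κ b • h1 - S.κ b • h2 + S.κ b • h3 - S.κ b • h4
  have db : ∀ n, S.d k l b n = 0 := fun n => by simp [d, hkb]
  simp only [db, dc, da, mul_zero, zero_mul, add_zero, smul_zero]

end Half
end QAS
end

section
namespace QAS
open Polynomial
open scoped TensorProduct

abbrev JJ (M N : ℕ) := {i : ℕ // i ≤ M + N - 1}

def toJ {M N : ℕ} (i : Idx M N) : JJ M N := ⟨i.1, i.2.2⟩

/-- the weight by which `K_a` acts on `X_j` -/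
def wt {M N : ℕ} (a : JJ M N) (j : Idx M N) : ℤ :=
  if a.1 = 0 then (if j.1 = 1 then 1 else 0) else cc M a.1 j.1

theorem wt_toJ {M N : ℕ} (i j : Idx M N) : wt (toJ i) j = cc M i.1 j.1 := by
  have : i.1 ≠ 0 := by have := i.2.1; omega
  simp [wt, toJ, this]

/-- the coefficient of the action of `h_{i,s}` on `X_j` -/
def coh (q : ℂ) {M N : ℕ} (i j : Idx M N) (s : ℤ) : ℂ :=
  qint (qpar q M i.1) (s * lof M i.1 * cc M i.1 j.1) / (s : ℂ)

def tq (q : ℂ) {M N : ℕ} (i : Idx M N) : ℂ := qpar q M i.1 - (qpar q M i.1)⁻¹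

def hz {B : Type} [Ring B] (h : {s : ℤ // s ≠ 0} → B) (s : ℤ) : B :=
  if hs : s ≠ 0 then h ⟨s, hs⟩ else 0

def pg {B : Type} [Ring B] [Algebra ℂ B] (t : ℂ) (k : B) (h : ℕ → B) (m : ℤ) : B :=
  if 0 ≤ m then k * expC t h m.toNat else 0

/-- the elements `φ^±` -/
def phiG {B : Type} [Ring B] [Algebra ℂ B] (t : ℂ) (k ki : B) (h : {s : ℤ // s ≠ 0} → B)
    (b : Bool) (m : ℤ) : B :=
  if b then pg t k (fun s => hz h s) m else pg (-t) ki (fun s => hz h (-(s : ℤ))) (-m)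

theorem map_hz {B C : Type} [Ring B] [Ring C] [Algebra ℂ B] [Algebra ℂ C] (f : B →ₐ[ℂ] C)
    (h : {s : ℤ // s ≠ 0} → B) (s : ℤ) : f (hz h s) = hz (fun s => f (h s)) s := by
  unfold hz; split_ifs <;> simp

theorem map_phiG {B C : Type} [Ring B] [Ring C] [Algebra ℂ B] [Algebra ℂ C] (f : B →ₐ[ℂ] C)
    (t : ℂ) (k ki : B) (h : {s : ℤ // s ≠ 0} → B) (b : Bool) (m : ℤ) :
    f (phiG t k ki h b m) = phiG t (f k) (f ki) (fun s => f (h s)) b m := by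
  unfold phiG pg
  split_ifs <;> simp [map_expC, map_hz]

/-- a system of elements satisfying the relations (R1)-(R3) -/
structure Sys (B : Type) [Ring B] [Algebra ℂ B] (q : ℂ) (M N : ℕ) where
  hq0 : q ≠ 0
  hq2 : q ^ 2 ≠ 1
  xp : Idx M N → ℤ → B
  xm : Idx M N → ℤ → B
  k : JJ M N → B
  ki : JJ M N → B
  h : Idx M N → {s : ℤ // s ≠ 0} → B
  kki : ∀ a, k a * ki a = 1
  kik : ∀ a, ki a * k a = 1
  kk : ∀ a b, k a * k b = k b * k a
  kh : ∀ a i s, k a * h i s = h i s * k a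
  hh : ∀ i j s t, h i s * h j t = h j t * h i s
  kxp : ∀ a j n, k a * xp j n = (q ^ wt a j) • (xp j n * k a)
  kxm : ∀ a j n, k a * xm j n = (q ^ (- wt a j)) • (xm j n * k a)
  hxp : ∀ i j s n, h i s * xp j n - xp j n * h i s = coh q i j s.1 • xp j (n + s.1)
  hxm : ∀ i j s n, h i s * xm j n - xm j n * h i s = -(coh q i j s.1 • xm j (n + s.1))
  xx : ∀ i j m n, xp i m * xm j n - sgn M i.1 j.1 • (xm j n * xp i m) =
    if i = j then (tq q i)⁻¹ • (phiG (tq q i) (k (toJ i)) (ki (toJ i)) (h i) true (m + n) -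
      phiG (tq q i) (k (toJ i)) (ki (toJ i)) (h i) false (m + n)) else 0

theorem tq_ne {q : ℂ} (h0 : q ≠ 0) (h2 : q ^ 2 ≠ 1) {M N : ℕ} (i : Idx M N) : tq q i ≠ 0 := by
  have key : q - q⁻¹ ≠ 0 := by
    intro h
    apply h2
    have : q * (q - q⁻¹) = 0 := by rw [h, mul_zero]
    rw [mul_sub, mul_inv_cancel₀ h0] at this
    linear_combination this
  unfold tq qpar lof
  split_ifs
  · simpa using key
  · intro h; apply key; simp at h; linear_combination -h

theorem coh_eq {q : ℂ} (h0 : q ≠ 0) (h2 : q ^ 2 ≠ 1) {M N : ℕ} (i j : Idx M N) (s : ℤ) :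
    tq q i * s * coh q i j s = (q ^ cc M i.1 j.1) ^ s - (q ^ cc M i.1 j.1)⁻¹ ^ s := by
  have ht := tq_ne h0 h2 i
  by_cases hs : s = 0
  · simp [hs]
  have hs' : (s : ℂ) ≠ 0 := by exact_mod_cast hs
  have hl : lof M i.1 * lof M i.1 = 1 := by unfold lof; split_ifs <;> rfl
  unfold coh qint
  change tq q i * s * ((_ / tq q i) / s) = _
  have e1 : qpar q M i.1 ^ (s * lof M i.1 * cc M i.1 j.1) = (q ^ cc M i.1 j.1) ^ s := by
    rw [qpar, ← zpow_mul, ← zpow_mul]; congr 1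
    linear_combination (s * cc M i.1 j.1) * hl
  have e2 : qpar q M i.1 ^ (-(s * lof M i.1 * cc M i.1 j.1)) = (q ^ cc M i.1 j.1)⁻¹ ^ s := by
    rw [zpow_neg, e1, inv_zpow]
  rw [e1, e2]; field_simp

theorem pg_X {B : Type} [Ring B] [Algebra ℂ B] (t : ℂ) (k : B) (h : ℕ → B)
    (hh : ∀ s s', h s * h s' = h s' * h s) (X : ℤ → B) (e : ℤ)
    (a : ℂ) (ha : a ≠ 0) (co : ℕ → ℂ) (hco : ∀ s : ℕ, t * s * co s = a ^ s - a⁻¹ ^ s)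
    (hX : ∀ (s : ℕ) (n : ℤ), h s * X n - X n * h s = co s • X (n + s * e))
    (hk : ∀ n, k * X n = a • (X n * k)) (m : ℤ) (n : ℤ) :
    pg t k h (m + 1) * X n - a • (pg t k h m * X (n + e)) =
      a • (X n * pg t k h (m + 1)) - X (n + e) * pg t k h m := by
  unfold pg
  rcases lt_trichotomy m (-1) with hm | hm | hm
  · rw [if_neg (by omega), if_neg (by omega)]; simp
  · subst hm; simp [expC, hk]
  · have h1 := expC_X t h hh X e a co hco hX m.toNat n
    rw [if_pos (by omega), if_pos (by omega)]
    have e1 : (m + 1).toNat = m.toNat + 1 := by omega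
    rw [e1]
    have h2 := congrArg (fun z => k * z) h1
    simp only [mul_sub, mul_smul_comm, ← mul_assoc, hk, smul_mul_assoc] at h2
    simp only [← mul_assoc]
    rw [h2, smul_smul, inv_mul_cancel₀ ha, one_smul]

namespace Sys
variable {B : Type} [Ring B] [Algebra ℂ B] {q : ℂ} {M N : ℕ} (S : Sys B q M N)

def phi (b : Bool) (i : Idx M N) (m : ℤ) : B :=
  phiG (tq q i) (S.k (toJ i)) (S.ki (toJ i)) (S.h i) b m

theorem ki_comm {a : JJ M N} {x : B} (h : S.k a * x = x * S.k a) : S.ki a * x = x * S.ki a := by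
  calc S.ki a * x = S.ki a * (x * S.k a) * S.ki a := by
        rw [mul_assoc, mul_assoc, S.kki, mul_one]
    _ = _ := by rw [← h, ← mul_assoc, S.kik, one_mul]

theorem ki_x {a : JJ M N} {x : B} {c : ℂ} (hc : c ≠ 0) (h : S.k a * x = c • (x * S.k a)) :
    S.ki a * x = c⁻¹ • (x * S.ki a) := by
  have h1 : S.ki a * (S.k a * x) * S.ki a = c • (S.ki a * (x * S.k a) * S.ki a) := by
    rw [h]; simp
  rw [← mul_assoc, S.kik, one_mul, mul_assoc, mul_assoc, S.kki, mul_one] at h1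
  rw [h1, smul_smul, inv_mul_cancel₀ hc, one_smul]

theorem kiki (a b : JJ M N) : S.ki a * S.ki b = S.ki b * S.ki a :=
  S.ki_comm (S.ki_comm (S.kk b a)).symm
theorem kki2 (a b : JJ M N) : S.k a * S.ki b = S.ki b * S.k a := (S.ki_comm (S.kk b a)).symm
theorem kih (a : JJ M N) (i s) : S.ki a * S.h i s = S.h i s * S.ki a := S.ki_comm (S.kh a i s)
theorem kixp (a : JJ M N) (j n) :
    S.ki a * S.xp j n = (q ^ wt a j)⁻¹ • (S.xp j n * S.ki a) :=
  S.ki_x (zpow_ne_zero _ S.hq0) (S.kxp a j n)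
theorem kixm (a : JJ M N) (j n) :
    S.ki a * S.xm j n = (q ^ (-wt a j))⁻¹ • (S.xm j n * S.ki a) :=
  S.ki_x (zpow_ne_zero _ S.hq0) (S.kxm a j n)

theorem hz_comm (i j : Idx M N) (s t : ℤ) :
    hz (S.h i) s * hz (S.h j) t = hz (S.h j) t * hz (S.h i) s := by
  unfold hz; split_ifs <;> simp [S.hh]

theorem hz_xp (i j : Idx M N) (s n : ℤ) :
    hz (S.h i) s * S.xp j n - S.xp j n * hz (S.h i) s = coh q i j s • S.xp j (n + s) := by
  unfold hz; split_ifs with h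
  · exact S.hxp i j ⟨s, h⟩ n
  · push Not at h; simp [h, coh]

theorem phi_xp (b : Bool) (i j : Idx M N) (m n : ℤ) :
    S.phi b i (m + 1) * S.xp j n - (q ^ cc M i.1 j.1) • (S.phi b i m * S.xp j (n + 1)) =
    (q ^ cc M i.1 j.1) • (S.xp j n * S.phi b i (m + 1)) - S.xp j (n + 1) * S.phi b i m := by
  set a := q ^ cc M i.1 j.1 with ha
  have ha0 : a ≠ 0 := zpow_ne_zero _ S.hq0
  cases b
  · have := pg_X (-tq q i) (S.ki (toJ i)) (fun s => hz (S.h i) (-(s : ℤ)))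
      (fun s s' => S.hz_comm i i _ _) (S.xp j) (-1) a⁻¹ (inv_ne_zero ha0)
      (fun s => coh q i j (-(s : ℤ))) (fun s => by
        have := coh_eq S.hq0 S.hq2 i j (-(s : ℤ))
        rw [← ha] at this
        simp only [zpow_neg, zpow_natCast, inv_pow, inv_inv] at this ⊢
        rw [← this]; push_cast; ring)
      (fun s n => by simpa using S.hz_xp i j (-(s : ℤ)) n)
      (fun n => by rw [S.kixp, wt_toJ]) (-m - 1) (n + 1)
    have e1 : -m - 1 + 1 = -m := by ring
    have e2 : n + 1 + -1 = n := by ring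
    have e3 : -m - 1 = -(m + 1) := by ring
    rw [e1, e2, e3] at this
    simp only [phi, phiG]
    simp only [Bool.false_eq_true, if_false]
    have h2 := congrArg (fun z => (-a) • z) this
    simp only [smul_sub, smul_smul, neg_mul, mul_inv_cancel₀ ha0] at h2
    linear_combination (norm := module) h2
  · have := pg_X (tq q i) (S.k (toJ i)) (fun s => hz (S.h i) (s : ℤ))
      (fun s s' => S.hz_comm i i _ _) (S.xp j) (1) a ha0
      (fun s => coh q i j (s : ℤ)) (fun s => by
        have := coh_eq S.hq0 S.hq2 i j (s : ℤ)
        simpa [← ha] using this)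
      (fun s n => by simpa using S.hz_xp i j (s : ℤ) n)
      (fun n => by rw [S.kxp, wt_toJ]) m n
    simpa [phi, phiG] using this

def half : Half B q M N where
  Q0 := S.hq0
  x := S.xp
  y := S.xm
  f := S.phi
  κ := fun i => (tq q i)⁻¹
  hxy := fun i j m n => S.xx i j m n
  hfx := S.phi_xp
  supp := by
    intro b i m h
    cases b <;> simp [phi, phiG, pg] at * <;> omega

theorem phi_comm (b : Bool) (i : Idx M N) (m : ℤ) (x : B) (hk : S.k (toJ i) * x = x * S.k (toJ i))
    (hh : ∀ s, S.h i s * x = x * S.h i s) : Commute x (S.phi b i m) := by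
  have hz' : ∀ s, Commute x (hz (S.h i) s) := by
    intro s; unfold hz; split_ifs with h
    · exact (hh _).symm
    · exact Commute.zero_right _
  unfold phi phiG pg
  split_ifs
  · exact Commute.mul_right hk.symm (expC_commute _ _ _ (fun s => hz' _) _)
  · exact Commute.zero_right _
  · exact Commute.mul_right (S.ki_comm hk).symm (expC_commute _ _ _ (fun s => hz' _) _)
  · exact Commute.zero_right _

end Sys

theorem expC_op {B : Type} [Ring B] [Algebra ℂ B] (t : ℂ) (h : ℕ → B)
    (hh : ∀ s s', h s * h s' = h s' * h s) (n : ℕ) :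
    expC t (fun s => MulOpposite.op (h s)) n = MulOpposite.op (expC t h n) := by
  induction n using Nat.strong_induction_on with
  | _ n ih =>
    cases n with
    | zero => simp [expC]
    | succ n =>
      rw [expC, expC, MulOpposite.op_smul, MulOpposite.op_smul, Finset.op_sum]
      congr 2
      refine Finset.sum_congr rfl fun s hs => ?_
      rw [ih _ (by omega), ← MulOpposite.op_mul, MulOpposite.op_smul]
      congr 2
      exact ((expC_commute t h (h (s + 1)) (fun s' => hh _ _) _).symm)

theorem hz_op {B : Type} [Ring B] (h : {s : ℤ // s ≠ 0} → B) (s : ℤ) :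
    hz (fun s => MulOpposite.op (h s)) s = MulOpposite.op (hz h s) := by
  unfold hz; split_ifs <;> simp

theorem Sys.phiG_op {B : Type} [Ring B] [Algebra ℂ B] {q : ℂ} {M N : ℕ} (S : Sys B q M N)
    (b : Bool) (i : Idx M N) (m : ℤ) :
    phiG (tq q i) (MulOpposite.op (S.k (toJ i))) (MulOpposite.op (S.ki (toJ i)))
      (fun s => MulOpposite.op (S.h i s)) b m = MulOpposite.op (S.phi b i m) := by
  unfold Sys.phi phiG pg
  have hzk : ∀ s, Commute (S.k (toJ i)) (hz (S.h i) s) := by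
    intro s; unfold hz; split_ifs with h
    · exact S.kh _ _ _
    · exact Commute.zero_right _
  have hzki : ∀ s, Commute (S.ki (toJ i)) (hz (S.h i) s) := by
    intro s; unfold hz; split_ifs with h
    · exact S.kih _ _ _
    · exact Commute.zero_right _
  simp only [hz_op]
  split_ifs
  · rw [expC_op _ _ (fun s s' => S.hz_comm i i _ _), ← MulOpposite.op_mul]
    congr 1
    exact ((expC_commute _ _ _ (fun s => hzk _) _).symm)
  · simp
  · rw [expC_op _ _ (fun s s' => S.hz_comm i i _ _), ← MulOpposite.op_mul]
    congr 1
    exact ((expC_commute _ _ _ (fun s => hzki _) _).symm)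
  · simp

open MulOpposite in
/-- the anti-involution exchanging `X⁺` and `X⁻` -/
def Sys.opp {B : Type} [Ring B] [Algebra ℂ B] {q : ℂ} {M N : ℕ} (S : Sys B q M N) :
    Sys Bᵐᵒᵖ q M N where
  hq0 := S.hq0
  hq2 := S.hq2
  xp := fun i n => op (S.xm i n)
  xm := fun i n => op (S.xp i n)
  k := fun a => op (S.k a)
  ki := fun a => op (S.ki a)
  h := fun i s => op (S.h i s)
  kki := fun a => by rw [← op_mul, S.kik, op_one]
  kik := fun a => by rw [← op_mul, S.kki, op_one]
  kk := fun a b => by rw [← op_mul, ← op_mul, S.kk]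
  kh := fun a i s => by rw [← op_mul, ← op_mul, S.kh]
  hh := fun i j s t => by rw [← op_mul, ← op_mul, S.hh]
  kxp := fun a j n => by
    rw [← op_mul, ← op_mul, S.kxm, ← op_smul, smul_smul, zpow_neg,
      mul_inv_cancel₀ (zpow_ne_zero _ S.hq0), one_smul]
  kxm := fun a j n => by
    rw [← op_mul, ← op_mul, S.kxp, ← op_smul, smul_smul, zpow_neg,
      inv_mul_cancel₀ (zpow_ne_zero _ S.hq0), one_smul]
  hxp := fun i j s n => by
    rw [← op_mul, ← op_mul, ← op_sub, ← op_smul, ← neg_sub, S.hxm, neg_neg]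
  hxm := fun i j s n => by
    rw [← op_mul, ← op_mul, ← op_sub, ← op_smul, ← neg_sub, S.hxp, op_neg]
  xx := fun i j m n => by
    rw [← op_mul, ← op_mul, ← op_smul, ← op_sub, sgn_symm, S.xx j i n m]
    by_cases h : i = j
    · subst h
      rw [if_pos rfl, if_pos rfl, op_smul, op_sub, S.phiG_op, S.phiG_op, add_comm n m]
      rfl
    · rw [if_neg h, if_neg (Ne.symm h), op_zero]

end QAS
end

section
namespace QAS
open Polynomial
open scoped TensorProduct

section submod
variable {B : Type} [Ring B] [Algebra ℂ B]

abbrev adj (G : Set B) : Submodule ℂ B := Subalgebra.toSubmodule (Algebra.adjoin ℂ G)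

theorem smulL {a b c : Submodule ℂ B} (h : a ≤ b) : a * c ≤ b * c := mul_le_mul' h le_rfl
theorem smulR {a b c : Submodule ℂ B} (h : a ≤ b) : c * a ≤ c * b := mul_le_mul' le_rfl h

theorem adj_mul_self (G : Set B) : adj G * adj G = adj G := Subalgebra.isIdempotentElem_toSubmodule _

theorem one_le_adj (G : Set B) : 1 ≤ adj G := by
  rw [Submodule.one_le]; exact Subalgebra.one_mem _

theorem one_mem_adj (G : Set B) : (1 : B) ∈ adj G := Subalgebra.one_mem (Algebra.adjoin ℂ G)

theorem gen_mem_adj {G : Set B} {g : B} (h : g ∈ G) : g ∈ adj G := Algebra.subset_adjoin h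

theorem mul_adj_le (G : Set B) (S : Submodule ℂ B)
    (h : ∀ g ∈ G, ∀ s ∈ S, s * g ∈ adj G * S) : S * adj G ≤ adj G * S := by
  have key : ∀ b ∈ Algebra.adjoin ℂ G, ∀ s ∈ S, s * b ∈ adj G * S := by
    intro b hb
    induction hb using Algebra.adjoin_induction with
    | mem x hx => exact fun s hs => h x hx s hs
    | algebraMap r =>
      intro s hs
      rw [← Algebra.commutes]
      exact Submodule.mul_mem_mul (Subalgebra.algebraMap_mem (Algebra.adjoin ℂ G) r) hs
    | add x y _ _ hx hy => intro s hs; rw [mul_add]; exact add_mem (hx s hs) (hy s hs)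
    | mul x y _ _ hx hy =>
      intro s hs
      rw [← mul_assoc]
      have h1 := hx s hs
      generalize s * x = z at h1
      induction h1 using Submodule.mul_induction_on' with
      | mem_mul_mem b hb s' hs' =>
        rw [mul_assoc]
        have h2 := Submodule.mul_mem_mul hb (hy s' hs')
        rwa [← mul_assoc (adj G), adj_mul_self] at h2
      | add u _ v _ hu hv => rw [add_mul]; exact add_mem hu hv
  rw [Submodule.mul_le]
  exact fun s hs b hb => key b hb s hs

theorem adj_mul_le (G : Set B) (S : Submodule ℂ B)
    (h : ∀ g ∈ G, ∀ s ∈ S, g * s ∈ S * adj G) : adj G * S ≤ S * adj G := by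
  have key : ∀ b ∈ Algebra.adjoin ℂ G, ∀ s ∈ S, b * s ∈ S * adj G := by
    intro b hb
    induction hb using Algebra.adjoin_induction with
    | mem x hx => exact fun s hs => h x hx s hs
    | algebraMap r =>
      intro s hs
      rw [Algebra.commutes]
      exact Submodule.mul_mem_mul hs (Subalgebra.algebraMap_mem (Algebra.adjoin ℂ G) r)
    | add x y _ _ hx hy => intro s hs; rw [add_mul]; exact add_mem (hx s hs) (hy s hs)
    | mul x y _ _ hx hy =>
      intro s hs
      rw [mul_assoc]
      have h1 := hy s hs
      generalize y * s = z at h1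
      induction h1 using Submodule.mul_induction_on' with
      | mem_mul_mem s' hs' b hb =>
        rw [← mul_assoc]
        have h2 := Submodule.mul_mem_mul (hx s' hs') hb
        rwa [mul_assoc, adj_mul_self] at h2
      | add u _ v _ hu hv => rw [mul_add]; exact add_mem hu hv
  rw [Submodule.mul_le]
  exact fun b hb s hs => key b hb s hs

theorem mul_adj_span_le (G R : Set B)
    (h : ∀ g ∈ G, ∀ s ∈ R, s * g ∈ adj G * Submodule.span ℂ R) :
    Submodule.span ℂ R * adj G ≤ adj G * Submodule.span ℂ R := by
  apply mul_adj_le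
  intro g hg s hs
  induction hs using Submodule.span_induction with
  | mem x hx => exact h g hg x hx
  | zero => simp
  | add x y _ _ hx hy => rw [add_mul]; exact add_mem hx hy
  | smul a x _ hx => rw [smul_mul_assoc]; exact Submodule.smul_mem _ _ hx

theorem adj_mul_span_le (G R : Set B)
    (h : ∀ g ∈ G, ∀ s ∈ R, g * s ∈ Submodule.span ℂ R * adj G) :
    adj G * Submodule.span ℂ R ≤ Submodule.span ℂ R * adj G := by
  apply adj_mul_le
  intro g hg s hs
  induction hs using Submodule.span_induction with
  | mem x hx => exact h g hg x hx
  | zero => simp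
  | add x y _ _ hx hy => rw [mul_add]; exact add_mem hx hy
  | smul a x _ hx => rw [mul_smul_comm]; exact Submodule.smul_mem _ _ hx

end submod

namespace Sys
variable {B : Type} [Ring B] [Algebra ℂ B] {q : ℂ} {M N : ℕ} (S : Sys B q M N)

def gp : Set B := {x | ∃ i n, x = S.xp i n}
def gm : Set B := {x | ∃ i n, x = S.xm i n}
def g0 : Set B := {x | (∃ a, x = S.k a) ∨ (∃ a, x = S.ki a) ∨ ∃ i s, x = S.h i s}

abbrev Am := adj S.gm
abbrev Ap := adj S.gp
abbrev A0 := adj S.g0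

/-- a set of elements stable (up to scalars and span) under commutation with `U⁰` -/
structure Stab (R : Set B) : Prop where
  h : ∀ r ∈ R, ∀ i s, S.h i s * r - r * S.h i s ∈ Submodule.span ℂ R
  k : ∀ r ∈ R, ∀ a, ∃ c : ℂ, c ≠ 0 ∧ S.k a * r = c • (r * S.k a)

theorem k_mem (a) : S.k a ∈ S.A0 := gen_mem_adj (Or.inl ⟨a, rfl⟩)
theorem ki_mem (a) : S.ki a ∈ S.A0 := gen_mem_adj (Or.inr (Or.inl ⟨a, rfl⟩))
theorem h_mem (i s) : S.h i s ∈ S.A0 := gen_mem_adj (Or.inr (Or.inr ⟨i, s, rfl⟩))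

variable {S} in
theorem Stab.right {R : Set B} (hR : S.Stab R) :
    Submodule.span ℂ R * S.A0 ≤ S.A0 * Submodule.span ℂ R := by
  apply mul_adj_span_le
  rintro g (⟨a, rfl⟩ | ⟨a, rfl⟩ | ⟨i, s, rfl⟩) r hr
  · obtain ⟨c, hc, h⟩ := hR.k r hr a
    have : r * S.k a = c⁻¹ • (S.k a * r) := by rw [h, smul_smul, inv_mul_cancel₀ hc, one_smul]
    rw [this]
    exact Submodule.smul_mem _ _ (Submodule.mul_mem_mul (S.k_mem a) (Submodule.subset_span hr))
  · obtain ⟨c, hc, h⟩ := hR.k r hr a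
    have : r * S.ki a = c • (S.ki a * r) := by
      rw [S.ki_x hc h, smul_smul, mul_inv_cancel₀ hc, one_smul]
    rw [this]
    exact Submodule.smul_mem _ _ (Submodule.mul_mem_mul (S.ki_mem a) (Submodule.subset_span hr))
  · have : r * S.h i s = S.h i s * r - 1 * (S.h i s * r - r * S.h i s) := by
      rw [one_mul]; abel
    rw [this]
    exact sub_mem (Submodule.mul_mem_mul (S.h_mem i s) (Submodule.subset_span hr))
      (Submodule.mul_mem_mul (one_mem_adj _) (hR.h r hr i s))

variable {S} in
theorem Stab.left {R : Set B} (hR : S.Stab R) :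
    S.A0 * Submodule.span ℂ R ≤ Submodule.span ℂ R * S.A0 := by
  apply adj_mul_span_le
  rintro g (⟨a, rfl⟩ | ⟨a, rfl⟩ | ⟨i, s, rfl⟩) r hr
  · obtain ⟨c, hc, h⟩ := hR.k r hr a
    rw [h]
    exact Submodule.smul_mem _ _ (Submodule.mul_mem_mul (Submodule.subset_span hr) (S.k_mem a))
  · obtain ⟨c, hc, h⟩ := hR.k r hr a
    rw [S.ki_x hc h]
    exact Submodule.smul_mem _ _ (Submodule.mul_mem_mul (Submodule.subset_span hr) (S.ki_mem a))
  · have : S.h i s * r = r * S.h i s + (S.h i s * r - r * S.h i s) * 1 := by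
      rw [mul_one]; abel
    rw [this]
    exact add_mem (Submodule.mul_mem_mul (Submodule.subset_span hr) (S.h_mem i s))
      (Submodule.mul_mem_mul (hR.h r hr i s) (one_mem_adj _))

theorem stab_gp : S.Stab S.gp where
  h := by
    rintro r ⟨j, n, rfl⟩ i s
    rw [S.hxp]
    exact Submodule.smul_mem _ _ (Submodule.subset_span ⟨_, _, rfl⟩)
  k := by
    rintro r ⟨j, n, rfl⟩ a
    exact ⟨_, zpow_ne_zero _ S.hq0, S.kxp a j n⟩

theorem stab_gm : S.Stab S.gm where
  h := by
    rintro r ⟨j, n, rfl⟩ i s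
    rw [S.hxm]
    exact neg_mem (Submodule.smul_mem _ _ (Submodule.subset_span ⟨_, _, rfl⟩))
  k := by
    rintro r ⟨j, n, rfl⟩ a
    exact ⟨_, zpow_ne_zero _ S.hq0, S.kxm a j n⟩

theorem span_gp_le : Submodule.span ℂ S.gp ≤ S.Ap := Submodule.span_le.2 Algebra.subset_adjoin
theorem span_gm_le : Submodule.span ℂ S.gm ≤ S.Am := Submodule.span_le.2 Algebra.subset_adjoin

theorem A0_Am : S.A0 * S.Am ≤ S.Am * S.A0 := by
  apply mul_adj_le
  rintro g hg s hs
  exact smulL S.span_gm_le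
    (S.stab_gm.left (Submodule.mul_mem_mul hs (Submodule.subset_span hg)))

theorem Ap_A0 : S.Ap * S.A0 ≤ S.A0 * S.Ap := by
  apply adj_mul_le
  rintro g hg s hs
  exact smulR S.span_gp_le
    (S.stab_gp.right (Submodule.mul_mem_mul (Submodule.subset_span hg) hs))

theorem expC_mem {C : Subalgebra ℂ B} (t : ℂ) (h : ℕ → B) (hh : ∀ s, h s ∈ C) (n : ℕ) :
    expC t h n ∈ C := by
  induction n using Nat.strong_induction_on with
  | _ n ih =>
    cases n with
    | zero => simp [expC]
    | succ n =>
      rw [expC]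
      refine C.smul_mem (C.smul_mem (C.sum_mem fun s hs => C.smul_mem (C.mul_mem (hh _) ?_) _) _) _
      exact ih _ (by omega)

theorem phi_mem (b i m) : S.phi b i m ∈ S.A0 := by
  have hz' : ∀ s, hz (S.h i) s ∈ Algebra.adjoin ℂ S.g0 := by
    intro s; unfold hz; split_ifs with h
    · exact S.h_mem _ _
    · exact zero_mem _
  unfold phi phiG pg
  change _ ∈ Algebra.adjoin ℂ S.g0
  split_ifs
  · exact mul_mem (S.k_mem _) (expC_mem _ _ (fun s => hz' _) _)
  · exact zero_mem _
  · exact mul_mem (S.ki_mem _) (expC_mem _ _ (fun s => hz' _) _)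
  · exact zero_mem _

theorem AV_Am : (S.A0 ⊔ Submodule.span ℂ S.gp) * S.Am ≤
    S.Am * (S.A0 ⊔ Submodule.span ℂ S.gp) := by
  apply mul_adj_le
  rintro g ⟨j, n, rfl⟩ s hs
  have hj : S.xm j n ∈ S.Am := gen_mem_adj ⟨j, n, rfl⟩
  rw [Submodule.mem_sup] at hs
  obtain ⟨a, ha, v, hv, rfl⟩ := hs
  rw [add_mul]
  refine add_mem ?_ ?_
  · exact smulR le_sup_left (S.A0_Am (Submodule.mul_mem_mul ha hj))
  · induction hv using Submodule.span_induction with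
    | mem x hx =>
      obtain ⟨i, m, rfl⟩ := hx
      have h := S.xx i j m n
      rw [sub_eq_iff_eq_add] at h
      rw [h]
      refine add_mem ?_ ?_
      · rw [← one_mul (ite _ _ _)]
        refine Submodule.mul_mem_mul (one_mem_adj _) (Submodule.mem_sup_left ?_)
        split_ifs
        · exact Submodule.smul_mem _ _ (sub_mem (S.phi_mem true i _) (S.phi_mem false i _))
        · exact zero_mem _
      · exact Submodule.smul_mem _ _ (Submodule.mul_mem_mul hj
          (Submodule.mem_sup_right (Submodule.subset_span ⟨i, m, rfl⟩)))
    | zero => simp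
    | add x y _ _ hx hy => rw [add_mul]; exact add_mem hx hy
    | smul c x _ hx => rw [smul_mul_assoc]; exact Submodule.smul_mem _ _ hx

def Gener : Prop := Algebra.adjoin ℂ (S.gm ∪ S.g0 ∪ S.gp) = ⊤

theorem tri_top (hS : S.Gener) : S.Am * S.A0 * S.Ap = ⊤ := by
  set T := S.Am * S.A0 * S.Ap with hT
  have hm : S.Am * T ≤ T := by
    rw [hT, ← mul_assoc, ← mul_assoc, adj_mul_self]
  have h0 : S.A0 * T ≤ T := by
    calc S.A0 * T = (S.A0 * S.Am) * S.A0 * S.Ap := by simp only [hT, mul_assoc]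
      _ ≤ (S.Am * S.A0) * S.A0 * S.Ap := by
        exact smulL (smulL S.A0_Am)
      _ = T := by rw [mul_assoc S.Am, adj_mul_self]
  have hp : (S.A0 ⊔ Submodule.span ℂ S.gp) * T ≤ T := by
    calc _ = ((S.A0 ⊔ Submodule.span ℂ S.gp) * S.Am) * S.A0 * S.Ap := by
            simp only [hT, mul_assoc]
      _ ≤ (S.Am * (S.A0 ⊔ Submodule.span ℂ S.gp)) * S.A0 * S.Ap := 
        smulL (smulL S.AV_Am)
      _ = S.Am * ((S.A0 * S.A0 ⊔ Submodule.span ℂ S.gp * S.A0) * S.Ap) := by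
        rw [mul_assoc S.Am, Submodule.sup_mul, mul_assoc]
      _ ≤ S.Am * ((S.A0 ⊔ S.A0 * Submodule.span ℂ S.gp) * S.Ap) := by
        refine smulR (smulL ?_)
        rw [adj_mul_self]
        exact sup_le_sup le_rfl S.stab_gp.right
      _ ≤ S.Am * ((S.A0 * S.Ap) * S.Ap) := by
        refine smulR (smulL (sup_le ?_ ?_))
        · calc S.A0 = S.A0 * 1 := (mul_one _).symm
            _ ≤ _ := smulR (one_le_adj _)
        · exact smulR S.span_gp_le
      _ = T := by rw [mul_assoc S.A0, adj_mul_self, ← mul_assoc]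
  have h1 : (1 : B) ∈ T := by
    have := Submodule.mul_mem_mul (Submodule.mul_mem_mul (one_mem_adj S.gm) (one_mem_adj S.g0))
      (one_mem_adj S.gp)
    simpa using this
  have key : ∀ b ∈ Algebra.adjoin ℂ (S.gm ∪ S.g0 ∪ S.gp), ∀ t ∈ T, b * t ∈ T := by
    intro b hb
    induction hb using Algebra.adjoin_induction with
    | mem x hx =>
      intro t ht
      rcases hx with (hx | hx) | hx
      · exact hm (Submodule.mul_mem_mul (gen_mem_adj hx) ht)
      · exact h0 (Submodule.mul_mem_mul (gen_mem_adj hx) ht)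
      · exact hp (Submodule.mul_mem_mul (Submodule.mem_sup_right (Submodule.subset_span hx)) ht)
    | algebraMap r => intro t ht; rw [← Algebra.smul_def]; exact T.smul_mem _ ht
    | add x y _ _ hx hy => intro t ht; rw [add_mul]; exact add_mem (hx t ht) (hy t ht)
    | mul x y _ _ hx hy => intro t ht; rw [mul_assoc]; exact hx _ (hy t ht)
  rw [eq_top_iff]
  intro b _
  have hb : b ∈ Algebra.adjoin ℂ (S.gm ∪ S.g0 ∪ S.gp) := by rw [hS]; trivial
  simpa using key b hb 1 h1

theorem ideal_plus (hS : S.Gener) {R : Set B} (h0 : S.Stab R)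
    (hm : ∀ r ∈ R, ∀ j n, ∃ c : ℂ, r * S.xm j n = c • (S.xm j n * r)) :
    ⊤ * Submodule.span ℂ R * ⊤ ≤ S.Am * S.A0 * (S.Ap * Submodule.span ℂ R * S.Ap) := by
  have h1 : Submodule.span ℂ R * S.Am ≤ S.Am * Submodule.span ℂ R := by
    apply mul_adj_span_le
    rintro g ⟨j, n, rfl⟩ r hr
    obtain ⟨c, hc⟩ := hm r hr j n
    rw [hc]
    exact Submodule.smul_mem _ _
      (Submodule.mul_mem_mul (gen_mem_adj ⟨j, n, rfl⟩) (Submodule.subset_span hr))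
  set X := Submodule.span ℂ R
  calc ⊤ * X * ⊤ = ⊤ * ((X * S.Am) * S.A0 * S.Ap) := by
        rw [mul_assoc ⊤, mul_assoc X, mul_assoc X, S.tri_top hS]
    _ ≤ ⊤ * ((S.Am * X) * S.A0 * S.Ap) :=
      smulR (smulL (smulL h1))
    _ = ⊤ * (S.Am * (X * S.A0) * S.Ap) := by simp only [mul_assoc]
    _ ≤ ⊤ * (S.Am * (S.A0 * X) * S.Ap) :=
      smulR (smulL (smulR h0.right))
    _ = (⊤ * S.Am * S.A0) * (X * S.Ap) := by simp only [mul_assoc]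
    _ ≤ ⊤ * (X * S.Ap) := smulL le_top
    _ = _ := by rw [← S.tri_top hS]; simp only [mul_assoc]

theorem ideal_minus (hS : S.Gener) {R : Set B} (h0 : S.Stab R)
    (hm : ∀ r ∈ R, ∀ j n, ∃ c : ℂ, S.xp j n * r = c • (r * S.xp j n)) :
    ⊤ * Submodule.span ℂ R * ⊤ ≤ (S.Am * Submodule.span ℂ R * S.Am) * S.A0 * S.Ap := by
  have h1 : S.Ap * Submodule.span ℂ R ≤ Submodule.span ℂ R * S.Ap := by
    apply adj_mul_span_le
    rintro g ⟨j, n, rfl⟩ r hr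
    obtain ⟨c, hc⟩ := hm r hr j n
    rw [hc]
    exact Submodule.smul_mem _ _
      (Submodule.mul_mem_mul (Submodule.subset_span hr) (gen_mem_adj ⟨j, n, rfl⟩))
  set X := Submodule.span ℂ R
  calc ⊤ * X * ⊤ = (S.Am * S.A0 * (S.Ap * X)) * ⊤ := by
        rw [← mul_assoc _ S.Ap, S.tri_top hS]
    _ ≤ (S.Am * S.A0 * (X * S.Ap)) * ⊤ :=
      smulL (smulR h1)
    _ = (S.Am * (S.A0 * X) * S.Ap) * ⊤ := by simp only [mul_assoc]
    _ ≤ (S.Am * (X * S.A0) * S.Ap) * ⊤ :=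
      smulL (smulL (smulR h0.left))
    _ = (S.Am * X) * (S.A0 * S.Ap * ⊤) := by simp only [mul_assoc]
    _ ≤ (S.Am * X) * ⊤ := smulR le_top
    _ = _ := by rw [← S.tri_top hS]; simp only [mul_assoc]

end Sys
end QAS
end

section
namespace QAS
open Polynomial
open scoped TensorProduct

/-- commutator as a linear map -/
def adl {B : Type} [Ring B] [Algebra ℂ B] (h : B) : B →ₗ[ℂ] B :=
  LinearMap.mulLeft ℂ h - LinearMap.mulRight ℂ h

theorem adl_apply {B : Type} [Ring B] [Algebra ℂ B] (h x : B) : adl h x = h * x - x * h := rfl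

theorem adl_mul {B : Type} [Ring B] [Algebra ℂ B] (h x y : B) :
    adl h (x * y) = adl h x * y + x * adl h y := by
  simp only [adl_apply, mul_sub, sub_mul, mul_assoc]; abel

/-- weight vectors for conjugation -/
def WtV {B : Type} [Ring B] [Algebra ℂ B] (k : B) (c : ℂ) (x : B) : Prop :=
  k * x = c • (x * k)

theorem WtV.mul {B : Type} [Ring B] [Algebra ℂ B] {k : B} {c d : ℂ} {x y : B}
    (hx : WtV k c x) (hy : WtV k d y) : WtV k (c * d) (x * y) := by
  unfold WtV at *
  rw [← mul_assoc, hx, smul_mul_assoc, mul_assoc, hy, mul_smul_comm, smul_smul, mul_assoc]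

theorem WtV.add {B : Type} [Ring B] [Algebra ℂ B] {k : B} {c d : ℂ} {x y : B}
    (hx : WtV k c x) (hy : WtV k d y) (e : d = c) : WtV k c (x + y) := by
  unfold WtV at *
  rw [mul_add, hx, hy, add_mul, smul_add, e]

theorem WtV.sub {B : Type} [Ring B] [Algebra ℂ B] {k : B} {c d : ℂ} {x y : B}
    (hx : WtV k c x) (hy : WtV k d y) (e : d = c) : WtV k c (x - y) := by
  unfold WtV at *
  rw [mul_sub, hx, hy, sub_mul, smul_sub, e]

theorem WtV.smul {B : Type} [Ring B] [Algebra ℂ B] {k : B} {c : ℂ} {x : B}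
    (hx : WtV k c x) (r : ℂ) : WtV k c (r • x) := by
  unfold WtV at *
  rw [mul_smul_comm, hx, smul_mul_assoc, smul_comm]

namespace Sys
variable {B : Type} [Ring B] [Algebra ℂ B] {q : ℂ} {M N : ℕ} (S : Sys B q M N)

/-- the quadratic relation elements -/
inductive RR2 : B → Prop
  | e4 (i j m n) (h : cc M i.1 j.1 = 0) : RR2 (S.half.el4 i j m n)
  | e5 (i j m n) (h : cc M i.1 j.1 ≠ 0) : RR2 (S.half.el5 i j m n)

/-- the Serre and oscillation elements -/
inductive RR3 : B → Prop
  | eS (i j m n k) (hi : i.1 ≠ M) (h : cc M i.1 j.1 = 1 ∨ cc M i.1 j.1 = -1) :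
      RR3 (S.half.elS i j m n k)
  | eO (a b c) (ha : a.1 + 1 = M) (hb : b.1 = M) (hc : c.1 = M + 1) (m n k u) :
      RR3 (S.half.elO a b c m n k u)

theorem nodes (a b c : Idx M N) (ha : a.1 + 1 = M) (hb : b.1 = M) (hc : c.1 = M + 1) :
    Nodes M N a b c where
  hb := hb
  hac := by unfold cc form4 innerE; rw [hc]; simp; split_ifs <;> omega
  hab := by
    right
    have hb' : b.1 = a.1 + 1 := by omega
    rw [hb', cc_succ, ha]; simp [lof]
  hbc := by
    have hb' : b.1 = a.1 + 1 := by omega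
    have h1 : cc M a.1 b.1 = -1 := by rw [hb', cc_succ, ha]; simp [lof]
    rw [h1, hb, hc, cc_succ]; simp [lof]

def R2 : Set B := {r | S.RR2 r}
def R3 : Set B := {r | S.RR3 r}

theorem adl_xp (i s) (j n) : adl (S.h i s) (S.xp j n) = coh q i j s.1 • S.xp j (n + s.1) :=
  S.hxp i j s n

theorem wtv_xp (a) (j n) : WtV (S.k a) (q ^ wt a j) (S.xp j n) := S.kxp a j n

theorem stab_R2 : S.Stab S.R2 where
  h := by
    rintro r (⟨i, j, m, n, h⟩ | ⟨i, j, m, n, h⟩) i' s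
    · have : S.h i' s * S.half.el4 i j m n - S.half.el4 i j m n * S.h i' s =
        coh q i' i s.1 • S.half.el4 i j (m + s.1) n + coh q i' j s.1 • S.half.el4 i j m (n + s.1) := by
        rw [← adl_apply]
        simp only [Half.el4, half, map_sub, map_smul, adl_mul, adl_xp, smul_mul_assoc,
          mul_smul_comm]
        module
      rw [this]
      exact add_mem (Submodule.smul_mem _ _ (Submodule.subset_span (.e4 _ _ _ _ h)))
        (Submodule.smul_mem _ _ (Submodule.subset_span (.e4 _ _ _ _ h)))
    · have : S.h i' s * S.half.el5 i j m n - S.half.el5 i j m n * S.h i' s =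
        coh q i' i s.1 • S.half.el5 i j (m + s.1) n + coh q i' j s.1 • S.half.el5 i j m (n + s.1) := by
        rw [← adl_apply]
        simp only [Half.el5, half, map_sub, map_smul, adl_mul, adl_xp, smul_mul_assoc,
          mul_smul_comm, add_right_comm _ (1 : ℤ) s.1]
        module
      rw [this]
      exact add_mem (Submodule.smul_mem _ _ (Submodule.subset_span (.e5 _ _ _ _ h)))
        (Submodule.smul_mem _ _ (Submodule.subset_span (.e5 _ _ _ _ h)))
  k := by
    have h0 : ∀ n : ℤ, q ^ n ≠ 0 := fun n => zpow_ne_zero _ S.hq0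
    rintro r (⟨i, j, m, n, h⟩ | ⟨i, j, m, n, h⟩) a
    · refine ⟨q ^ wt a i * q ^ wt a j, mul_ne_zero (h0 _) (h0 _), ?_⟩
      have x := S.wtv_xp a i
      have y := S.wtv_xp a j
      exact ((x _).mul (y _)).sub (((y _).mul (x _)).smul _) (mul_comm _ _)
    · refine ⟨q ^ wt a i * q ^ wt a j, mul_ne_zero (h0 _) (h0 _), ?_⟩
      have x := S.wtv_xp a i
      have y := S.wtv_xp a j
      exact (((x _).mul (y _)).sub (((y _).mul (x _)).smul _) (mul_comm _ _)).sub
        ((((x _).mul (y _)).smul _).sub ((y _).mul (x _)) (mul_comm _ _)) rfl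

theorem R2_xm : ∀ r ∈ S.R2, ∀ j n, ∃ c : ℂ, r * S.xm j n = c • (S.xm j n * r) := by
  rintro r (⟨i, j, m, n, h⟩ | ⟨i, j, m, n, h⟩) i' s
  · exact S.half.el4_y i j h m n i' s
  · exact S.half.el5_y i j h m n i' s

theorem wtv_osc1 {k : B} {t α β γ : ℂ} {a b c d : B} (ha : WtV k α a) (hb : WtV k β b)
    (hc : WtV k γ c) (hd : WtV k β d) : WtV k (α * β * γ * β) (osc1 t a b c d) :=
  ((((((ha.mul hb).mul hc).mul hd).add (((hc.mul hb).mul ha).mul hd) (by ring)).add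
    (((hb.mul ha).mul hd).mul hc) (by ring)).add (((hb.mul hc).mul hd).mul ha) (by ring)).sub
    ((((hb.mul ha).mul hc).mul hd).smul t) (by ring)

theorem wtv_polyJ {k : B} {t α β : ℂ} {F X W : B} (hF : WtV k α F) (hX : WtV k β X)
    (hW : WtV k β W) : WtV k (β * β * α) (polyJ t F X W) :=
  ((((((hX.mul hW).mul hF).add ((hW.mul hX).mul hF) rfl).sub
    ((((hX.mul hF).mul hW).add ((hW.mul hF).mul hX) rfl).smul t) (by ring)).add
    ((hF.mul hW).mul hX) (by ring)).add ((hF.mul hX).mul hW) (by ring))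

theorem adl_osc1 (h : B) (t : ℂ) (a b c d : B) : adl h (osc1 t a b c d) =
    osc1 t (adl h a) b c d + osc1 t a (adl h b) c d + osc1 t a b (adl h c) d
      + osc1 t a b c (adl h d) := by
  simp only [osc1, map_add, map_sub, map_smul, adl_mul, add_mul]
  module

theorem adl_polyJ (h : B) (t : ℂ) (a b c : B) : adl h (polyJ t a b c) =
    polyJ t (adl h a) b c + polyJ t a (adl h b) c + polyJ t a b (adl h c) := by
  simp only [polyJ, map_add, map_sub, map_smul, adl_mul, add_mul]
  module

theorem stab_R3 : S.Stab S.R3 where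
  h := by
    rintro r (⟨i, j, m, n, k, hi, h⟩ | ⟨a, b, c, ha, hb, hc, m, n, k, u⟩) i' s
    · have : S.h i' s * S.half.elS i j m n k - S.half.elS i j m n k * S.h i' s =
        coh q i' i s.1 • S.half.elS i j (m + s.1) n k + coh q i' i s.1 • S.half.elS i j m (n + s.1) k
          + coh q i' j s.1 • S.half.elS i j m n (k + s.1) := by
        rw [← adl_apply]
        simp only [Half.elS, half, adl_polyJ, adl_xp]
        simp only [polyJ, smul_mul_assoc, mul_smul_comm]
        module
      rw [this]
      exact add_mem (add_mem
        (Submodule.smul_mem _ _ (Submodule.subset_span (.eS _ _ _ _ _ hi h)))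
        (Submodule.smul_mem _ _ (Submodule.subset_span (.eS _ _ _ _ _ hi h))))
        (Submodule.smul_mem _ _ (Submodule.subset_span (.eS _ _ _ _ _ hi h)))
    · have : S.h i' s * S.half.elO a b c m n k u - S.half.elO a b c m n k u * S.h i' s =
        coh q i' a s.1 • S.half.elO a b c (m + s.1) n k u
          + coh q i' b s.1 • S.half.elO a b c m (n + s.1) k u
          + coh q i' c s.1 • S.half.elO a b c m n (k + s.1) u
          + coh q i' b s.1 • S.half.elO a b c m n k (u + s.1) := by
        rw [← adl_apply]
        simp only [Half.elO, half, map_add, adl_osc1, adl_xp]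
        simp only [osc1, smul_mul_assoc, mul_smul_comm]
        module
      rw [this]
      exact add_mem (add_mem (add_mem
        (Submodule.smul_mem _ _ (Submodule.subset_span (.eO _ _ _ ha hb hc _ _ _ _)))
        (Submodule.smul_mem _ _ (Submodule.subset_span (.eO _ _ _ ha hb hc _ _ _ _))))
        (Submodule.smul_mem _ _ (Submodule.subset_span (.eO _ _ _ ha hb hc _ _ _ _))))
        (Submodule.smul_mem _ _ (Submodule.subset_span (.eO _ _ _ ha hb hc _ _ _ _)))
  k := by
    have h0 : ∀ n : ℤ, q ^ n ≠ 0 := fun n => zpow_ne_zero _ S.hq0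
    rintro r (⟨i, j, m, n, k, hi, h⟩ | ⟨a, b, c, ha, hb, hc, m, n, k, u⟩) z
    · exact ⟨_, mul_ne_zero (mul_ne_zero (h0 _) (h0 _)) (h0 _),
        wtv_polyJ (S.wtv_xp z j _) (S.wtv_xp z i _) (S.wtv_xp z i _)⟩
    · exact ⟨_, mul_ne_zero (mul_ne_zero (mul_ne_zero (h0 _) (h0 _)) (h0 _)) (h0 _),
        (wtv_osc1 (S.wtv_xp z a _) (S.wtv_xp z b _) (S.wtv_xp z c _) (S.wtv_xp z b _)).add
        (wtv_osc1 (S.wtv_xp z a _) (S.wtv_xp z b _) (S.wtv_xp z c _) (S.wtv_xp z b _)) rfl⟩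

theorem R3_xm (h4 : S.half.R4) (h5 : S.half.R5) :
    ∀ r ∈ S.R3, ∀ j n, ∃ c : ℂ, r * S.xm j n = c • (S.xm j n * r) := by
  rintro r (⟨i, j, m, n, k, hi, h⟩ | ⟨a, b, c, ha, hb, hc, m, n, k, u⟩) i' s
  · exact S.half.elS_y h5 i j hi h m n k i' s
  · exact S.half.elO_y h4 h5 (nodes a b c ha hb hc) m n k u i' s

end Sys
end QAS
end

section
namespace QAS
open Polynomial
open scoped TensorProduct

theorem mkA_rel (q : ℂ) (M N l : ℕ) {x y : FA M N true} (h : rel q M N true l x y) :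
    mkA q M N true l x = mkA q M N true l y := RingQuot.mkAlgHom_rel ℂ h

theorem KF_idx {M N : ℕ} (i : Idx M N) : KF M N true i.1 = gi (Gen.K i) := by
  simp [KF, i.2]
theorem KiF_idx {M N : ℕ} (i : Idx M N) : KiF M N true i.1 = gi (Gen.Ki i) := by
  simp [KiF, i.2]
theorem XpF_idx {M N : ℕ} (i : Idx M N) (n : ℤ) : XpF M N true i.1 n = gi (Gen.Xp i n) := by
  simp [XpF, i.2]
theorem XmF_idx {M N : ℕ} (i : Idx M N) (n : ℤ) : XmF M N true i.1 n = gi (Gen.Xm i n) := by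
  simp [XmF, i.2]
theorem HF_idx {M N : ℕ} (i : Idx M N) (s : ℤ) :
    HF M N true i.1 s = hz (fun s => gi (Gen.H i s)) s := by
  unfold HF hz
  by_cases h : s ≠ 0
  · rw [dif_pos ⟨i.2, h⟩, dif_pos h]
  · rw [dif_neg (by tauto), dif_neg h]

theorem phiPF_idx (q : ℂ) {M N : ℕ} (i : Idx M N) (n : ℤ) : phiPF q M N true i.1 n =
    phiG (tq q i) (gi (Gen.K i)) (gi (Gen.Ki i)) (fun s => gi (Gen.H i s)) true n := by
  simp only [phiPF, phiG, pg, KF_idx, HF_idx, tq, if_true]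

theorem phiMF_idx (q : ℂ) {M N : ℕ} (i : Idx M N) (n : ℤ) : phiMF q M N true i.1 n =
    phiG (tq q i) (gi (Gen.K i)) (gi (Gen.Ki i)) (fun s => gi (Gen.H i s)) false n := by
  simp only [phiMF, phiG, pg, KiF_idx, HF_idx, tq, Bool.false_eq_true, if_false]
  by_cases h : n ≤ 0
  · rw [if_pos h, if_pos (by omega)]
  · rw [if_neg h, if_neg (by omega)]

def kGen {M N : ℕ} (a : JJ M N) : Gen M N true :=
  if h : a.1 = 0 then Gen.K0 rfl else Gen.K ⟨a.1, by omega, a.2⟩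
def kiGen {M N : ℕ} (a : JJ M N) : Gen M N true :=
  if h : a.1 = 0 then Gen.K0i rfl else Gen.Ki ⟨a.1, by omega, a.2⟩

theorem kGen_toJ {M N : ℕ} (i : Idx M N) : kGen (toJ i) = Gen.K i := by
  have : i.1 ≠ 0 := by have := i.2.1; omega
  simp [kGen, toJ, this]
theorem kiGen_toJ {M N : ℕ} (i : Idx M N) : kiGen (toJ i) = Gen.Ki i := by
  have : i.1 ≠ 0 := by have := i.2.1; omega
  simp [kiGen, toJ, this]

/-- the tautological system in the presented algebra -/
def SysA (q : ℂ) (h0 : q ≠ 0) (h2 : q ^ 2 ≠ 1) (M N l : ℕ) : Sys (ALG q M N true l) q M N where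
  hq0 := h0
  hq2 := h2
  xp := fun i n => mkA q M N true l (gi (Gen.Xp i n))
  xm := fun i n => mkA q M N true l (gi (Gen.Xm i n))
  k := fun a => mkA q M N true l (gi (kGen a))
  ki := fun a => mkA q M N true l (gi (kiGen a))
  h := fun i s => mkA q M N true l (gi (Gen.H i s))
  kki := fun a => by
    rw [← map_mul, ← map_one (mkA q M N true l)]
    apply mkA_rel
    unfold kGen kiGen; split_ifs
    · exact .K0K0i rfl
    · exact .KKi _
  kik := fun a => by
    rw [← map_mul, ← map_one (mkA q M N true l)]
    apply mkA_rel
    unfold kGen kiGen; split_ifs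
    · exact .K0iK0 rfl
    · exact .KiK _
  kk := fun a b => by
    rw [← map_mul, ← map_mul]
    unfold kGen; split_ifs
    · rfl
    · exact mkA_rel _ _ _ _ (.K0K rfl _)
    · exact (mkA_rel _ _ _ _ (.K0K rfl _)).symm
    · exact mkA_rel _ _ _ _ (.KK _ _)
  kh := fun a i s => by
    rw [← map_mul, ← map_mul]
    apply mkA_rel
    unfold kGen; split_ifs
    · exact .K0H rfl _ _
    · exact .KH _ _ _
  hh := fun i j s t => by
    rw [← map_mul, ← map_mul]
    exact mkA_rel _ _ _ _ (.HH _ _ _ _)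
  kxp := fun a j n => by
    rw [← map_mul, ← map_mul, ← map_smul]
    apply mkA_rel
    unfold kGen wt; split_ifs with h h'
    · have := rel.K0Xp (q := q) (lvl := l) rfl j n; rwa [if_pos h'] at this
    · have := rel.K0Xp (q := q) (lvl := l) rfl j n; rwa [if_neg h'] at this
    · exact rel.KXp ⟨a.1, by omega, a.2⟩ j n
  kxm := fun a j n => by
    rw [← map_mul, ← map_mul, ← map_smul]
    apply mkA_rel
    unfold kGen wt; split_ifs with h h'
    · have := rel.K0Xm (q := q) (lvl := l) rfl j n; rwa [if_pos h'] at this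
    · have := rel.K0Xm (q := q) (lvl := l) rfl j n; rwa [if_neg h'] at this
    · exact rel.KXm ⟨a.1, by omega, a.2⟩ j n
  hxp := fun i j s n => by
    rw [← map_mul, ← map_mul, ← map_sub, ← map_smul]
    exact mkA_rel _ _ _ _ (.HXp _ _ _ _)
  hxm := fun i j s n => by
    rw [← map_mul, ← map_mul, ← map_sub, ← map_smul, ← map_neg]
    exact mkA_rel _ _ _ _ (.HXm _ _ _ _)
  xx := fun i j m n => by
    rw [← map_mul, ← map_mul, ← map_smul, ← map_sub, mkA_rel _ _ _ _ (.XpXm i j m n)]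
    split_ifs
    · rw [map_smul, map_sub, phiPF_idx, phiMF_idx, map_phiG, map_phiG, kGen_toJ, kiGen_toJ]
      rfl
    · simp

/-- linear extension by zero of a family -/
def SX {B : Type} [Ring B] {M N : ℕ} (x : Idx M N → ℤ → B) (i : ℕ) (n : ℤ) : B :=
  if h : 1 ≤ i ∧ i ≤ M + N - 1 then x ⟨i, h⟩ n else 0

theorem map_osc {B C : Type} [Ring B] [Algebra ℂ B] [Ring C] [Algebra ℂ C] (f : B →ₐ[ℂ] C) (q : ℂ)
    (M : ℕ) (X : ℕ → ℤ → B) (Y : ℕ → ℤ → C) (h : ∀ i n, f (X i n) = Y i n) (m n k u : ℤ) :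
    f (oscOf q M X m n k u) = oscOf q M Y m n k u := by
  simp [oscOf, brF, h]

theorem map_brF {B C : Type} [Ring B] [Algebra ℂ B] [Ring C] [Algebra ℂ C] (f : B →ₐ[ℂ] C) (q : ℂ)
    (x y : B) : f (brF q x y) = brF q (f x) (f y) := by
  simp [brF]

namespace Sys
variable {B : Type} [Ring B] [Algebra ℂ B] {q : ℂ} {M N : ℕ} (S : Sys B q M N)

structure L2 : Prop where
  p : ∀ r ∈ S.R2, r = 0
  m : ∀ r ∈ S.opp.R2, r = 0

structure L3 : Prop where
  p : ∀ r ∈ S.R3, r = 0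
  m : ∀ r ∈ S.opp.R3, r = 0

theorem R4_of (h : ∀ r ∈ S.R2, r = 0) : S.half.R4 := fun i j m n hc => h _ (.e4 i j m n hc)
theorem R5_of (h : ∀ r ∈ S.R2, r = 0) : S.half.R5 :=
  fun i j m n hc => sub_eq_zero.1 (h _ (.e5 i j m n hc))

open MulOpposite in
theorem opp_el4 (i j m n) : S.opp.half.el4 i j m n =
    op (S.xm j n * S.xm i m - sgn M j.1 i.1 • (S.xm i m * S.xm j n)) := by
  rw [sgn_symm]; rfl

open MulOpposite in
theorem opp_el5 (i j m n) : S.opp.half.el5 i j m n =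
    op (-(q ^ cc M i.1 j.1) • 
    (S.xm j (n + 1) * S.xm i m - (q ^ (-cc M j.1 i.1)) • (S.xm i m * S.xm j (n + 1)) -
      ((q ^ (-cc M j.1 i.1)) • (S.xm j n * S.xm i (m + 1)) - S.xm i (m + 1) * S.xm j n))) := by
  have h0 : q ^ cc M i.1 j.1 ≠ 0 := zpow_ne_zero _ S.hq0
  have : S.opp.half.el5 i j m n = op (S.xm j n * S.xm i (m + 1) - (q ^ cc M i.1 j.1) •
    (S.xm i (m + 1) * S.xm j n) - ((q ^ cc M i.1 j.1) • (S.xm j (n + 1) * S.xm i m) -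
      S.xm i m * S.xm j (n + 1))) := rfl
  rw [this, cc_symm M j.1 i.1]
  congr 1
  simp only [smul_sub, smul_smul, neg_mul, zpow_neg, mul_inv_cancel₀ h0]
  module

open MulOpposite in
theorem opp_elS (i j m n k) : S.opp.half.elS i j m n k =
    op (polyJ (q + q⁻¹) (S.xm j k) (S.xm i m) (S.xm i n)) := by
  simp only [Half.elS, half, opp, polyJ, ← op_mul, ← op_add, ← op_sub, ← op_smul]
  congr 1
  simp only [mul_assoc]
  module

open MulOpposite in
theorem opp_elO (a b c m n k u) (hac : S.xm a m * S.xm c k = S.xm c k * S.xm a m) :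
    S.opp.half.elO a b c m n k u =
    op (osc1 (q + q⁻¹) (S.xm a m) (S.xm b n) (S.xm c k) (S.xm b u) +
      osc1 (q + q⁻¹) (S.xm a m) (S.xm b u) (S.xm c k) (S.xm b n)) := by
  simp only [Half.elO, half, opp, osc1, ← op_mul, ← op_add, ← op_sub, ← op_smul]
  congr 1
  have e : ∀ z, S.xm c k * (S.xm a m * z) = S.xm a m * (S.xm c k * z) := by
    intro z; rw [← mul_assoc, ← hac, mul_assoc]
  simp only [mul_assoc, e]
  module

theorem osc_SX (hM : 1 < M) (hN : 1 < N) (q : ℂ) (hq : q ≠ 0) (x : Idx M N → ℤ → B)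
    (hc : ∀ i j m n, cc M i.1 j.1 = 0 → x i m * x j n - sgn M i.1 j.1 • (x j n * x i m) = 0) :
    ∃ a b c : Idx M N, a.1 + 1 = M ∧ b.1 = M ∧ c.1 = M + 1 ∧
    (∀ m n, x a m * x c n = x c n * x a m) ∧
    ∀ m n k u, 
    oscOf q M (SX x) m n k u + oscOf q M (SX x) m u k n =
      osc1 (q + q⁻¹) (x a m) (x b n) (x c k) (x b u) +
      osc1 (q + q⁻¹) (x a m) (x b u) (x c k) (x b n) := by
  let a : Idx M N := ⟨M - 1, by omega, by omega⟩
  let b : Idx M N := ⟨M, by omega, by omega⟩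
  let c : Idx M N := ⟨M + 1, by omega, by omega⟩
  have hn : Nodes M N a b c := nodes a b c (by simp [a]; omega) rfl rfl
  have hac : ∀ m n, x a m * x c n = x c n * x a m := fun m n => by
    have := hc a c m n hn.hac
    rw [sgn_of_ne M _ _ (show (a : Idx M N).1 ≠ M by simp [a]; omega), one_smul] at this
    exact sub_eq_zero.1 this
  refine ⟨a, b, c, by simp [a]; omega, rfl, rfl, hac, fun m n k u => ?_⟩
  have ea : SX x (M - 1) = x a := by funext n; exact dif_pos _
  have eb : SX x M = x b := by funext n; exact dif_pos _
  have ec : SX x (M + 1) = x c := by funext n; exact dif_pos _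
  have hbd : x b n * x b u = - (x b u * x b n) := by
    have := hc b b n u (cc_MM M)
    rw [show sgn M b.1 b.1 = -1 by simp [sgn, b]] at this
    rw [sub_eq_zero.1 this]; simp
  rw [← osc_expand q hq (x a m) (x b n) (x c k) (x b u) (hac _ _) hbd]
  simp only [oscOf, ea, eb, ec]

def gen : Gen M N true → B
  | .Xp i n => S.xp i n
  | .Xm i n => S.xm i n
  | .K i => S.k (toJ i)
  | .Ki i => S.ki (toJ i)
  | .H i s => S.h i s
  | .K0 _ => S.k ⟨0, Nat.zero_le _⟩
  | .K0i _ => S.ki ⟨0, Nat.zero_le _⟩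

def liftF : FA M N true →ₐ[ℂ] B := FreeAlgebra.lift ℂ S.gen

theorem liftF_gi (g) : S.liftF (gi g) = S.gen g := by simp [liftF, gi]

theorem liftF_Xp (i n) : S.liftF (XpF M N true i n) = SX S.xp i n := by
  unfold XpF SX; split_ifs
  · exact S.liftF_gi _
  · simp
theorem liftF_Xm (i n) : S.liftF (XmF M N true i n) = SX S.xm i n := by
  unfold XmF SX; split_ifs
  · exact S.liftF_gi _
  · simp

theorem wt_zero (j : Idx M N) : wt (⟨0, Nat.zero_le _⟩ : JJ M N) j = if j.1 = 1 then 1 else 0 := by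
  simp [wt]

theorem liftF_rel (l : ℕ) (h2 : 2 ≤ l → S.L2) (h3 : 3 ≤ l → S.L3) {x y : FA M N true}
    (h : rel q M N true l x y) : S.liftF x = S.liftF y := by
  have m4 : 2 ≤ l → ∀ i j m n, cc M i.1 j.1 = 0 →
      S.xm i m * S.xm j n - sgn M i.1 j.1 • (S.xm j n * S.xm i m) = 0 := by
    intro hl i j m n h
    have := (h2 hl).m _ (.e4 j i n m (by rw [cc_symm]; exact h))
    rw [opp_el4] at this
    exact MulOpposite.op_injective this
  cases h with
  | KKi i => simp [liftF_gi, gen, S.kki]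
  | KiK i => simp [liftF_gi, gen, S.kik]
  | KK i j => simp [liftF_gi, gen, S.kk (toJ i) (toJ j)]
  | KKi2 i j => simp [liftF_gi, gen, S.kki2 (toJ i) (toJ j)]
  | KiKi i j => simp [liftF_gi, gen, S.kiki (toJ i) (toJ j)]
  | KH i j s => simp [liftF_gi, gen, S.kh]
  | KiH i j s => simp [liftF_gi, gen, S.kih]
  | HH i j s t => simp [liftF_gi, gen, S.hh i j s t]
  | KXp i j n => simp [liftF_gi, gen, S.kxp, wt_toJ]
  | KXm i j n => simp [liftF_gi, gen, S.kxm, wt_toJ]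
  | HXp i j s n => simpa [liftF_gi, gen, coh] using S.hxp i j s n
  | HXm i j s n => simpa [liftF_gi, gen, coh] using S.hxm i j s n
  | XpXm i j m n =>
    rw [map_sub, map_smul, map_mul, map_mul, liftF_gi, liftF_gi]
    refine (S.xx i j m n).trans ?_
    split_ifs
    · rw [map_smul, map_sub, phiPF_idx, phiMF_idx, map_phiG, map_phiG]
      simp only [liftF_gi]; rfl
    · simp
  | XX0p i j m n hl h =>
    simpa [half, liftF_gi, gen] using S.R4_of (h2 hl).p i j m n h
  | XX0m i j m n hl h => simpa [liftF_gi, gen] using m4 hl i j m n h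
  | XXp i j m n hl h => simpa [half, liftF_gi, gen] using S.R5_of (h2 hl).p i j m n h
  | XXm i j m n hl h =>
    have := (h2 hl).m _ (.e5 j i n m (by rw [cc_symm]; exact h))
    rw [opp_el5] at this
    have := MulOpposite.op_injective (this.trans MulOpposite.op_zero.symm)
    rw [smul_eq_zero, neg_eq_zero] at this
    have := this.resolve_left (zpow_ne_zero _ S.hq0)
    simpa [liftF_gi, gen] using sub_eq_zero.1 this
  | serreP i j m n k hl h hi =>
    have := (h3 hl).p _ (.eS i j m n k hi h)
    rw [map_zero, ← this, map_add]
    simp only [map_brF, liftF_gi]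
    exact serre_expand q S.hq0 _ _ _
  | serreM i j m n k hl h hi =>
    have := (h3 hl).m _ (.eS i j m n k hi h)
    rw [opp_elS] at this
    have := MulOpposite.op_injective (this.trans MulOpposite.op_zero.symm)
    rw [map_zero, ← this, map_add]
    simp only [map_brF, liftF_gi]
    exact serre_expand q S.hq0 _ _ _
  | oscP m n k u hl hM hN =>
    obtain ⟨a, b, c, ha, hb, hc, hac, hh⟩ := osc_SX hM hN q S.hq0 S.xp
      (S.R4_of (h2 (by omega)).p)
    have := (h3 hl).p _ (.eO a b c ha hb hc m n k u)
    rw [map_zero, map_add, map_osc _ _ _ _ _ S.liftF_Xp, map_osc _ _ _ _ _ S.liftF_Xp, hh]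
    exact this
  | oscM m n k u hl hM hN =>
    obtain ⟨a, b, c, ha, hb, hc, hac, hh⟩ := osc_SX hM hN q S.hq0 S.xm (m4 (by omega))
    have := (h3 hl).m _ (.eO a b c ha hb hc m n k u)
    rw [opp_elO _ _ _ _ _ _ _ _ (hac _ _)] at this
    rw [map_zero, map_add, map_osc _ _ _ _ _ S.liftF_Xm, map_osc _ _ _ _ _ S.liftF_Xm, hh]
    exact MulOpposite.op_injective this
  | K0K0i he => simp [liftF_gi, gen, S.kki]
  | K0iK0 he => simp [liftF_gi, gen, S.kik]
  | K0K he i => simp [liftF_gi, gen, S.kk _ (toJ i)]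
  | K0Ki he i => simp [liftF_gi, gen, S.kki2 _ (toJ i)]
  | K0H he i s => simp [liftF_gi, gen, S.kh]
  | K0Xp he i n => simp only [map_mul, map_smul, liftF_gi, gen, S.kxp, wt_zero]
  | K0Xm he i n =>
    simp only [map_mul, map_smul, liftF_gi, gen, S.kxm, wt_zero]
    split_ifs <;> simp

/-- the homomorphism from the presented algebra attached to a system -/
def lift (l : ℕ) (h2 : 2 ≤ l → S.L2) (h3 : 3 ≤ l → S.L3) : ALG q M N true l →ₐ[ℂ] B :=
  RingQuot.liftAlgHom ℂ ⟨S.liftF, fun _ _ h => S.liftF_rel l h2 h3 h⟩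

theorem lift_mk (l : ℕ) (h2 : 2 ≤ l → S.L2) (h3 : 3 ≤ l → S.L3) (x) :
    S.lift l h2 h3 (mkA q M N true l x) = S.liftF x := by
  simp [lift, mkA, RingQuot.liftAlgHom_mkAlgHom_apply]

theorem lift_gi (l : ℕ) (h2 : 2 ≤ l → S.L2) (h3 : 3 ≤ l → S.L3) (g) :
    S.lift l h2 h3 (mkA q M N true l (gi g)) = S.gen g := by
  rw [lift_mk, liftF_gi]

theorem gen_kGen (a) : S.gen (kGen a) = S.k a := by
  unfold kGen; split_ifs with h
  · simp only [gen]; congr 1; exact Subtype.ext h.symm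
  · rfl
theorem gen_kiGen (a) : S.gen (kiGen a) = S.ki a := by
  unfold kiGen; split_ifs with h
  · simp only [gen]; congr 1; exact Subtype.ext h.symm
  · rfl

end Sys
end QAS
end

section
namespace QAS
open Polynomial
open scoped TensorProduct

namespace Sys
variable {B C : Type} [Ring B] [Algebra ℂ B] [Ring C] [Algebra ℂ C] {q : ℂ} {M N : ℕ}
  (S : Sys B q M N)

/-- image of a system under a homomorphism -/
def map (f : B →ₐ[ℂ] C) : Sys C q M N where
  hq0 := S.hq0
  hq2 := S.hq2
  xp := fun i n => f (S.xp i n)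
  xm := fun i n => f (S.xm i n)
  k := fun a => f (S.k a)
  ki := fun a => f (S.ki a)
  h := fun i s => f (S.h i s)
  kki := fun a => by rw [← map_mul, S.kki, map_one]
  kik := fun a => by rw [← map_mul, S.kik, map_one]
  kk := fun a b => by rw [← map_mul, S.kk, map_mul]
  kh := fun a i s => by rw [← map_mul, S.kh, map_mul]
  hh := fun i j s t => by rw [← map_mul, S.hh, map_mul]
  kxp := fun a j n => by rw [← map_mul, S.kxp, map_smul, map_mul]
  kxm := fun a j n => by rw [← map_mul, S.kxm, map_smul, map_mul]
  hxp := fun i j s n => by rw [← map_mul, ← map_mul, ← map_sub, S.hxp, map_smul]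
  hxm := fun i j s n => by rw [← map_mul, ← map_mul, ← map_sub, S.hxm, map_neg, map_smul]
  xx := fun i j m n => by
    rw [← map_mul, ← map_mul, ← map_smul, ← map_sub, S.xx]
    split_ifs
    · rw [map_smul, map_sub, map_phiG, map_phiG]
    · simp

theorem map_R2 (f : B →ₐ[ℂ] C) : ∀ r ∈ (S.map f).R2, ∃ r0 ∈ S.R2, r = f r0 := by
  rintro r (⟨i, j, m, n, h⟩ | ⟨i, j, m, n, h⟩)
  · exact ⟨_, .e4 i j m n h, by simp [Half.el4, half, map]⟩
  · exact ⟨_, .e5 i j m n h, by simp [Half.el5, half, map]⟩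

theorem map_R3 (f : B →ₐ[ℂ] C) : ∀ r ∈ (S.map f).R3, ∃ r0 ∈ S.R3, r = f r0 := by
  rintro r (⟨i, j, m, n, k, hi, h⟩ | ⟨a, b, c, ha, hb, hc, m, n, k, u⟩)
  · exact ⟨_, .eS i j m n k hi h, by simp [Half.elS, half, map, polyJ]⟩
  · exact ⟨_, .eO a b c ha hb hc m n k u, by simp [Half.elO, half, map, osc1]⟩

theorem map_opp (f : B →ₐ[ℂ] C) : (S.map f).opp = S.opp.map (AlgHom.op f) := rfl

/-- transported relation elements on the negative side -/
def R2m : Set B := {r | MulOpposite.op r ∈ S.opp.R2}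
def R3m : Set B := {r | MulOpposite.op r ∈ S.opp.R3}

theorem map_L2 (f : B →ₐ[ℂ] C) (h : ∀ r ∈ S.R2, f r = 0) (h' : ∀ r ∈ S.R2m, f r = 0) :
    (S.map f).L2 where
  p := fun r hr => by obtain ⟨r0, h0, rfl⟩ := S.map_R2 f r hr; exact h _ h0
  m := fun r hr => by
    rw [map_opp] at hr
    obtain ⟨r0, h0, rfl⟩ := S.opp.map_R2 _ r hr
    have := h' r0.unop h0
    simp [this]

theorem map_L3 (f : B →ₐ[ℂ] C) (h : ∀ r ∈ S.R3, f r = 0) (h' : ∀ r ∈ S.R3m, f r = 0) :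
    (S.map f).L3 where
  p := fun r hr => by obtain ⟨r0, h0, rfl⟩ := S.map_R3 f r hr; exact h _ h0
  m := fun r hr => by
    rw [map_opp] at hr
    obtain ⟨r0, h0, rfl⟩ := S.opp.map_R3 _ r hr
    have := h' r0.unop h0
    simp [this]

theorem span_op (R : Set Bᵐᵒᵖ) (x : Bᵐᵒᵖ) (hx : x ∈ Submodule.span ℂ R) :
    x.unop ∈ Submodule.span ℂ {r | MulOpposite.op r ∈ R} := by
  induction hx using Submodule.span_induction with
  | mem x hx => exact Submodule.subset_span hx
  | zero => simp
  | add x y _ _ h1 h2 => exact add_mem h1 h2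
  | smul c x _ h => exact Submodule.smul_mem _ c h

theorem stab_unop {R : Set Bᵐᵒᵖ} (h : S.opp.Stab R) : S.Stab {r | MulOpposite.op r ∈ R} where
  h := fun r hr i s => by
    have := span_op R _ (h.h _ hr i s)
    have e : S.h i s * r - r * S.h i s =
      - (S.opp.h i s * MulOpposite.op r - MulOpposite.op r * S.opp.h i s).unop := by
      simp [opp]
    rw [e]; exact neg_mem this
  k := fun r hr a => by
    obtain ⟨c, hc, e⟩ := h.k _ hr a
    have e' := congrArg MulOpposite.unop e
    refine ⟨c⁻¹, inv_ne_zero hc, ?_⟩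
    have e2 : r * S.k a = c • (S.k a * r) := by simpa [opp] using e'
    rw [e2, smul_smul, inv_mul_cancel₀ hc, one_smul]

theorem comm_unop {R : Set Bᵐᵒᵖ}
    (h : ∀ r ∈ R, ∀ j n, ∃ c : ℂ, r * S.opp.xm j n = c • (S.opp.xm j n * r)) :
    ∀ r ∈ {r | MulOpposite.op r ∈ R}, ∀ j n, ∃ c : ℂ, S.xp j n * r = c • (r * S.xp j n) := by
  intro r hr j n
  obtain ⟨c, e⟩ := h _ hr j n
  have e' := congrArg MulOpposite.unop e
  exact ⟨c, by simpa [opp] using e'⟩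

theorem R2_Ap : S.R2 ⊆ (Algebra.adjoin ℂ S.gp : Set B) := by
  have hx : ∀ i n, S.xp i n ∈ Algebra.adjoin ℂ S.gp := fun i n => Algebra.subset_adjoin ⟨i, n, rfl⟩
  rintro r (⟨i, j, m, n, h⟩ | ⟨i, j, m, n, h⟩)
  · exact sub_mem (mul_mem (hx _ _) (hx _ _)) (Subalgebra.smul_mem _ (mul_mem (hx _ _) (hx _ _)) _)
  · exact sub_mem (sub_mem (mul_mem (hx _ _) (hx _ _))
      (Subalgebra.smul_mem _ (mul_mem (hx _ _) (hx _ _)) _)) (sub_mem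
      (Subalgebra.smul_mem _ (mul_mem (hx _ _) (hx _ _)) _) (mul_mem (hx _ _) (hx _ _)))

theorem R3_Ap : S.R3 ⊆ (Algebra.adjoin ℂ S.gp : Set B) := by
  have hx : ∀ i n, S.xp i n ∈ Algebra.adjoin ℂ S.gp := fun i n => Algebra.subset_adjoin ⟨i, n, rfl⟩
  have h4 : ∀ i m j n k p l u, S.xp i m * S.xp j n * S.xp k p * S.xp l u ∈ Algebra.adjoin ℂ S.gp :=
    fun i m j n k p l u => mul_mem (mul_mem (mul_mem (hx _ _) (hx _ _)) (hx _ _)) (hx _ _)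
  have h3 : ∀ i m j n k p, S.xp i m * S.xp j n * S.xp k p ∈ Algebra.adjoin ℂ S.gp :=
    fun i m j n k p => mul_mem (mul_mem (hx _ _) (hx _ _)) (hx _ _)
  have ho : ∀ i m j n k p l u, osc1 (q + q⁻¹) (S.xp i m) (S.xp j n) (S.xp k p) (S.xp l u)
      ∈ Algebra.adjoin ℂ S.gp := fun i m j n k p l u =>
    sub_mem (add_mem (add_mem (add_mem (h4 _ _ _ _ _ _ _ _) (h4 _ _ _ _ _ _ _ _))
      (h4 _ _ _ _ _ _ _ _)) (h4 _ _ _ _ _ _ _ _)) (Subalgebra.smul_mem _ (h4 _ _ _ _ _ _ _ _) _)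
  rintro r (⟨i, j, m, n, k, hi, h⟩ | ⟨a, b, c, ha, hb, hc, m, n, k, u⟩)
  · exact add_mem (add_mem (sub_mem (add_mem (h3 _ _ _ _ _ _) (h3 _ _ _ _ _ _))
      (Subalgebra.smul_mem _ (add_mem (h3 _ _ _ _ _ _) (h3 _ _ _ _ _ _)) _)) (h3 _ _ _ _ _ _))
      (h3 _ _ _ _ _ _)
  · exact add_mem (ho _ _ _ _ _ _ _ _) (ho _ _ _ _ _ _ _ _)

theorem opp_Ap (x : B) (h : MulOpposite.op x ∈ S.opp.Ap) : x ∈ S.Am := by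
  have : ∀ y ∈ Algebra.adjoin ℂ S.opp.gp, y.unop ∈ Algebra.adjoin ℂ S.gm := by
    intro y hy
    induction hy using Algebra.adjoin_induction with
    | mem y hy => obtain ⟨i, n, rfl⟩ := hy; exact Algebra.subset_adjoin ⟨i, n, rfl⟩
    | algebraMap r => exact Subalgebra.algebraMap_mem _ r
    | add x y _ _ h1 h2 => exact add_mem h1 h2
    | mul x y _ _ h1 h2 => exact mul_mem h2 h1
  exact this _ h

end Sys

section
variable (q : ℂ) (h0 : q ≠ 0) (h2 : q ^ 2 ≠ 1) (M N l : ℕ)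

theorem SysA_L2 (hl : 2 ≤ l) : (SysA q h0 h2 M N l).L2 where
  p := by
    rintro r (⟨i, j, m, n, h⟩ | ⟨i, j, m, n, h⟩)
    · simpa [Half.el4, Sys.half, SysA] using mkA_rel q M N l (.XX0p i j m n hl h)
    · refine sub_eq_zero.2 ?_
      simpa [Half.el4, Sys.half, SysA] using mkA_rel q M N l (.XXp i j m n hl h)
  m := by
    rintro r (⟨i, j, m, n, h⟩ | ⟨i, j, m, n, h⟩)
    · rw [Sys.opp_el4, MulOpposite.op_eq_zero_iff]
      simpa [SysA] using mkA_rel q M N l (.XX0m j i n m hl (by rw [cc_symm]; exact h))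
    · rw [Sys.opp_el5, MulOpposite.op_eq_zero_iff, sub_eq_zero.2, smul_zero]
      simpa [SysA] using mkA_rel q M N l (.XXm j i n m hl (by rw [cc_symm]; exact h))

theorem SysA_L3 (hl : 3 ≤ l) : (SysA q h0 h2 M N l).L3 where
  p := by
    rintro r (⟨i, j, m, n, k, hi, h⟩ | ⟨a, b, c, ha, hb, hc, m, n, k, u⟩)
    · have := mkA_rel q M N l (.serreP i j m n k hl h hi)
      rw [map_add, map_zero] at this
      simp only [map_brF] at this
      rw [serre_expand q h0] at this
      exact this
    · have hM : 1 < M := by have := a.2; omega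
      have hN : 1 < N := by have := c.2; omega
      obtain ⟨a', b', c', ha', hb', hc', hac, hh⟩ := Sys.osc_SX hM hN q h0 (SysA q h0 h2 M N l).xp
        ((SysA q h0 h2 M N l).R4_of (SysA_L2 q h0 h2 M N l (by omega)).p)
      obtain rfl : a' = a := Subtype.ext (by omega)
      obtain rfl : b' = b := Subtype.ext (by omega)
      obtain rfl : c' = c := Subtype.ext (by omega)
      have X : ∀ i n, mkA q M N true l (XpF M N true i n) = SX (SysA q h0 h2 M N l).xp i n := by
        intro i n; unfold XpF SX; split_ifs
        · rfl
        · simp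
      have := mkA_rel q M N l (.oscP m n k u hl hM hN)
      rw [map_zero, map_add, map_osc _ _ _ _ _ X, map_osc _ _ _ _ _ X, hh] at this
      exact this
  m := by
    rintro r (⟨i, j, m, n, k, hi, h⟩ | ⟨a, b, c, ha, hb, hc, m, n, k, u⟩)
    · rw [Sys.opp_elS, MulOpposite.op_eq_zero_iff]
      have := mkA_rel q M N l (.serreM i j m n k hl h hi)
      rw [map_add, map_zero] at this
      simp only [map_brF] at this
      rw [serre_expand q h0] at this
      exact this
    · have hM : 1 < M := by have := a.2; omega
      have hN : 1 < N := by have := c.2; omega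
      have m4 : ∀ i j m n, cc M i.1 j.1 = 0 → (SysA q h0 h2 M N l).xm i m *
          (SysA q h0 h2 M N l).xm j n - sgn M i.1 j.1 • ((SysA q h0 h2 M N l).xm j n *
          (SysA q h0 h2 M N l).xm i m) = 0 := by
        intro i j m n h
        simpa [SysA] using mkA_rel q M N l (.XX0m i j m n (by omega) h)
      obtain ⟨a', b', c', ha', hb', hc', hac, hh⟩ := Sys.osc_SX hM hN q h0 (SysA q h0 h2 M N l).xm m4
      obtain rfl : a' = a := Subtype.ext (by omega)
      obtain rfl : b' = b := Subtype.ext (by omega)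
      obtain rfl : c' = c := Subtype.ext (by omega)
      have X : ∀ i n, mkA q M N true l (XmF M N true i n) = SX (SysA q h0 h2 M N l).xm i n := by
        intro i n; unfold XmF SX; split_ifs
        · rfl
        · simp
      rw [Sys.opp_elO _ _ _ _ _ _ _ _ (hac _ _), MulOpposite.op_eq_zero_iff]
      have := mkA_rel q M N l (.oscM m n k u hl hM hN)
      rw [map_zero, map_add, map_osc _ _ _ _ _ X, map_osc _ _ _ _ _ X, hh] at this
      exact this

theorem SysA_gen_mem (g : Gen M N true) : mkA q M N true l (gi g) ∈ (SysA q h0 h2 M N l).gm ∪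
    (SysA q h0 h2 M N l).g0 ∪ (SysA q h0 h2 M N l).gp := by
  cases g with
  | Xp i n => exact Or.inr ⟨i, n, rfl⟩
  | Xm i n => exact Or.inl (Or.inl ⟨i, n, rfl⟩)
  | K i => exact Or.inl (Or.inr (Or.inl ⟨toJ i, by simp [SysA, kGen_toJ]⟩))
  | Ki i => exact Or.inl (Or.inr (Or.inr (Or.inl ⟨toJ i, by simp [SysA, kiGen_toJ]⟩)))
  | H i s => exact Or.inl (Or.inr (Or.inr (Or.inr ⟨i, s, rfl⟩)))
  | K0 e => exact Or.inl (Or.inr (Or.inl ⟨⟨0, Nat.zero_le _⟩, by simp [SysA, kGen]⟩))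
  | K0i e => exact Or.inl (Or.inr (Or.inr (Or.inl ⟨⟨0, Nat.zero_le _⟩, by simp [SysA, kiGen]⟩)))

theorem SysA_gener : (SysA q h0 h2 M N l).Gener := by
  unfold Sys.Gener
  rw [eq_top_iff]
  rintro x -
  obtain ⟨y, rfl⟩ := RingQuot.mkAlgHom_surjective ℂ (rel q M N true l) x
  change mkA q M N true l y ∈ _
  induction y using FreeAlgebra.induction with
  | grade0 r => rw [AlgHom.commutes]; exact Subalgebra.algebraMap_mem _ _
  | grade1 g => exact Algebra.subset_adjoin (SysA_gen_mem q h0 h2 M N l g)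
  | mul a b h1 h2 => rw [map_mul]; exact mul_mem h1 h2
  | add a b h1 h2 => rw [map_add]; exact add_mem h1 h2

end
end QAS
end

section
namespace QAS
open Polynomial
open scoped TensorProduct

/-- the Laurent polynomial algebra -/
abbrev PP (M N : ℕ) := MvPolynomial (Idx M N × {s : ℤ // s ≠ 0}) (AddMonoidAlgebra ℂ (JJ M N →₀ ℤ))

section
variable {M N : ℕ}

def PS (f : JJ M N →₀ ℤ) : PP M N := MvPolynomial.C (AddMonoidAlgebra.single f (1 : ℂ))
def PH (i : Idx M N) (s : {s : ℤ // s ≠ 0}) : PP M N := MvPolynomial.X (i, s)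
def PK (a : JJ M N) : PP M N := PS (Finsupp.single a 1)
def PKi (a : JJ M N) : PP M N := PS (Finsupp.single a (-1))

theorem PS_add (f g : JJ M N →₀ ℤ) : PS (f + g) = PS f * PS g := by
  simp [PS, ← map_mul, AddMonoidAlgebra.single_mul_single]
theorem PS_zero : PS (0 : JJ M N →₀ ℤ) = 1 := by
  unfold PS
  rw [← map_one MvPolynomial.C]; rfl
theorem PK_PKi (a : JJ M N) : PK a * PKi a = 1 := by
  unfold PK PKi
  rw [← PS_add, ← Finsupp.single_add]; simp [PS_zero]

def Pgens (M N : ℕ) : Set (PP M N) := {x | (∃ a, x = PK a) ∨ (∃ a, x = PKi a) ∨ ∃ i s, x = PH i s}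

theorem PS_nsmul (f : JJ M N →₀ ℤ) (n : ℕ) : PS (n • f) = PS f ^ n := by
  induction n with
  | zero => simp [PS_zero]
  | succ n ih => rw [add_smul, PS_add, ih, one_smul, pow_succ]

theorem PS_mem (f : JJ M N →₀ ℤ) : PS f ∈ Algebra.adjoin ℂ (Pgens M N) := by
  induction f using Finsupp.induction_linear with
  | zero => rw [PS_zero]; exact one_mem _
  | add f g h1 h2 => rw [PS_add]; exact mul_mem h1 h2
  | single a n =>
    obtain ⟨k, rfl | rfl⟩ := n.eq_nat_or_neg
    · have : Finsupp.single a (k : ℤ) = k • Finsupp.single a (1 : ℤ) := by simp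
      rw [this, PS_nsmul]
      have : PS (Finsupp.single a 1) ∈ Algebra.adjoin ℂ (Pgens M N) :=
        Algebra.subset_adjoin (Or.inl ⟨a, rfl⟩)
      exact pow_mem this _
    · have : Finsupp.single a (-(k : ℤ)) = k • Finsupp.single a (-1 : ℤ) := by simp
      rw [this, PS_nsmul]
      have : PS (Finsupp.single a (-1)) ∈ Algebra.adjoin ℂ (Pgens M N) :=
        Algebra.subset_adjoin (Or.inr (Or.inl ⟨a, rfl⟩))
      exact pow_mem this _

theorem PP_gen : Algebra.adjoin ℂ (Pgens M N) = ⊤ := by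
  rw [eq_top_iff]
  rintro x -
  induction x using MvPolynomial.induction_on with
  | C a =>
    induction a using AddMonoidAlgebra.induction_linear with
    | zero => simp
    | add f g h1 h2 => rw [map_add]; exact add_mem h1 h2
    | single f c =>
      have : (MvPolynomial.C (AddMonoidAlgebra.single f c) : PP M N) = c • PS f := by
        unfold PS
        ext d
        rw [MvPolynomial.coeff_smul, MvPolynomial.coeff_C, MvPolynomial.coeff_C]
        split_ifs <;> simp
      rw [this]
      exact Subalgebra.smul_mem _ (PS_mem f) _
  | add p r h1 h2 => exact add_mem h1 h2
  | mul_X p g h => exact mul_mem h (Algebra.subset_adjoin (Or.inr (Or.inr ⟨g.1, g.2, rfl⟩)))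

theorem PP_ext {B : Type} [Ring B] [Algebra ℂ B] {f g : PP M N →ₐ[ℂ] B}
    (hK : ∀ a, f (PK a) = g (PK a)) (hH : ∀ i s, f (PH i s) = g (PH i s)) : f = g := by
  apply AlgHom.ext_of_adjoin_eq_top PP_gen
  rintro x (⟨a, rfl⟩ | ⟨a, rfl⟩ | ⟨i, s, rfl⟩)
  · exact hK a
  · have e1 : f (PKi a) * f (PK a) = 1 := by rw [← map_mul, mul_comm, PK_PKi, map_one]
    have e2 : f (PK a) * g (PKi a) = 1 := by rw [hK, ← map_mul, PK_PKi, map_one]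
    exact left_inv_eq_right_inv e1 e2
  · exact hH i s

/-- universal property, commutative target -/
theorem PP_lift {A : Type} [CommRing A] [Algebra ℂ A] (k ki : JJ M N → A) (hk : ∀ a, k a * ki a = 1)
    (h : Idx M N → {s : ℤ // s ≠ 0} → A) :
    ∃ f : PP M N →ₐ[ℂ] A, (∀ a, f (PK a) = k a) ∧ (∀ a, f (PKi a) = ki a) ∧
      ∀ i s, f (PH i s) = h i s := by
  let u : JJ M N → Aˣ := fun a => ⟨k a, ki a, hk a, by rw [mul_comm, hk]⟩
  let φ : (JJ M N →₀ ℤ) →+ Additive Aˣ :=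
    Finsupp.liftAddHom (fun a => zmultiplesHom (Additive Aˣ) (Additive.ofMul (u a)))
  let ψ : Multiplicative (JJ M N →₀ ℤ) →* A :=
    (Units.coeHom A).comp (AddMonoidHom.toMultiplicativeLeft φ)
  have hψ : ∀ a n, ψ (Multiplicative.ofAdd (Finsupp.single a n)) = ((u a ^ n : Aˣ) : A) := by
    intro a n
    simp [ψ, φ]
  let g := MvPolynomial.aevalTower (AddMonoidAlgebra.lift ℂ A (JJ M N →₀ ℤ) ψ)
    (fun x : Idx M N × {s : ℤ // s ≠ 0} => h x.1 x.2)
  refine ⟨g, ?_, ?_, ?_⟩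
  · intro a
    simp only [g, PK, PS, MvPolynomial.aevalTower_C, AddMonoidAlgebra.lift_single, hψ]
    simp [u]
  · intro a
    simp only [g, PKi, PS, MvPolynomial.aevalTower_C, AddMonoidAlgebra.lift_single, hψ]
    simp [u]
  · intro i s
    simp [g, PH]
end

namespace Sys
variable {B C : Type} [Ring B] [Algebra ℂ B] [Ring C] [Algebra ℂ C] {q : ℂ} {M N : ℕ}
  (S : Sys B q M N)

theorem g0_comm : ∀ x ∈ S.g0, ∀ y ∈ S.g0, x * y = y * x := by
  rintro x (⟨a, rfl⟩ | ⟨a, rfl⟩ | ⟨i, s, rfl⟩) y (⟨b, rfl⟩ | ⟨b, rfl⟩ | ⟨j, t, rfl⟩)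
  · exact S.kk _ _
  · exact S.kki2 _ _
  · exact S.kh _ _ _
  · exact (S.kki2 _ _).symm
  · exact S.kiki _ _
  · exact S.kih _ _ _
  · exact (S.kh _ _ _).symm
  · exact (S.kih _ _ _).symm
  · exact S.hh _ _ _ _

theorem exists_phiHom : ∃ f : PP M N →ₐ[ℂ] B, (∀ a, f (PK a) = S.k a) ∧ (∀ a, f (PKi a) = S.ki a) ∧
      ∀ i s, f (PH i s) = S.h i s := by
  letI : CommRing (Algebra.adjoin ℂ S.g0) :=
    { (inferInstance : Ring (Algebra.adjoin ℂ S.g0)) with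
      mul_comm := (Algebra.adjoinCommRingOfComm ℂ S.g0_comm).mul_comm }
  obtain ⟨f, h1, h2, h3⟩ := PP_lift (A := Algebra.adjoin ℂ S.g0) (fun a => ⟨S.k a, S.k_mem a⟩)
    (fun a => ⟨S.ki a, S.ki_mem a⟩) (fun a => Subtype.ext (S.kki a)) (fun i s => ⟨S.h i s, S.h_mem i s⟩)
  refine ⟨(Algebra.adjoin ℂ S.g0).val.comp f, fun a => ?_, fun a => ?_, fun i s => ?_⟩
  · simp [h1]
  · simp [h2]
  · simp [h3]

/-- the homomorphism from the Laurent polynomial algebra -/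
def pH : PP M N →ₐ[ℂ] B := S.exists_phiHom.choose
theorem pH_K (a) : S.pH (PK a) = S.k a := S.exists_phiHom.choose_spec.1 a
theorem pH_Ki (a) : S.pH (PKi a) = S.ki a := S.exists_phiHom.choose_spec.2.1 a
theorem pH_H (i s) : S.pH (PH i s) = S.h i s := S.exists_phiHom.choose_spec.2.2 i s

theorem pH_range : S.pH.range = Algebra.adjoin ℂ S.g0 := by
  rw [← Algebra.map_top, ← PP_gen, AlgHom.map_adjoin]
  congr 1
  ext x; constructor
  · rintro ⟨_, (⟨a, rfl⟩ | ⟨a, rfl⟩ | ⟨i, s, rfl⟩), rfl⟩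
    · exact Or.inl ⟨a, S.pH_K a⟩
    · exact Or.inr (Or.inl ⟨a, S.pH_Ki a⟩)
    · exact Or.inr (Or.inr ⟨i, s, S.pH_H i s⟩)
  · rintro (⟨a, rfl⟩ | ⟨a, rfl⟩ | ⟨i, s, rfl⟩)
    · exact ⟨_, Or.inl ⟨a, rfl⟩, S.pH_K a⟩
    · exact ⟨_, Or.inr (Or.inl ⟨a, rfl⟩), S.pH_Ki a⟩
    · exact ⟨_, Or.inr (Or.inr ⟨i, s, rfl⟩), S.pH_H i s⟩

theorem map_pH (f : B →ₐ[ℂ] C) : (S.map f).pH = f.comp S.pH := by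
  apply PP_ext
  · intro a; rw [pH_K]; simp [pH_K, map]
  · intro a s; rw [pH_H]; simp [pH_H, map]

/-- multiplication map -/
def Th : (↥(Algebra.adjoin ℂ S.gm) ⊗[ℂ] (PP M N ⊗[ℂ] ↥(Algebra.adjoin ℂ S.gp))) →ₗ[ℂ] B :=
  TensorProduct.lift
    (((LinearMap.mul ℂ B).comp (Algebra.adjoin ℂ S.gm).val.toLinearMap).compl₂
      (TensorProduct.lift
        (((LinearMap.mul ℂ B).comp S.pH.toLinearMap).compl₂
          (Algebra.adjoin ℂ S.gp).val.toLinearMap)))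

theorem Th_tmul (a p c) : S.Th (a ⊗ₜ (p ⊗ₜ c)) = a.1 * (S.pH p * c.1) := by
  simp [Th]

def resm (f : B →ₐ[ℂ] C) : ↥(Algebra.adjoin ℂ S.gm) →ₗ[ℂ] ↥(Algebra.adjoin ℂ (S.map f).gm) :=
  LinearMap.restrict (p := (Algebra.adjoin ℂ S.gm).toSubmodule)
    (q := (Algebra.adjoin ℂ (S.map f).gm).toSubmodule) f.toLinearMap (by
    intro x hx
    have : f x ∈ (Algebra.adjoin ℂ S.gm).map f := ⟨x, hx, rfl⟩
    rw [AlgHom.map_adjoin] at this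
    refine Algebra.adjoin_mono ?_ this
    rintro _ ⟨_, ⟨i, n, rfl⟩, rfl⟩; exact ⟨i, n, rfl⟩)

def resp (f : B →ₐ[ℂ] C) : ↥(Algebra.adjoin ℂ S.gp) →ₗ[ℂ] ↥(Algebra.adjoin ℂ (S.map f).gp) :=
  LinearMap.restrict (p := (Algebra.adjoin ℂ S.gp).toSubmodule)
    (q := (Algebra.adjoin ℂ (S.map f).gp).toSubmodule) f.toLinearMap (by
    intro x hx
    have : f x ∈ (Algebra.adjoin ℂ S.gp).map f := ⟨x, hx, rfl⟩
    rw [AlgHom.map_adjoin] at this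
    refine Algebra.adjoin_mono ?_ this
    rintro _ ⟨_, ⟨i, n, rfl⟩, rfl⟩; exact ⟨i, n, rfl⟩)

theorem resm_surj (f : B →ₐ[ℂ] C) : Function.Surjective (S.resm f) := by
  rintro ⟨x, hx⟩
  have : x ∈ (Algebra.adjoin ℂ S.gm).map f := by
    rw [AlgHom.map_adjoin]
    refine Algebra.adjoin_mono ?_ hx
    rintro _ ⟨i, n, rfl⟩; exact ⟨_, ⟨i, n, rfl⟩, rfl⟩
  obtain ⟨y, hy, rfl⟩ := this
  exact ⟨⟨y, hy⟩, rfl⟩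

theorem resp_surj (f : B →ₐ[ℂ] C) : Function.Surjective (S.resp f) := by
  rintro ⟨x, hx⟩
  have : x ∈ (Algebra.adjoin ℂ S.gp).map f := by
    rw [AlgHom.map_adjoin]
    refine Algebra.adjoin_mono ?_ hx
    rintro _ ⟨i, n, rfl⟩; exact ⟨_, ⟨i, n, rfl⟩, rfl⟩
  obtain ⟨y, hy, rfl⟩ := this
  exact ⟨⟨y, hy⟩, rfl⟩

def Pi (f : B →ₐ[ℂ] C) := TensorProduct.map (S.resm f)
  (TensorProduct.map (LinearMap.id : PP M N →ₗ[ℂ] PP M N) (S.resp f))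

theorem Th_Pi (f : B →ₐ[ℂ] C) (t) : (S.map f).Th (S.Pi f t) = f (S.Th t) := by
  have : (S.map f).Th ∘ₗ S.Pi f = f.toLinearMap ∘ₗ S.Th := by
    apply TensorProduct.ext'
    intro a y
    induction y using TensorProduct.induction_on with
    | zero => simp
    | add x y h1 h2 => rw [TensorProduct.tmul_add, map_add, map_add, h1, h2]
    | tmul p c =>
      have h1 : (S.resm f a).1 = f a.1 := rfl
      have h2 : (S.resp f c).1 = f c.1 := rfl
      simp [Pi, Th_tmul, map_pH, h1, h2]
  exact LinearMap.congr_fun this t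

theorem step (hS : S.Gener) (f : B →ₐ[ℂ] C) {R R' : Set B} (hR : S.Stab R) (hR' : S.Stab R')
    (cR : ∀ r ∈ R, ∀ j n, ∃ c : ℂ, r * S.xm j n = c • (S.xm j n * r))
    (cR' : ∀ r ∈ R', ∀ j n, ∃ c : ℂ, S.xp j n * r = c • (r * S.xp j n))
    (mR : R ⊆ (Algebra.adjoin ℂ S.gp : Set B)) (mR' : R' ⊆ (Algebra.adjoin ℂ S.gm : Set B))
    (fR : ∀ r ∈ R, f r = 0) (fR' : ∀ r ∈ R', f r = 0)
    (hker : ∀ x, f x = 0 → x ∈ (⊤ * Submodule.span ℂ R * ⊤ ⊔ ⊤ * Submodule.span ℂ R' * ⊤ :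
      Submodule ℂ B)) (hinj : Function.Injective S.Th) : Function.Injective (S.map f).Th := by
  have sR : Submodule.span ℂ R ≤ S.Ap := Submodule.span_le.2 mR
  have sR' : Submodule.span ℂ R' ≤ S.Am := Submodule.span_le.2 mR'
  have kR : Submodule.span ℂ R ≤ LinearMap.ker f.toLinearMap := Submodule.span_le.2 fR
  have kR' : Submodule.span ℂ R' ≤ LinearMap.ker f.toLinearMap := Submodule.span_le.2 fR'
  have key : (⊤ * Submodule.span ℂ R * ⊤ ⊔ ⊤ * Submodule.span ℂ R' * ⊤ : Submodule ℂ B) ≤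
      (LinearMap.ker (S.Pi f)).map S.Th := by
    apply sup_le
    · refine (S.ideal_plus hS hR cR).trans ?_
      have hz : S.Ap * Submodule.span ℂ R * S.Ap ≤ S.Ap ⊓ LinearMap.ker f.toLinearMap := by
        apply le_inf
        · calc _ ≤ S.Ap * S.Ap * S.Ap := smulL (smulR sR)
            _ = _ := by rw [adj_mul_self, adj_mul_self]
        · rw [Submodule.mul_le]
          intro x hx y hy
          have : S.Ap * Submodule.span ℂ R ≤ LinearMap.ker f.toLinearMap := by
            rw [Submodule.mul_le]
            intro x hx y hy
            have := kR hy
            simp only [LinearMap.mem_ker, AlgHom.toLinearMap_apply] at this ⊢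
            rw [map_mul, this, mul_zero]
          have := this hx
          simp only [LinearMap.mem_ker, AlgHom.toLinearMap_apply] at this ⊢
          rw [map_mul, this, zero_mul]
      refine (smulR hz).trans ?_
      rw [mul_assoc, Submodule.mul_le]
      intro a ha x hx
      suffices hs : S.A0 * (S.Ap ⊓ LinearMap.ker f.toLinearMap) ≤
          Submodule.comap (LinearMap.mulLeft ℂ a) ((LinearMap.ker (S.Pi f)).map S.Th) from hs hx
      rw [Submodule.mul_le]
      rintro b hb z ⟨hz1, hz2⟩
      obtain ⟨p, rfl⟩ : b ∈ S.pH.range := by rw [pH_range]; exact hb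
      refine ⟨⟨a, ha⟩ ⊗ₜ (p ⊗ₜ ⟨z, hz1⟩), ?_, by simp [Th_tmul]⟩
      have : S.resp f ⟨z, hz1⟩ = 0 := Subtype.ext hz2
      simp [Pi, this]
    · refine (S.ideal_minus hS hR' cR').trans ?_
      have hz : S.Am * Submodule.span ℂ R' * S.Am ≤ S.Am ⊓ LinearMap.ker f.toLinearMap := by
        apply le_inf
        · calc _ ≤ S.Am * S.Am * S.Am := smulL (smulR sR')
            _ = _ := by rw [adj_mul_self, adj_mul_self]
        · rw [Submodule.mul_le]
          intro x hx y hy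
          have : S.Am * Submodule.span ℂ R' ≤ LinearMap.ker f.toLinearMap := by
            rw [Submodule.mul_le]
            intro x hx y hy
            have := kR' hy
            simp only [LinearMap.mem_ker, AlgHom.toLinearMap_apply] at this ⊢
            rw [map_mul, this, mul_zero]
          have := this hx
          simp only [LinearMap.mem_ker, AlgHom.toLinearMap_apply] at this ⊢
          rw [map_mul, this, zero_mul]
      refine (smulL (smulL hz)).trans ?_
      rw [mul_assoc, Submodule.mul_le]
      rintro a ⟨ha1, ha2⟩ x hx
      suffices hs : S.A0 * S.Ap ≤
          Submodule.comap (LinearMap.mulLeft ℂ a) ((LinearMap.ker (S.Pi f)).map S.Th) from hs hx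
      rw [Submodule.mul_le]
      rintro b hb z hz1
      obtain ⟨p, rfl⟩ : b ∈ S.pH.range := by rw [pH_range]; exact hb
      refine ⟨⟨a, ha1⟩ ⊗ₜ (p ⊗ₜ ⟨z, hz1⟩), ?_, by simp [Th_tmul]⟩
      have : S.resm f ⟨a, ha1⟩ = 0 := Subtype.ext ha2
      simp [Pi, this]
  rw [injective_iff_map_eq_zero]
  intro t ht
  have hsurj : Function.Surjective (S.Pi f) :=
    TensorProduct.map_surjective (S.resm_surj f)
      (TensorProduct.map_surjective Function.surjective_id (S.resp_surj f))
  obtain ⟨t', rfl⟩ := hsurj t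
  rw [Th_Pi] at ht
  obtain ⟨t'', h1, h2⟩ := key (hker _ ht)
  rw [← hinj h2]; exact h1

end Sys
end QAS
end

section
namespace QAS
open Polynomial
open scoped TensorProduct

theorem exists_quot {B : Type} [Ring B] [Algebra ℂ B] (R R' : Set B) :
    ∃ (D : Type) (_ : Ring D) (_ : Algebra ℂ D) (f : B →ₐ[ℂ] D), (∀ r ∈ R, f r = 0) ∧
      (∀ r ∈ R', f r = 0) ∧ ∀ x, f x = 0 → x ∈ (⊤ * Submodule.span ℂ R * ⊤ ⊔
        ⊤ * Submodule.span ℂ R' * ⊤ : Submodule ℂ B) := by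
  let J0 : Submodule ℂ B := ⊤ * Submodule.span ℂ R * ⊤ ⊔ ⊤ * Submodule.span ℂ R' * ⊤
  have tt : (⊤ : Submodule ℂ B) * ⊤ = ⊤ := by
    rw [eq_top_iff]; intro x _
    rw [← one_mul x]; exact Submodule.mul_mem_mul trivial trivial
  have hl : ⊤ * J0 ≤ J0 := by
    simp only [J0, Submodule.mul_sup, ← mul_assoc, tt, le_refl]
  have hr : J0 * ⊤ ≤ J0 := by
    simp only [J0, Submodule.sup_mul, mul_assoc, tt, le_refl]
  let J : Ideal B :=
    { carrier := J0
      add_mem' := J0.add_mem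
      zero_mem' := J0.zero_mem
      smul_mem' := fun c x hx => hl (Submodule.mul_mem_mul trivial hx) }
  haveI : J.IsTwoSided := ⟨fun {a} b ha => hr (Submodule.mul_mem_mul ha trivial)⟩
  have hin : ∀ T : Set B, ∀ r ∈ T, r ∈ (⊤ * Submodule.span ℂ T * ⊤ : Submodule ℂ B) := by
    intro T r hr
    rw [← one_mul r, ← mul_one (1 * r)]
    exact Submodule.mul_mem_mul (Submodule.mul_mem_mul trivial (Submodule.subset_span hr)) trivial
  refine ⟨B ⧸ J, inferInstance, inferInstance, Ideal.Quotient.mkₐ ℂ J, ?_, ?_, ?_⟩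
  · intro r hr
    exact Ideal.Quotient.eq_zero_iff_mem.2 ((le_sup_left : _ ≤ J0) (hin R r hr))
  · intro r hr
    exact Ideal.Quotient.eq_zero_iff_mem.2 ((le_sup_right : _ ≤ J0) (hin R' r hr))
  · intro x hx
    exact Ideal.Quotient.eq_zero_iff_mem.1 hx

theorem Sys.ext' {B : Type} [Ring B] [Algebra ℂ B] {q : ℂ} {M N : ℕ} {S T : Sys B q M N}
    (h1 : S.xp = T.xp) (h2 : S.xm = T.xm) (h3 : S.k = T.k) (h4 : S.ki = T.ki) (h5 : S.h = T.h) :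
    S = T := by
  cases S; cases T
  simp only at h1 h2 h3 h4 h5
  subst h1 h2 h3 h4 h5
  rfl

section
variable (q : ℂ) (h0 : q ≠ 0) (h2 : q ^ 2 ≠ 1) (M N : ℕ)

theorem SysA_ext {B : Type} [Ring B] [Algebra ℂ B] (l : ℕ) {f g : ALG q M N true l →ₐ[ℂ] B}
    (h : (SysA q h0 h2 M N l).map f = (SysA q h0 h2 M N l).map g) : f = g := by
  apply AlgHom.ext_of_adjoin_eq_top (SysA_gener q h0 h2 M N l)
  rintro x ((⟨i, n, rfl⟩ | (⟨a, rfl⟩ | ⟨a, rfl⟩ | ⟨i, s, rfl⟩)) | ⟨i, n, rfl⟩)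
  · exact congrFun (congrFun (congrArg Sys.xm h) i) n
  · exact (congrFun (congrArg Sys.k h) a)
  · exact (congrFun (congrArg Sys.ki h) a)
  · exact congrFun (congrFun (congrArg Sys.h h) i) s
  · exact congrFun (congrFun (congrArg Sys.xp h) i) n

theorem lift_map {B : Type} [Ring B] [Algebra ℂ B] (S : Sys B q M N) (l : ℕ)
    (e2 : 2 ≤ l → S.L2) (e3 : 3 ≤ l → S.L3) :
    (SysA q h0 h2 M N l).map (S.lift l e2 e3) = S := by
  apply Sys.ext'
  · funext i n; exact S.lift_gi l e2 e3 _
  · funext i n; exact S.lift_gi l e2 e3 _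
  · funext a; exact (S.lift_gi l e2 e3 _).trans (S.gen_kGen a)
  · funext a; exact (S.lift_gi l e2 e3 _).trans (S.gen_kiGen a)
  · funext i n; exact S.lift_gi l e2 e3 _

theorem map_map {B C D : Type} [Ring B] [Algebra ℂ B] [Ring C] [Algebra ℂ C] [Ring D] [Algebra ℂ D]
    {q : ℂ} {M N : ℕ} (S : Sys B q M N) (f : B →ₐ[ℂ] C) (g : C →ₐ[ℂ] D) :
    (S.map f).map g = S.map (g.comp f) := rfl

theorem step12 (h : Function.Injective (SysA q h0 h2 M N 1).Th) :
    Function.Injective (SysA q h0 h2 M N 2).Th := by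
  set S := SysA q h0 h2 M N 1 with hS
  have e2 := SysA_L2 q h0 h2 M N 2 le_rfl
  set T := SysA q h0 h2 M N 2 with hT
  let π := T.lift 1 (by omega) (by omega)
  have hπ : S.map π = T := lift_map _ _ _ _ _ _ _ _ _
  obtain ⟨D, _, _, f, f1, f2, f3⟩ := exists_quot S.R2 S.R2m
  let g := (S.map f).lift 2 (fun _ => S.map_L2 f f1 f2) (by omega)
  have hg : T.map g = S.map f := lift_map _ _ _ _ _ _ _ _ _
  have hgf : g.comp π = f := by
    apply SysA_ext q h0 h2 M N 1
    rw [← map_map, ← hS, hπ, hg]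
  have := S.step (SysA_gener _ _ _ _ _ _) π (R := S.R2) (R' := S.R2m) S.stab_R2
    (S.stab_unop S.opp.stab_R2) S.R2_xm (S.comm_unop S.opp.R2_xm) S.R2_Ap
    (fun r hr => S.opp_Ap r (S.opp.R2_Ap hr)) ?_ ?_ ?_ h
  · rwa [hπ] at this
  · intro r hr
    have h1 : π r ∈ T.R2 := by
      rw [← hπ]; rcases hr with ⟨i, j, m, n, h⟩ | ⟨i, j, m, n, h⟩
      · have : π (S.half.el4 i j m n) = (S.map π).half.el4 i j m n := by
          simp [Half.el4, Sys.half, Sys.map]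
        rw [this]; exact .e4 i j m n h
      · have : π (S.half.el5 i j m n) = (S.map π).half.el5 i j m n := by
          simp [Half.el5, Sys.half, Sys.map]
        rw [this]; exact .e5 i j m n h
    exact e2.p _ h1
  · intro r hr
    have h1 : MulOpposite.op (π r) ∈ T.opp.R2 := by
      have e : MulOpposite.op (π r) = AlgHom.op π (MulOpposite.op r) := rfl
      rw [← hπ, e]; 
      change MulOpposite.op r ∈ S.opp.R2 at hr
      generalize MulOpposite.op r = r' at hr
      rcases hr with ⟨i, j, m, n, h⟩ | ⟨i, j, m, n, h⟩
      · have : AlgHom.op π (S.opp.half.el4 i j m n) = (S.map π).opp.half.el4 i j m n := by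
          rw [Sys.map_opp]; simp [Half.el4, Sys.half, Sys.map]
        rw [this]; exact .e4 i j m n h
      · have : AlgHom.op π (S.opp.half.el5 i j m n) = (S.map π).opp.half.el5 i j m n := by
          rw [Sys.map_opp]; simp [Half.el5, Sys.half, Sys.map]
        rw [this]; exact .e5 i j m n h
    exact (MulOpposite.op_eq_zero_iff _).1 (e2.m _ h1)
  · intro x hx
    apply f3
    rw [← hgf, AlgHom.comp_apply, hx, map_zero]

theorem step23 (h : Function.Injective (SysA q h0 h2 M N 2).Th) :
    Function.Injective (SysA q h0 h2 M N 3).Th := by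
  have s2 := SysA_L2 q h0 h2 M N 2 le_rfl
  set S := SysA q h0 h2 M N 2 with hS
  have e2 := SysA_L2 q h0 h2 M N 3 (by omega)
  have e3 := SysA_L3 q h0 h2 M N 3 le_rfl
  set T := SysA q h0 h2 M N 3 with hT
  let π := T.lift 2 (fun _ => e2) (by omega)
  have hπ : S.map π = T := lift_map _ _ _ _ _ _ _ _ _
  obtain ⟨D, _, _, f, f1, f2, f3⟩ := exists_quot S.R3 S.R3m
  let g := (S.map f).lift 3 (fun _ => S.map_L2 f (fun r hr => by rw [s2.p r hr, map_zero])
    (fun r hr => by rw [(MulOpposite.op_eq_zero_iff _).1 (s2.m _ hr), map_zero]))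
    (fun _ => S.map_L3 f f1 f2)
  have hg : T.map g = S.map f := lift_map _ _ _ _ _ _ _ _ _
  have hgf : g.comp π = f := by
    apply SysA_ext q h0 h2 M N 2
    rw [← map_map, ← hS, hπ, hg]
  have := S.step (SysA_gener _ _ _ _ _ _) π (R := S.R3) (R' := S.R3m) S.stab_R3
    (S.stab_unop S.opp.stab_R3) (S.R3_xm (S.R4_of s2.p) (S.R5_of s2.p))
    (S.comm_unop (S.opp.R3_xm (S.opp.R4_of s2.m) (S.opp.R5_of s2.m))) S.R3_Ap
    (fun r hr => S.opp_Ap r (S.opp.R3_Ap hr)) ?_ ?_ ?_ h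
  · rwa [hπ] at this
  · intro r hr
    have h1 : π r ∈ T.R3 := by
      rw [← hπ]; rcases hr with ⟨i, j, m, n, k, hi, h⟩ | ⟨a, b, c, ha, hb, hc, m, n, k, u⟩
      · have : π (S.half.elS i j m n k) = (S.map π).half.elS i j m n k := by
          simp [Half.elS, Sys.half, Sys.map, polyJ]
        rw [this]; exact .eS i j m n k hi h
      · have : π (S.half.elO a b c m n k u) = (S.map π).half.elO a b c m n k u := by
          simp [Half.elO, Sys.half, Sys.map, osc1]
        rw [this]; exact .eO a b c ha hb hc m n k u
    exact e3.p _ h1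
  · intro r hr
    have h1 : MulOpposite.op (π r) ∈ T.opp.R3 := by
      have e : MulOpposite.op (π r) = AlgHom.op π (MulOpposite.op r) := rfl
      rw [← hπ, e]; 
      change MulOpposite.op r ∈ S.opp.R3 at hr
      generalize MulOpposite.op r = r' at hr
      rcases hr with ⟨i, j, m, n, k, hi, h⟩ | ⟨a, b, c, ha, hb, hc, m, n, k, u⟩
      · have : AlgHom.op π (S.opp.half.elS i j m n k) = (S.map π).opp.half.elS i j m n k := by
          rw [Sys.map_opp]; simp [Half.elS, Sys.half, Sys.map, polyJ]
        rw [this]; exact .eS i j m n k hi h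
      · have : AlgHom.op π (S.opp.half.elO a b c m n k u) =
            (S.map π).opp.half.elO a b c m n k u := by
          rw [Sys.map_opp]; simp [Half.elO, Sys.half, Sys.map, osc1]
        rw [this]; exact .eO a b c ha hb hc m n k u
    exact (MulOpposite.op_eq_zero_iff _).1 (e3.m _ h1)
  · intro x hx
    apply f3
    rw [← hgf, AlgHom.comp_apply, hx, map_zero]

end
end QAS
end

section
namespace QAS
open Polynomial
open scoped TensorProduct

abbrev Let (M N : ℕ) := Idx M N × ℤ

section induced
variable {M N : ℕ} {V : Type} [AddCommGroup V] [Module ℂ V]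

abbrev WW (M N : ℕ) (V : Type) [AddCommGroup V] [Module ℂ V] := List (Let M N) →₀ V

/-- prepend a letter -/
def ym (l : Let M N) : Module.End ℂ (WW M N V) := Finsupp.lmapDomain V ℂ (fun w => l :: w)

theorem ym_single (l : Let M N) (w) (v : V) :
    ym l (Finsupp.single w v : WW M N V) = Finsupp.single (l :: w) v := by
  simp [ym]

/-- the inclusion of the generating space -/
def io : V →ₗ[ℂ] WW M N V := Finsupp.lsingle []

def recL (F : V →ₗ[ℂ] V) (c : Let M N → ℂ) (D : Let M N → Module.End ℂ (WW M N V)) :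
    List (Let M N) → (V →ₗ[ℂ] WW M N V)
  | [] => io ∘ₗ F
  | l :: w => c l • ((ym l) ∘ₗ recL F c D w) + (D l) ∘ₗ Finsupp.lsingle w

def recE (F : V →ₗ[ℂ] V) (c : Let M N → ℂ) (D : Let M N → Module.End ℂ (WW M N V)) :
    Module.End ℂ (WW M N V) := Finsupp.lsum ℂ (recL F c D)

theorem recE_io (F : V →ₗ[ℂ] V) (c : Let M N → ℂ) (D : Let M N → Module.End ℂ (WW M N V)) (v : V) :
    recE F c D (io v) = io (F v) := by
  simp [recE, io, recL]

theorem recE_ym (F : V →ₗ[ℂ] V) (c : Let M N → ℂ) (D : Let M N → Module.End ℂ (WW M N V)) (l) :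
    recE F c D * ym l = c l • (ym l * recE F c D) + D l := by
  apply Finsupp.lhom_ext
  intro w v
  simp [Module.End.mul_apply, ym_single, recE, recL]

theorem W_ind (Z : Module.End ℂ (WW M N V)) (h0 : ∀ v, Z (io v) = 0)
    (hs : ∀ l, ∃ c : ℂ, Z * ym l = c • (ym l * Z)) : Z = 0 := by
  apply Finsupp.lhom_ext
  intro w
  induction w with
  | nil => intro v; simpa [io] using h0 v
  | cons l w ih =>
    intro v
    obtain ⟨c, hc⟩ := hs l
    have := LinearMap.congr_fun hc (Finsupp.single w v)
    rw [Module.End.mul_apply, ym_single] at this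
    rw [this, LinearMap.smul_apply, Module.End.mul_apply, ih v]
    simp

end induced

theorem phiG_commute {B : Type} [Ring B] [Algebra ℂ B] (t : ℂ) (k ki : B) (h : {s : ℤ // s ≠ 0} → B)
    (b : Bool) (m : ℤ) (x : B) (hk : Commute x k) (hki : Commute x ki) (hh : ∀ s, Commute x (h s)) :
    Commute x (phiG t k ki h b m) := by
  have hz' : ∀ s, Commute x (hz h s) := by
    intro s; unfold hz; split_ifs with h
    · exact (hh _)
    · exact Commute.zero_right _
  unfold phiG pg
  split_ifs
  · exact Commute.mul_right hk (expC_commute _ _ _ (fun s => hz' _) _)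
  · exact Commute.zero_right _
  · exact Commute.mul_right hki (expC_commute _ _ _ (fun s => hz' _) _)
  · exact Commute.zero_right _

/-- representation of the Borel part -/
structure Bor (V : Type) [AddCommGroup V] [Module ℂ V] (q : ℂ) (M N : ℕ) where
  hq0 : q ≠ 0
  hq2 : q ^ 2 ≠ 1
  xp : Idx M N → ℤ → Module.End ℂ V
  k : JJ M N → Module.End ℂ V
  ki : JJ M N → Module.End ℂ V
  h : Idx M N → {s : ℤ // s ≠ 0} → Module.End ℂ V
  kki : ∀ a, k a * ki a = 1
  kik : ∀ a, ki a * k a = 1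
  kk : ∀ a b, k a * k b = k b * k a
  kh : ∀ a i s, k a * h i s = h i s * k a
  hh : ∀ i j s t, h i s * h j t = h j t * h i s
  kxp : ∀ a j n, k a * xp j n = (q ^ wt a j) • (xp j n * k a)
  hxp : ∀ i j s n, h i s * xp j n - xp j n * h i s = coh q i j s.1 • xp j (n + s.1)

namespace Bor
variable {V : Type} [AddCommGroup V] [Module ℂ V] {q : ℂ} {M N : ℕ} (T : Bor V q M N)

def wk (a : JJ M N) : Module.End ℂ (WW M N V) := recE (T.k a) (fun l => q ^ (- wt a l.1)) (fun _ => 0)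
def wki (a : JJ M N) : Module.End ℂ (WW M N V) := recE (T.ki a) (fun l => q ^ (wt a l.1)) (fun _ => 0)
def wh (i : Idx M N) (s : {s : ℤ // s ≠ 0}) : Module.End ℂ (WW M N V) :=
  recE (T.h i s) (fun _ => 1) (fun l => - (coh q i l.1 s.1 • ym (l.1, l.2 + s.1)))
def wphi (b : Bool) (i : Idx M N) (m : ℤ) : Module.End ℂ (WW M N V) :=
  phiG (tq q i) (T.wk (toJ i)) (T.wki (toJ i)) (T.wh i) b m
def wx (i : Idx M N) (m : ℤ) : Module.End ℂ (WW M N V) :=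
  recE (T.xp i m) (fun l => sgn M i.1 l.1.1)
    (fun l => if i = l.1 then (tq q i)⁻¹ • (T.wphi true i (m + l.2) - T.wphi false i (m + l.2)) else 0)

theorem k_ym (a j n) : T.wk a * ym (j, n) = q ^ (- wt a j) • (ym (j, n) * T.wk a) := by
  simp only [wk, recE_ym, add_zero]
theorem ki_ym (a j n) : T.wki a * ym (j, n) = q ^ (wt a j) • (ym (j, n) * T.wki a) := by
  simp only [wki, recE_ym, add_zero]
theorem h_ym (i s j n) : T.wh i s * ym (j, n) =
    ym (j, n) * T.wh i s - coh q i j s.1 • ym (j, n + s.1) := by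
  simp only [wh, recE_ym, one_smul, sub_eq_add_neg]
theorem x_ym (i m j n) : T.wx i m * ym (j, n) = sgn M i.1 j.1 • (ym (j, n) * T.wx i m) +
    if i = j then (tq q i)⁻¹ • (T.wphi true i (m + n) - T.wphi false i (m + n)) else 0 := by
  simp only [wx, recE_ym]
theorem k_io (a v) : T.wk a (io v) = io (T.k a v) := recE_io _ _ _ _
theorem ki_io (a v) : T.wki a (io v) = io (T.ki a v) := recE_io _ _ _ _
theorem h_io (i s v) : T.wh i s (io v) = io (T.h i s v) := recE_io _ _ _ _
theorem x_io (i m v) : T.wx i m (io v) = io (T.xp i m v) := recE_io _ _ _ _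

theorem wkki (a) : T.wk a * T.wki a = 1 := by
  rw [← sub_eq_zero]
  apply W_ind
  · intro v
    have := LinearMap.congr_fun (T.kki a) v
    simp only [Module.End.mul_apply, Module.End.one_apply] at this
    simp [k_io, ki_io, this]
  · rintro ⟨j, n⟩
    refine ⟨1, ?_⟩
    have h : q ^ wt a j * q ^ (- wt a j) = 1 := by
      rw [← zpow_add₀ T.hq0]; simp
    rw [sub_mul, mul_assoc, ki_ym, mul_smul_comm, ← mul_assoc, k_ym, smul_mul_assoc, smul_smul, h]
    simp [mul_sub, mul_assoc]

theorem wkik (a) : T.wki a * T.wk a = 1 := by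
  rw [← sub_eq_zero]
  apply W_ind
  · intro v
    have := LinearMap.congr_fun (T.kik a) v
    simp only [Module.End.mul_apply, Module.End.one_apply] at this
    simp [k_io, ki_io, this]
  · rintro ⟨j, n⟩
    refine ⟨1, ?_⟩
    have h : q ^ (-wt a j) * q ^ (wt a j) = 1 := by
      rw [← zpow_add₀ T.hq0]; simp
    rw [sub_mul, mul_assoc, k_ym, mul_smul_comm, ← mul_assoc, ki_ym, smul_mul_assoc, smul_smul, h]
    simp [mul_sub, mul_assoc]

theorem wkk (a b) : T.wk a * T.wk b = T.wk b * T.wk a := by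
  rw [← sub_eq_zero]
  apply W_ind
  · intro v
    have := LinearMap.congr_fun (T.kk a b) v
    simp only [Module.End.mul_apply] at this
    simp [k_io, this]
  · rintro ⟨j, n⟩
    refine ⟨q ^ (-wt a j) * q ^ (-wt b j), ?_⟩
    rw [sub_mul, mul_assoc, mul_assoc, k_ym, k_ym, mul_smul_comm, mul_smul_comm, ← mul_assoc,
      ← mul_assoc, k_ym, k_ym]
    simp only [smul_mul_assoc, smul_smul, mul_sub, mul_assoc]
    module

theorem wkh (a i s) : T.wk a * T.wh i s = T.wh i s * T.wk a := by
  rw [← sub_eq_zero]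
  apply W_ind
  · intro v
    have := LinearMap.congr_fun (T.kh a i s) v
    simp only [Module.End.mul_apply] at this
    simp [k_io, h_io, this]
  · rintro ⟨j, n⟩
    refine ⟨q ^ (-wt a j), ?_⟩
    rw [sub_mul, mul_assoc, mul_assoc, k_ym, h_ym, mul_smul_comm, mul_sub, mul_smul_comm, ← mul_assoc,
      ← mul_assoc, k_ym, h_ym, k_ym]
    simp only [smul_mul_assoc, smul_smul, mul_sub, sub_mul, mul_assoc]
    module

theorem whh (i j s t) : T.wh i s * T.wh j t = T.wh j t * T.wh i s := by
  rw [← sub_eq_zero]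
  apply W_ind
  · intro v
    have := LinearMap.congr_fun (T.hh i j s t) v
    simp only [Module.End.mul_apply] at this
    simp [h_io, this]
  · rintro ⟨j', n⟩
    refine ⟨1, ?_⟩
    rw [sub_mul, mul_assoc, mul_assoc, h_ym, h_ym, mul_sub, mul_sub, mul_smul_comm, mul_smul_comm,
      ← mul_assoc, ← mul_assoc]
    simp only [h_ym]
    rw [add_right_comm n t.1 s.1]
    simp only [smul_mul_assoc, smul_smul, mul_sub, sub_mul, mul_assoc]
    module

theorem wkih (a i s) : Commute (T.wh i s) (T.wki a) := by
  have : T.wki a * (T.wk a * T.wh i s) * T.wki a = T.wki a * (T.wh i s * T.wk a) * T.wki a := by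
    rw [wkh]
  rw [← mul_assoc, wkik, one_mul, mul_assoc, mul_assoc, wkki, mul_one] at this
  exact this

theorem wkki2 (a b) : Commute (T.wk b) (T.wki a) := by
  have : T.wki a * (T.wk a * T.wk b) * T.wki a = T.wki a * (T.wk b * T.wk a) * T.wki a := by
    rw [wkk]
  rw [← mul_assoc, wkik, one_mul, mul_assoc, mul_assoc, wkki, mul_one] at this
  exact this

theorem h_phi (i s b j m) : T.wh i s * T.wphi b j m = T.wphi b j m * T.wh i s :=
  phiG_commute _ _ _ _ _ _ _ (T.wkh _ _ _).symm (T.wkih _ _ _) (fun t => T.whh _ _ _ _)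
theorem k_phi (a b j m) : T.wk a * T.wphi b j m = T.wphi b j m * T.wk a :=
  phiG_commute _ _ _ _ _ _ _ (T.wkk _ _) (T.wkki2 _ _) (fun t => T.wkh _ _ _)

theorem wkx (a i m) : T.wk a * T.wx i m = q ^ wt a i • (T.wx i m * T.wk a) := by
  rw [← sub_eq_zero]
  apply W_ind
  · intro v
    have := LinearMap.congr_fun (T.kxp a i m) v
    simp only [Module.End.mul_apply, LinearMap.smul_apply] at this
    simp [k_io, x_io, this]
  · rintro ⟨j, n⟩
    refine ⟨q ^ (-wt a j) * sgn M i.1 j.1, ?_⟩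
    rw [sub_mul, mul_assoc, smul_mul_assoc, mul_assoc, k_ym, x_ym, mul_smul_comm, mul_add,
      mul_smul_comm, ← mul_assoc, ← mul_assoc, k_ym, x_ym]
    split_ifs with hij
    · subst hij
      have h : q ^ wt a i * q ^ (- wt a i) = 1 := by
        rw [← zpow_add₀ T.hq0]; simp
      simp only [smul_mul_assoc, smul_smul, mul_sub, sub_mul, mul_assoc, smul_add, add_mul, smul_sub,
        mul_smul_comm, k_phi, h, one_mul]
      match_scalars <;> first | ring1 | linear_combination (-(tq q i)⁻¹) * h | linear_combination ((tq q i)⁻¹) * h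
    · simp only [smul_mul_assoc, smul_smul, mul_sub, sub_mul, mul_assoc, mul_zero, add_zero,
        mul_smul_comm]
      module

theorem whx (i j s n) : T.wh i s * T.wx j n - T.wx j n * T.wh i s = coh q i j s.1 • T.wx j (n + s.1) := by
  rw [← sub_eq_zero]
  apply W_ind
  · intro v
    have := LinearMap.congr_fun (T.hxp i j s n) v
    simp only [Module.End.mul_apply, LinearMap.smul_apply, LinearMap.sub_apply] at this
    simp only [LinearMap.sub_apply, LinearMap.smul_apply, Module.End.mul_apply, h_io, x_io]
    rw [← map_sub, ← map_smul, ← map_sub, this, sub_self, map_zero]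
  · rintro ⟨j', m⟩
    refine ⟨sgn M j.1 j'.1, ?_⟩
    rw [sub_mul, sub_mul, mul_assoc, mul_assoc, smul_mul_assoc, h_ym, x_ym, x_ym, mul_add,
      mul_sub, mul_smul_comm, mul_smul_comm, ← mul_assoc, ← mul_assoc, h_ym, x_ym, x_ym]
    split_ifs with hij
    · subst hij
      rw [show n + (m + s.1) = n + s.1 + m by ring]
      simp only [smul_mul_assoc, smul_smul, mul_sub, sub_mul, mul_assoc, smul_add, add_mul, smul_sub,
        mul_smul_comm, h_phi]
      module
    · simp only [smul_mul_assoc, smul_smul, mul_sub, sub_mul, mul_assoc, mul_zero, add_zero,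
        mul_smul_comm]
      module

/-- the induced system -/
def ind : Sys (Module.End ℂ (WW M N V)) q M N where
  hq0 := T.hq0
  hq2 := T.hq2
  xp := T.wx
  xm := fun j n => ym (j, n)
  k := T.wk
  ki := T.wki
  h := T.wh
  kki := T.wkki
  kik := T.wkik
  kk := T.wkk
  kh := T.wkh
  hh := T.whh
  kxp := T.wkx
  kxm := T.k_ym
  hxp := T.whx
  hxm := fun i j s n => by rw [h_ym]; module
  xx := fun i j m n => by rw [x_ym]; simp only [wphi]; module

end Bor
end QAS
end

section
namespace QAS
open Polynomial
open scoped TensorProduct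

theorem aux_sub {V : Type} [AddCommGroup V] [Module ℂ V] (a b : V) (c : ℂ) :
    a - (a + (-c) • b) = c • b := by module

section freeborel
variable {M N : ℕ}

abbrev Qm (M N : ℕ) := List (Let M N) →₀ PP M N
abbrev LP (M N : ℕ) := AddMonoidAlgebra (PP M N) ℤ

def ev (j : Idx M N) (n : ℤ) (w : List (Let M N)) : LP M N →ₗ[ℂ] Qm M N :=
  (Finsupp.lmapDomain (PP M N) ℂ (fun k => (j, n + k) :: w)) ∘ₗ
    (AddMonoidAlgebra.coeffLinearEquiv ℂ).toLinearMap

theorem ev_single (j : Idx M N) (n w k p) :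
    ev j n w (AddMonoidAlgebra.single k p) = Finsupp.single ((j, n + k) :: w) p := by
  rw [ev, LinearMap.comp_apply]
  exact Finsupp.mapDomain_single

theorem ev_C (j : Idx M N) (n w) (p : PP M N) (y : LP M N) :
    ev j n w (AddMonoidAlgebra.single 0 p * y) = p • ev j n w y := by
  induction y using AddMonoidAlgebra.induction_linear with
  | zero => simp
  | add f g h1 h2 => rw [mul_add, map_add, map_add, h1, h2, smul_add]
  | single k r =>
    rw [AddMonoidAlgebra.single_mul_single, ev_single, ev_single, zero_add]; simp

theorem ev_T (j : Idx M N) (n w) (s : ℤ) (y : LP M N) :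
    ev j n w (AddMonoidAlgebra.single s 1 * y) = ev j (n + s) w y := by
  induction y using AddMonoidAlgebra.induction_linear with
  | zero => simp
  | add f g h1 h2 => rw [mul_add, map_add, map_add, h1, h2]
  | single k r =>
    rw [AddMonoidAlgebra.single_mul_single, ev_single, ev_single, one_mul, add_assoc]

theorem exists_theta (q : ℂ) (h0 : q ≠ 0) (j : Idx M N) : ∃ f : PP M N →ₐ[ℂ] LP M N,
    (∀ a, f (PK a) = q ^ (- wt a j) • AddMonoidAlgebra.single 0 (PK a)) ∧
    (∀ a, f (PKi a) = q ^ (wt a j) • AddMonoidAlgebra.single 0 (PKi a)) ∧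
    ∀ i s, f (PH i s) = AddMonoidAlgebra.single 0 (PH i s) +
      (-coh q i j s.1) • AddMonoidAlgebra.single s.1 1 := by
  refine PP_lift (A := LP M N) (fun a => q ^ (- wt a j) • AddMonoidAlgebra.single 0 (PK a))
    (fun a => q ^ (wt a j) • AddMonoidAlgebra.single 0 (PKi a)) ?_
    (fun i s => AddMonoidAlgebra.single 0 (PH i s) + (-coh q i j s.1) • AddMonoidAlgebra.single s.1 1)
  intro a
  have h : q ^ (-wt a j) * q ^ (wt a j) = 1 := by
    rw [← zpow_add₀ h0]; simp
  rw [smul_mul_smul_comm, h, AddMonoidAlgebra.single_mul_single, PK_PKi, one_smul]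
  rfl

def theta (q : ℂ) (h0 : q ≠ 0) (j : Idx M N) : PP M N →ₐ[ℂ] LP M N := (exists_theta q h0 j).choose

def bx (q : ℂ) (h0 : q ≠ 0) (j : Idx M N) (n : ℤ) : Module.End ℂ (Qm M N) :=
  Finsupp.lsum ℂ (fun w => ev j n w ∘ₗ (theta q h0 j).toLinearMap)

theorem bx_single (q : ℂ) (h0 : q ≠ 0) (j : Idx M N) (n : ℤ) (w p) :
    bx q h0 j n (Finsupp.single w p) = ev j n w (theta q h0 j p) := by
  simp [bx]

theorem bx_one (q : ℂ) (h0 : q ≠ 0) (j : Idx M N) (n : ℤ) (w) :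
    bx q h0 j n (Finsupp.single w 1) = Finsupp.single ((j, n) :: w) 1 := by
  rw [bx_single, map_one]
  change ev j n w (AddMonoidAlgebra.single 0 1) = _
  rw [ev_single, add_zero]

def sc : PP M N →ₐ[ℂ] Module.End ℂ (Qm M N) := Algebra.lsmul ℂ ℂ (Qm M N)

theorem sc_apply (p : PP M N) (v : Qm M N) : sc p v = p • v := rfl

def BorQ (q : ℂ) (h0 : q ≠ 0) (h2 : q ^ 2 ≠ 1) (M N : ℕ) : Bor (Qm M N) q M N where
  hq0 := h0
  hq2 := h2
  xp := bx q h0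
  k a := sc (PK a)
  ki a := sc (PKi a)
  h i s := sc (PH i s)
  kki a := by rw [← map_mul, PK_PKi, map_one]
  kik a := by rw [← map_mul, mul_comm, PK_PKi, map_one]
  kk a b := by rw [← map_mul, mul_comm, map_mul]
  kh a i s := by rw [← map_mul, mul_comm, map_mul]
  hh i j s t := by rw [← map_mul, mul_comm, map_mul]
  kxp a j n := by
    apply Finsupp.lhom_ext
    intro w p
    have h : q ^ wt a j * q ^ (-wt a j) = 1 := by
      rw [← zpow_add₀ h0]; simp
    simp only [Module.End.mul_apply, LinearMap.smul_apply, sc_apply, Finsupp.smul_single, bx_single,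
      smul_eq_mul, map_mul]
    rw [theta, (exists_theta q h0 j).choose_spec.1, smul_mul_assoc, map_smul, ev_C, smul_smul, h,
      one_smul]
  hxp i j s n := by
    apply Finsupp.lhom_ext
    intro w p
    change sc (PH i s) (bx q h0 j n (Finsupp.single w p)) -
      bx q h0 j n (sc (PH i s) (Finsupp.single w p)) = coh q i j s.1 • bx q h0 j (n + s.1) (Finsupp.single w p)
    simp only [Module.End.mul_apply, LinearMap.smul_apply, sc_apply,
      Finsupp.smul_single, bx_single, smul_eq_mul, map_mul]
    rw [theta, (exists_theta q h0 j).choose_spec.2.2, add_mul, smul_mul_assoc, map_add, map_smul,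
      ev_C, ev_T]
    exact aux_sub (V := Qm M N) _ _ _

end freeborel

section
variable (q : ℂ) (h0 : q ≠ 0) (h2 : q ^ 2 ≠ 1) (M N : ℕ)

abbrev SW : Sys (Module.End ℂ (WW M N (Qm M N))) q M N := (BorQ q h0 h2 M N).ind

theorem SW_pH (p : PP M N) (v : Qm M N) : (SW q h0 h2 M N).pH p (io v) = io (p • v) := by
  have hp : p ∈ Algebra.adjoin ℂ (Pgens M N) := by rw [PP_gen]; trivial
  induction hp using Algebra.adjoin_induction generalizing v with
  | mem x hx =>
    rcases hx with (⟨a, rfl⟩ | ⟨a, rfl⟩ | ⟨i, s, rfl⟩)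
    · rw [Sys.pH_K]; exact Bor.k_io _ _ _
    · rw [Sys.pH_Ki]; exact Bor.ki_io _ _ _
    · rw [Sys.pH_H]; exact Bor.h_io _ _ _ _
  | algebraMap c => 
    rw [AlgHom.commutes, Module.algebraMap_end_apply, ← map_smul, algebraMap_smul]
  | add x y _ _ h1 h2 => rw [map_add, LinearMap.add_apply, h1, h2, add_smul, map_add]
  | mul x y _ _ h1 h2 => rw [map_mul, Module.End.mul_apply, h2, h1, mul_smul]

end

/-- words -/
def Sys.wp {B : Type} [Ring B] [Algebra ℂ B] {q : ℂ} {M N : ℕ} (S : Sys B q M N)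
    (w : List (Let M N)) : ↥(Algebra.adjoin ℂ S.gp) :=
  (w.map (fun l => (⟨S.xp l.1 l.2, Algebra.subset_adjoin ⟨l.1, l.2, rfl⟩⟩ : ↥(Algebra.adjoin ℂ S.gp)))).prod
def Sys.wm {B : Type} [Ring B] [Algebra ℂ B] {q : ℂ} {M N : ℕ} (S : Sys B q M N)
    (w : List (Let M N)) : ↥(Algebra.adjoin ℂ S.gm) :=
  (w.map (fun l => (⟨S.xm l.1 l.2, Algebra.subset_adjoin ⟨l.1, l.2, rfl⟩⟩ : ↥(Algebra.adjoin ℂ S.gm)))).prod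

section
variable {B : Type} [Ring B] [Algebra ℂ B] {q : ℂ} {M N : ℕ} (S : Sys B q M N)

theorem words_span {L : Type} (x : L → B) (A : Subalgebra ℂ B) (hA : A = Algebra.adjoin ℂ (Set.range x))
    (hx : ∀ l, x l ∈ A) :
    Submodule.span ℂ (Set.range (fun w : List L => (w.map (fun l => (⟨x l, hx l⟩ : A))).prod)) = ⊤ := by
  subst hA
  rw [eq_top_iff]
  rintro ⟨a, ha⟩ -
  have : a ∈ (Submodule.span ℂ (Set.range (fun w : List L =>
      (w.map (fun l => (⟨x l, hx l⟩ : Algebra.adjoin ℂ (Set.range x)))).prod))).map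
      (Algebra.adjoin ℂ (Set.range x)).val.toLinearMap := by
    have h := ha
    rw [← Subalgebra.mem_toSubmodule, Algebra.adjoin_eq_span] at h
    refine Submodule.span_le.2 ?_ h
    intro y hy
    obtain ⟨l, hl, rfl⟩ := Submonoid.exists_list_of_mem_closure hy
    have : ∃ w : List L, w.map x = l := by
      clear hy
      induction l with
      | nil => exact ⟨[], rfl⟩
      | cons z l ih =>
        obtain ⟨w, hw⟩ := ih (fun y hy => hl y (List.mem_cons_of_mem _ hy))
        obtain ⟨c, rfl⟩ := hl z (List.mem_cons_self)
        exact ⟨c :: w, by simp [hw]⟩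
    obtain ⟨w, rfl⟩ := this
    refine ⟨_, Submodule.subset_span ⟨w, rfl⟩, ?_⟩
    simp only [AlgHom.toLinearMap_apply, map_list_prod, List.map_map]
    rfl
  obtain ⟨b, hb, hb'⟩ := this
  have : b = ⟨a, ha⟩ := Subtype.ext hb'
  rw [← this]; exact hb

theorem wp_span : Submodule.span ℂ (Set.range S.wp) = ⊤ := by
  refine words_span (fun l : Let M N => S.xp l.1 l.2) (Algebra.adjoin ℂ S.gp) ?_ _
  congr 1
  ext x; constructor
  · rintro ⟨i, n, rfl⟩; exact ⟨(i, n), rfl⟩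
  · rintro ⟨⟨i, n⟩, rfl⟩; exact ⟨i, n, rfl⟩

theorem wm_span : Submodule.span ℂ (Set.range S.wm) = ⊤ := by
  refine words_span (fun l : Let M N => S.xm l.1 l.2) (Algebra.adjoin ℂ S.gm) ?_ _
  congr 1
  ext x; constructor
  · rintro ⟨i, n, rfl⟩; exact ⟨(i, n), rfl⟩
  · rintro ⟨⟨i, n⟩, rfl⟩; exact ⟨i, n, rfl⟩

/-- from the free module to the tensor product -/
def LL : WW M N (Qm M N) →ₗ[ℂ] (↥(Algebra.adjoin ℂ S.gm) ⊗[ℂ] (PP M N ⊗[ℂ] ↥(Algebra.adjoin ℂ S.gp))) :=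
  Finsupp.lsum ℂ (fun w1 => (TensorProduct.mk ℂ _ _ (S.wm w1)) ∘ₗ
    Finsupp.lsum ℂ (fun w2 => (TensorProduct.mk ℂ (PP M N) _).flip (S.wp w2)))

theorem LL_single (w1 w2 p) : LL S (Finsupp.single w1 (Finsupp.single w2 p)) =
    S.wm w1 ⊗ₜ (p ⊗ₜ S.wp w2) := by
  simp [LL]

theorem LL_surj : Function.Surjective (LL S) := by
  rw [← LinearMap.range_eq_top, eq_top_iff]
  rintro t -
  induction t using TensorProduct.induction_on with
  | zero => exact zero_mem _
  | add x y h1 h2 => exact add_mem h1 h2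
  | tmul a y =>
    induction y using TensorProduct.induction_on with
    | zero => rw [TensorProduct.tmul_zero]; exact zero_mem _
    | add x y h1 h2 => rw [TensorProduct.tmul_add]; exact add_mem h1 h2
    | tmul p c =>
      have ha : a ∈ Submodule.span ℂ (Set.range S.wm) := by rw [wm_span]; trivial
      have hc : c ∈ Submodule.span ℂ (Set.range S.wp) := by rw [wp_span]; trivial
      induction ha using Submodule.span_induction with
      | zero => rw [TensorProduct.zero_tmul]; exact zero_mem _
      | add x y _ _ h1 h2 => rw [TensorProduct.add_tmul]; exact add_mem h1 h2
      | smul r x _ h => rw [← TensorProduct.smul_tmul']; exact Submodule.smul_mem _ _ h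
      | mem x hx =>
        obtain ⟨w1, rfl⟩ := hx
        induction hc using Submodule.span_induction with
        | zero => rw [TensorProduct.tmul_zero, TensorProduct.tmul_zero]; exact zero_mem _
        | add x y _ _ h1 h2 => rw [TensorProduct.tmul_add, TensorProduct.tmul_add]; exact add_mem h1 h2
        | smul r x _ h =>
          rw [TensorProduct.tmul_smul, TensorProduct.tmul_smul]; exact Submodule.smul_mem _ _ h
        | mem x hx =>
          obtain ⟨w2, rfl⟩ := hx
          exact ⟨_, LL_single S w1 w2 p⟩
end

section
variable (q : ℂ) (h0 : q ≠ 0) (h2 : q ^ 2 ≠ 1) (M N : ℕ)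

theorem Th1_inj : Function.Injective (SysA q h0 h2 M N 1).Th := by
  set S := SysA q h0 h2 M N 1 with hS
  set W := SW q h0 h2 M N with hW
  let ρ := W.lift 1 (by omega) (by omega)
  have hρ : S.map ρ = W := lift_map q h0 h2 M N W 1 _ _
  have hx : ∀ i n, ρ (S.xp i n) = W.xp i n := fun i n => congrFun (congrFun (congrArg Sys.xp hρ) i) n
  have hy : ∀ i n, ρ (S.xm i n) = W.xm i n := fun i n => congrFun (congrFun (congrArg Sys.xm hρ) i) n
  have hp : ∀ p, ρ (S.pH p) = W.pH p := by
    intro p; rw [← hρ, Sys.map_pH]; rfl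
  have hwp : ∀ w : List (Let M N), ρ (S.wp w).1 (io (Finsupp.single [] 1)) =
      (io (Finsupp.single w 1) : WW M N (Qm M N)) := by
    intro w
    induction w with
    | nil => simp [Sys.wp]
    | cons l w ih =>
      have : (S.wp (l :: w)).1 = S.xp l.1 l.2 * (S.wp w).1 := by simp [Sys.wp]
      rw [this, map_mul, Module.End.mul_apply, ih, hx]
      refine (Bor.x_io _ _ _ _).trans ?_
      congr 1
      exact bx_one q h0 _ _ _
  have hwm : ∀ (w : List (Let M N)) (v : Qm M N), ρ (S.wm w).1 (io v) = 
      (Finsupp.single w v : WW M N (Qm M N)) := by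
    intro w v
    induction w with
    | nil => simp [Sys.wm, io]
    | cons l w ih =>
      have : (S.wm (l :: w)).1 = S.xm l.1 l.2 * (S.wm w).1 := by simp [Sys.wm]
      rw [this, map_mul, Module.End.mul_apply, ih, hy]
      exact ym_single _ _ _
  have key : ∀ z : WW M N (Qm M N), ρ (S.Th (LL S z)) (io (Finsupp.single [] 1)) = z := by
    intro z
    induction z using Finsupp.induction_linear with
    | zero => simp
    | add f g h1 h2 => rw [map_add, map_add, map_add, LinearMap.add_apply, h1, h2]
    | single w1 v =>
      induction v using Finsupp.induction_linear with
      | zero => simp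
      | add f g h1 h2 => rw [Finsupp.single_add, map_add, map_add, map_add, LinearMap.add_apply, h1, h2]
      | single w2 p =>
        rw [LL_single, Sys.Th_tmul, map_mul, map_mul, Module.End.mul_apply, Module.End.mul_apply, hwp,
          hp, SW_pH, hwm]
        simp
  intro t t' ht
  obtain ⟨z, rfl⟩ := LL_surj S t
  obtain ⟨z', rfl⟩ := LL_surj S t'
  have := key z
  rw [ht, key z'] at this
  rw [this]

theorem Th3_inj : Function.Injective (SysA q h0 h2 M N 3).Th :=
  step23 q h0 h2 M N (step12 q h0 h2 M N (Th1_inj q h0 h2 M N))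
end
end QAS
end

section
namespace QAS
open Polynomial
open scoped TensorProduct

theorem expC_null (t : ℂ) (n : ℕ) : expC t (fun _ => (0 : ℂ)) n = if n = 0 then 1 else 0 := by
  cases n with
  | zero => simp [expC]
  | succ n => simp [expC]

theorem phiG_null (t : ℂ) (m : ℤ) : phiG t (1 : ℂ) 1 (fun _ => 0) true m =
    phiG t (1 : ℂ) 1 (fun _ => 0) false m := by
  simp only [phiG, pg, hz, if_true, dite_eq_ite, ite_self, Bool.false_eq_true, if_false, expC_null]
  rcases lt_trichotomy m 0 with h | h | h
  · rw [if_neg (by omega), if_pos (by omega), if_neg (by omega)]; simp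
  · subst h; simp
  · rw [if_pos (by omega), if_neg (by omega), if_neg (by omega)]; simp

def SysC (q : ℂ) (h0 : q ≠ 0) (h2 : q ^ 2 ≠ 1) (M N : ℕ) : Sys ℂ q M N where
  hq0 := h0
  hq2 := h2
  xp _ _ := 0
  xm _ _ := 0
  k _ := 1
  ki _ := 1
  h _ _ := 0
  kki := by simp
  kik := by simp
  kk := by simp
  kh := by simp
  hh := by simp
  kxp := by simp
  kxm := by simp
  hxp := by simp
  hxm := by simp
  xx := by
    intro i j m n
    rw [phiG_null]; simp

theorem R2_null {B : Type} [Ring B] [Algebra ℂ B] {q : ℂ} {M N : ℕ} (S : Sys B q M N)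
    (h : ∀ i n, S.xp i n = 0) : ∀ r ∈ S.R2, r = 0 := by
  rintro r (⟨i, j, m, n, _⟩ | ⟨i, j, m, n, _⟩)
  · simp [Half.el4, Sys.half, h]
  · simp [Half.el5, Sys.half, h]

theorem R3_null {B : Type} [Ring B] [Algebra ℂ B] {q : ℂ} {M N : ℕ} (S : Sys B q M N)
    (h : ∀ i n, S.xp i n = 0) : ∀ r ∈ S.R3, r = 0 := by
  rintro r hr
  cases hr <;> simp [Half.elS, Half.elO, polyJ, osc1, Sys.half, h]

section
variable (q : ℂ) (h0 : q ≠ 0) (h2 : q ^ 2 ≠ 1) (M N : ℕ)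

theorem ALG_nontrivial (q : ℂ) (h0 : q ≠ 0) (h2 : q ^ 2 ≠ 1) (M N : ℕ) : Nontrivial (ALG q M N true 3) := by
  have f := (SysC q h0 h2 M N).lift 3 (fun _ => ⟨R2_null _ (fun _ _ => rfl), R2_null _ (fun _ _ => rfl)⟩)
    (fun _ => ⟨R3_null _ (fun _ _ => rfl), R3_null _ (fun _ _ => rfl)⟩)
  exact f.toRingHom.domain_nontrivial

theorem flatA {B : Type} [Ring B] [Algebra ℂ B] (A : Subalgebra ℂ B) : Module.Flat ℂ A := by
  haveI : Module.Free ℂ A := Module.Free.of_divisionRing ℂ A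
  infer_instance

theorem pH_inj : Function.Injective (SysA q h0 h2 M N 3).pH := by
  set S := SysA q h0 h2 M N 3
  haveI := ALG_nontrivial q h0 h2 M N
  intro p p' h
  have e1 : S.Th (1 ⊗ₜ (p ⊗ₜ 1)) = S.Th (1 ⊗ₜ (p' ⊗ₜ 1)) := by
    rw [Sys.Th_tmul, Sys.Th_tmul, h]
  have e2 := Th3_inj q h0 h2 M N e1
  haveI f1 : Module.Flat ℂ (PP M N) := inferInstance
  haveI f2 : Module.Flat ℂ ↥(Algebra.adjoin ℂ S.gp) := flatA _
  haveI f3 : Module.Flat ℂ (PP M N ⊗[ℂ] ↥(Algebra.adjoin ℂ S.gp)) :=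
    inferInstance
  have i1 : Function.Injective (fun y : PP M N ⊗[ℂ] ↥(Algebra.adjoin ℂ S.gp) =>
      (1 : ↥(Algebra.adjoin ℂ S.gm)) ⊗ₜ[ℂ] y) :=
    Algebra.TensorProduct.includeRight_injective (R := ℂ) (A := ↥(Algebra.adjoin ℂ S.gm))
      (FaithfulSMul.algebraMap_injective _ _)
  have i2 : Function.Injective (fun y : PP M N =>
      y ⊗ₜ[ℂ] (1 : ↥(Algebra.adjoin ℂ S.gp))) :=
    Algebra.TensorProduct.includeLeft_injective (R := ℂ) (S := ℂ) (B := ↥(Algebra.adjoin ℂ S.gp))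
      (FaithfulSMul.algebraMap_injective _ _)
  exact i2 (i1 e2)

theorem Th3_surj : Function.Surjective (SysA q h0 h2 M N 3).Th := by
  set S := SysA q h0 h2 M N 3 with hS
  rw [← LinearMap.range_eq_top, eq_top_iff, ← S.tri_top (SysA_gener q h0 h2 M N 3), mul_assoc,
    Submodule.mul_le]
  intro a ha y hy
  suffices hs : S.A0 * S.Ap ≤ Submodule.comap (LinearMap.mulLeft ℂ a) (LinearMap.range S.Th) from hs hy
  rw [Submodule.mul_le]
  intro b hb c hc
  obtain ⟨p, rfl⟩ : b ∈ S.pH.range := by rw [Sys.pH_range]; exact hb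
  exact ⟨⟨a, ha⟩ ⊗ₜ (p ⊗ₜ ⟨c, hc⟩), by simp [Sys.Th_tmul]⟩

theorem triMul_bij (A T R : Subalgebra ℂ (ALG q M N true 3))
    (hA : A = Algebra.adjoin ℂ (SysA q h0 h2 M N 3).gm) (hT : T = (SysA q h0 h2 M N 3).pH.range)
    (hR : R = Algebra.adjoin ℂ (SysA q h0 h2 M N 3).gp) :
    Function.Bijective (triMul q M N true 3 A T R) := by
  subst hA hT hR
  set S := SysA q h0 h2 M N 3 with hS
  let e := (AlgEquiv.ofInjective S.pH (pH_inj q h0 h2 M N)).toLinearEquiv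
  let E := TensorProduct.congr (LinearEquiv.refl ℂ ↥(Algebra.adjoin ℂ S.gm))
    (TensorProduct.congr e (LinearEquiv.refl ℂ ↥(Algebra.adjoin ℂ S.gp)))
  have : (triMul q M N true 3 (Algebra.adjoin ℂ S.gm) S.pH.range (Algebra.adjoin ℂ S.gp)) ∘ₗ
      E.toLinearMap = S.Th := by
    apply TensorProduct.ext'
    intro a y
    induction y using TensorProduct.induction_on with
    | zero => rw [TensorProduct.tmul_zero, LinearMap.map_zero, LinearMap.map_zero]
    | add x y h1 h2 => rw [TensorProduct.tmul_add, LinearMap.map_add, LinearMap.map_add, h1, h2]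
    | tmul p c => 
      rw [Sys.Th_tmul]
      simp [E, triMul, e]
  have hb : Function.Bijective S.Th := ⟨Th3_inj q h0 h2 M N, Th3_surj q h0 h2 M N⟩
  rw [← this, LinearMap.coe_comp] at hb
  exact (Function.Bijective.of_comp_iff _ E.bijective).1 hb

theorem adjoin_zero {B : Type} [Ring B] [Algebra ℂ B] (G G' : Set B) (h : G ⊆ G')
    (h' : ∀ x ∈ G', x ∈ G ∨ x = 0) : Algebra.adjoin ℂ G' = Algebra.adjoin ℂ G := by
  apply le_antisymm
  · apply Algebra.adjoin_le
    intro x hx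
    rcases h' x hx with h | h
    · exact Algebra.subset_adjoin h
    · rw [h]; exact zero_mem _
  · exact Algebra.adjoin_mono h

theorem Aplus_eq : Aplus q M N true 3 = Algebra.adjoin ℂ (SysA q h0 h2 M N 3).gp := by
  apply adjoin_zero
  · rintro _ ⟨i, n, rfl⟩
    exact ⟨i.1, n, by rw [XpA, XpF_idx]; rfl⟩
  · rintro _ ⟨i, n, rfl⟩
    by_cases h : 1 ≤ i ∧ i ≤ M + N - 1
    · left; exact ⟨⟨i, h⟩, n, by rw [XpA, XpF, dif_pos h]; rfl⟩
    · right; rw [XpA, XpF, dif_neg h, map_zero]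

theorem Aminus_eq : Aminus q M N true 3 = Algebra.adjoin ℂ (SysA q h0 h2 M N 3).gm := by
  apply adjoin_zero
  · rintro _ ⟨i, n, rfl⟩
    exact ⟨i.1, n, by rw [XmA, XmF_idx]; rfl⟩
  · rintro _ ⟨i, n, rfl⟩
    by_cases h : 1 ≤ i ∧ i ≤ M + N - 1
    · left; exact ⟨⟨i, h⟩, n, by rw [XmA, XmF, dif_pos h]; rfl⟩
    · right; rw [XmA, XmF, dif_neg h, map_zero]

theorem SysA_k (a : JJ M N) : (SysA q h0 h2 M N 3).k a =
    if a.1 = 0 then K0A q M N true 3 else KA q M N true 3 a.1 := by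
  change mkA q M N true 3 (gi (kGen a)) = _
  unfold kGen
  split_ifs with h
  · rw [K0A, K0F, dif_pos rfl]
  · rw [KA, KF, dif_pos ⟨by omega, a.2⟩]

theorem SysA_ki (a : JJ M N) : (SysA q h0 h2 M N 3).ki a =
    if a.1 = 0 then K0iA q M N true 3 else KiA q M N true 3 a.1 := by
  change mkA q M N true 3 (gi (kiGen a)) = _
  unfold kiGen
  split_ifs with h
  · rw [K0iA, K0iF, dif_pos rfl]
  · rw [KiA, KiF, dif_pos ⟨by omega, a.2⟩]

theorem SysA_h (i : Idx M N) (s : {s : ℤ // s ≠ 0}) : (SysA q h0 h2 M N 3).h i s =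
    HA q M N true 3 i.1 s.1 := by
  rw [HA, HF, dif_pos ⟨i.2, s.2⟩]; rfl

theorem Azero_eq : AzeroE q M N true 3 = Algebra.adjoin ℂ (SysA q h0 h2 M N 3).g0 := by
  apply adjoin_zero
  · rintro _ (⟨a, rfl⟩ | ⟨a, rfl⟩ | ⟨i, s, rfl⟩)
    · rw [SysA_k]; split_ifs with h
      · exact Or.inr (Or.inr (Or.inr (Or.inl rfl)))
      · exact Or.inl ⟨_, rfl⟩
    · rw [SysA_ki]; split_ifs with h
      · exact Or.inr (Or.inr (Or.inr (Or.inr rfl)))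
      · exact Or.inr (Or.inl ⟨_, rfl⟩)
    · rw [SysA_h]; exact Or.inr (Or.inr (Or.inl ⟨_, _, rfl⟩))
  · rintro _ (⟨i, rfl⟩ | ⟨i, rfl⟩ | ⟨i, s, rfl⟩ | rfl | rfl)
    · by_cases h : 1 ≤ i ∧ i ≤ M + N - 1
      · left; left; exact ⟨⟨i, h.2⟩, by rw [SysA_k, if_neg (by simp only; omega)]⟩
      · right; rw [KA, KF, dif_neg h, map_zero]
    · by_cases h : 1 ≤ i ∧ i ≤ M + N - 1
      · left; right; left; exact ⟨⟨i, h.2⟩, by rw [SysA_ki, if_neg (by simp only; omega)]⟩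
      · right; rw [KiA, KiF, dif_neg h, map_zero]
    · by_cases h : (1 ≤ i ∧ i ≤ M + N - 1) ∧ s ≠ 0
      · left; right; right; exact ⟨⟨i, h.1⟩, ⟨s, h.2⟩, by rw [SysA_h]⟩
      · right; rw [HA, HF, dif_neg h, map_zero]
    · left; left; exact ⟨⟨0, Nat.zero_le _⟩, by rw [SysA_k, if_pos rfl]⟩
    · left; right; left; exact ⟨⟨0, Nat.zero_le _⟩, by rw [SysA_ki, if_pos rfl]⟩

end
end QAS
end

open QAS in
/-- triangular decomposition `U⁻ ⊗ U'⁰ ⊗ U⁺ ≃ U'` for the enlarged algebra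
`U' = U_q(L'sl(M,N))`, and `U'⁰` is a Laurent polynomial algebra on
`K₀, …, K_{M+N-1}` over the polynomial algebra in the `h_{i,s}`. -/
theorem triangular_decomposition_ext (q : ℂ) (hq0 : q ≠ 0)
    (hq1 : ∀ k : ℕ, k ≠ 0 → q ^ k ≠ 1) (M N : ℕ) (hM : 1 ≤ M) (hN : 1 ≤ N) :
    Function.Bijective
      (triMul q M N true 3 (Aminus q M N true 3) (AzeroE q M N true 3)
        (Aplus q M N true 3)) ∧
    ∃ φ : MvPolynomial (Idx M N × {s : ℤ // s ≠ 0})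
        (AddMonoidAlgebra ℂ ({i : ℕ // i ≤ M + N - 1} →₀ ℤ)) →ₐ[ℂ] ALG q M N true 3,
      (∀ g : Idx M N × {s : ℤ // s ≠ 0},
          φ (MvPolynomial.X g) = HA q M N true 3 g.1.1 g.2.1) ∧
      (∀ i : {i : ℕ // i ≤ M + N - 1},
          φ (MvPolynomial.C (AddMonoidAlgebra.single (Finsupp.single i 1) (1 : ℂ))) =
            (if i.1 = 0 then K0A q M N true 3 else KA q M N true 3 i.1)) ∧
      Function.Injective φ ∧ φ.range = AzeroE q M N true 3 := by
  have hq2 := hq1 2 (by norm_num)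
  have h0 : AzeroE q M N true 3 = (SysA q hq0 hq2 M N 3).pH.range := by
    rw [Sys.pH_range, Azero_eq q hq0 hq2]
  refine ⟨triMul_bij q hq0 hq2 M N _ _ _ (Aminus_eq q hq0 hq2 M N) h0 (Aplus_eq q hq0 hq2 M N),
    (SysA q hq0 hq2 M N 3).pH, ?_, ?_, pH_inj q hq0 hq2 M N, h0.symm⟩
  · rintro ⟨i, s⟩
    exact ((SysA q hq0 hq2 M N 3).pH_H i s).trans (SysA_h q hq0 hq2 M N i s)
  · intro a
    exact ((SysA q hq0 hq2 M N 3).pH_K a).trans (SysA_k q hq0 hq2 M N a)
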